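/- Let n ≥ 2, 1 < p < ∞ and β < 0. Let Ω ⊂ ℝⁿ be a bounded, open, convex set, let Ω* be the ball centered at the origin with P(Ω*) = P(Ω), let v be a first eigenfunction of λ_{p,β}(Ω*), and let v_m be the minimum of v on the closure of Ω*. Then 0 < 1 − (v_m^p/‖v‖_{L^p(Ω*)}^p)(|Ω*| − |Ω|) ≤ 1 and λ_{p,β}(Ω) ≤ λ_{p,β}(Ω*) / (1 − (v_m^p/‖v‖_{L^p(Ω*)}^p)(|Ω*| − |Ω|)). -/

import Mathlib

open MeasureTheory Metric Set Bornology
open scoped NNReal ENNReal Pointwise symmDiff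

noncomputable section

/-- The perimeter of a (convex) set: the `(n-1)`-dimensional Hausdorff measure of its
topological boundary. -/
def perim (n : ℕ) (Ω : Set (EuclideanSpace ℝ (Fin n))) : ℝ :=
  (μH[(n : ℝ) - 1] (frontier Ω)).toReal

/-- The Rayleigh quotient of `u` on `Ω` with boundary parameter `β`. -/
def rayleigh (n : ℕ) (p β : ℝ) (Ω : Set (EuclideanSpace ℝ (Fin n)))
    (u : EuclideanSpace ℝ (Fin n) → ℝ) : ℝ :=
  ((∫ x in Ω, ‖fderiv ℝ u x‖ ^ p) +
      β * ∫ x in frontier Ω, |u x| ^ p ∂(μH[(n : ℝ) - 1])) /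
    ∫ x in Ω, |u x| ^ p

/-- The first Robin eigenvalue of the `p`-Laplacian on `Ω` with boundary parameter `β`. -/
def robinEig (n : ℕ) (p β : ℝ) (Ω : Set (EuclideanSpace ℝ (Fin n))) : ℝ :=
  sInf { r : ℝ | ∃ u : EuclideanSpace ℝ (Fin n) → ℝ,
    (∃ K : ℝ≥0, LipschitzOnWith K u (closure Ω)) ∧
    (0 < ∫ x in Ω, |u x| ^ p) ∧ r = rayleigh n p β Ω u }

/-- `v` is a first eigenfunction for the Robin `p`-Laplacian on `Ω`: a positive radial
Lipschitz function on the closure of `Ω` whose Rayleigh quotient equals `λ_{p,β}(Ω)`. -/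
def IsFirstEigenfunction (n : ℕ) (p β : ℝ) (Ω : Set (EuclideanSpace ℝ (Fin n)))
    (v : EuclideanSpace ℝ (Fin n) → ℝ) : Prop :=
  (∃ K : ℝ≥0, LipschitzOnWith K v (closure Ω)) ∧
  (∀ x ∈ closure Ω, 0 < v x) ∧
  (∃ h : ℝ → ℝ, ∀ x ∈ closure Ω, v x = h ‖x‖) ∧
  (0 < ∫ x in Ω, |v x| ^ p) ∧
  rayleigh n p β Ω v = robinEig n p β Ω

/-- `ω_n`, the Lebesgue measure of the unit ball of `ℝⁿ`. -/
def unitBallVol (n : ℕ) : ℝ :=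
  (volume (ball (0 : EuclideanSpace ℝ (Fin n)) 1)).toReal

/-! ### The Prékopa–Leindler inequality -/

lemma volume_add_le_of_isCompact {A B : Set ℝ} (hA : IsCompact A) (hB : IsCompact B)
    (hA' : A.Nonempty) (hB' : B.Nonempty) : volume A + volume B ≤ volume (A + B) := by
  obtain ⟨a, ha, hamax⟩ := hA.exists_isGreatest hA'
  obtain ⟨b, hb, hbmin⟩ := hB.exists_isLeast hB'
  have h1 : (b +ᵥ A) ∪ ((a +ᵥ B) \ {a + b}) ⊆ A + B := by
    rintro x (⟨y, hy, rfl⟩ | ⟨⟨y, hy, rfl⟩, -⟩)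
    · exact ⟨y, hy, b, hb, by simp [add_comm]⟩
    · exact ⟨a, ha, y, hy, by simp⟩
  have hd : Disjoint (b +ᵥ A) ((a +ᵥ B) \ {a + b}) := by
    rw [Set.disjoint_left]
    rintro x ⟨y, hy, rfl⟩ ⟨⟨z, hz, hzx⟩, hne⟩
    have h1 := hamax hy
    have h2 := hbmin hz
    simp only [vadd_eq_add, mem_singleton_iff] at hzx hne
    exact hne (by linarith)
  calc volume A + volume B = volume (b +ᵥ A) + volume ((a +ᵥ B) \ {a + b}) := by
        rw [measure_sdiff_null (by simp), measure_vadd, measure_vadd]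
    _ = volume ((b +ᵥ A) ∪ ((a +ᵥ B) \ {a + b})) := by
        rw [measure_union hd]
        exact ((hB.vadd a).measurableSet).diff (measurableSet_singleton _)
    _ ≤ _ := measure_mono h1

lemma volume_add_le_of_add_subset {A B C : Set ℝ} (hA : MeasurableSet A) (hB : MeasurableSet B)
    (hA' : A.Nonempty) (hB' : B.Nonempty) (hC : A + B ⊆ C) :
    volume A + volume B ≤ volume C := by
  have key : ∀ K ⊆ A, IsCompact K → ∀ L ⊆ B, IsCompact L → volume K + volume L ≤ volume C := by
    intro K hK hKc L hL hLc
    rcases K.eq_empty_or_nonempty with rfl | hKn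
    · obtain ⟨a, ha⟩ := hA'
      have : a +ᵥ L ⊆ C := by
        rintro x ⟨y, hy, rfl⟩
        exact hC ⟨a, ha, y, hL hy, rfl⟩
      simpa using measure_mono (μ := volume) this
    rcases L.eq_empty_or_nonempty with rfl | hLn
    · obtain ⟨b, hb⟩ := hB'
      have : b +ᵥ K ⊆ C := by
        rintro x ⟨y, hy, rfl⟩
        exact hC ⟨y, hK hy, b, hb, by simp [add_comm]⟩
      simpa using measure_mono (μ := volume) this
    exact (volume_add_le_of_isCompact hKc hLc hKn hLn).trans
      (measure_mono ((add_subset_add hK hL).trans hC))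
  rw [hA.measure_eq_iSup_isCompact, hB.measure_eq_iSup_isCompact]
  simp only [iSup_and']
  exact ENNReal.biSup_add_biSup_le' ⟨∅, by simp⟩ ⟨∅, by simp⟩
    fun K hK L hL => key K hK.1 hK.2 L hL.1 hL.2

/-- `X` satisfies the Prékopa–Leindler inequality. -/
def PrekopaLeindler (X : Type*) [AddCommGroup X] [Module ℝ X] [MeasureSpace X] : Prop :=
  ∀ a b : ℝ, 0 < a → 0 < b → a + b = 1 → ∀ f g h : X → ℝ≥0∞, Measurable f → Measurable g →
    Measurable h → (∀ x y, f x ^ a * g y ^ b ≤ h (a • x + b • y)) →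
    (∫⁻ x, f x) ^ a * (∫⁻ x, g x) ^ b ≤ ∫⁻ x, h x

lemma ENNReal.rpow_mul_rpow_le_add {a b : ℝ} (ha : 0 < a) (hb : 0 < b) (hab : a + b = 1)
    (x y : ℝ≥0∞) : x ^ a * y ^ b ≤ ENNReal.ofReal a * x + ENNReal.ofReal b * y := by
  rcases eq_or_ne x ∞ with rfl | hx
  · simp [ENNReal.mul_top, ha]
  rcases eq_or_ne y ∞ with rfl | hy
  · simp [ENNReal.mul_top, hb]
  lift x to ℝ≥0 using hx
  lift y to ℝ≥0 using hy
  have := NNReal.geom_mean_le_arith_mean2_weighted a.toNNReal b.toNNReal x y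
    (by rw [← Real.toNNReal_add ha.le hb.le, hab, Real.toNNReal_one])
  rw [Real.coe_toNNReal _ ha.le, Real.coe_toNNReal _ hb.le] at this
  rw [← ENNReal.coe_rpow_of_nonneg _ ha.le, ← ENNReal.coe_rpow_of_nonneg _ hb.le]
  simp only [ENNReal.ofReal]
  exact_mod_cast this

/-- The additive form, for functions with supremum one. -/
lemma lintegral_add_le_of_iSup_eq_one {a b : ℝ} (ha : 0 < a) (hb : 0 < b) (hab : a + b = 1)
    {f g h : ℝ → ℝ≥0∞} (hf : Measurable f) (hg : Measurable g) (hh : Measurable h)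
    (hfgh : ∀ x y, f x ^ a * g y ^ b ≤ h (a • x + b • y)) (hf1 : ⨆ x, f x = 1)
    (hg1 : ⨆ x, g x = 1) :
    ENNReal.ofReal a * (∫⁻ x, f x) + ENNReal.ofReal b * (∫⁻ x, g x) ≤ ∫⁻ x, h x := by
  have layer : ∀ u : ℝ → ℝ≥0∞, Measurable u → (∀ x, u x ≤ 1) →
      ∫⁻ x, u x = ∫⁻ t in Ioo (0 : ℝ) 1, volume {x | ENNReal.ofReal t < u x} := by
    intro u hu hu1
    have hfin : ∀ x, u x ≠ ∞ := fun x => ((hu1 x).trans_lt ENNReal.one_lt_top).ne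
    have h1 : ∫⁻ x, u x = ∫⁻ x, ENNReal.ofReal (u x).toReal := by
      simp_rw [ENNReal.ofReal_toReal (hfin _)]
    rw [h1, lintegral_eq_lintegral_meas_lt volume (ae_of_all _ fun x => ENNReal.toReal_nonneg)
      hu.ennreal_toReal.aemeasurable]
    have h2 : ∀ t ∈ Ioi (0 : ℝ), volume {x | t < (u x).toReal} =
        (Ioo (0 : ℝ) 1).indicator (fun t => volume {x | ENNReal.ofReal t < u x}) t := by
      intro t ht
      rw [mem_Ioi] at ht
      by_cases ht1 : t < 1
      · rw [indicator_of_mem (show t ∈ Ioo (0 : ℝ) 1 from ⟨ht, ht1⟩)]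
        congr 1; ext x
        simp [ENNReal.ofReal_lt_iff_lt_toReal ht.le (hfin x)]
      · rw [indicator_of_notMem (fun h => ht1 h.2)]
        convert measure_empty (μ := (volume : Measure ℝ))
        ext x
        simp only [mem_ofPred_eq, mem_empty_iff_false, iff_false, not_lt]
        have := ENNReal.toReal_mono ENNReal.one_ne_top (hu1 x)
        simp only [ENNReal.toReal_one] at this
        linarith [not_lt.1 ht1]
    rw [setLIntegral_congr_fun measurableSet_Ioi h2, ← lintegral_indicator measurableSet_Ioi,
      ← lintegral_indicator measurableSet_Ioo]
    congr 1; ext t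
    by_cases ht : 0 < t
    · simp [indicator, ht]
    · simp [indicator, ht]
  have hfle : ∀ x, f x ≤ 1 := fun x => hf1 ▸ le_iSup f x
  have hgle : ∀ x, g x ≤ 1 := fun x => hg1 ▸ le_iSup g x
  calc ENNReal.ofReal a * (∫⁻ x, f x) + ENNReal.ofReal b * (∫⁻ x, g x)
      = ∫⁻ t in Ioo (0 : ℝ) 1, (ENNReal.ofReal a * volume {x | ENNReal.ofReal t < f x} +
          ENNReal.ofReal b * volume {x | ENNReal.ofReal t < g x}) := by
        have hm : ∀ u : ℝ → ℝ≥0∞,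
            Measurable fun t : ℝ => volume {x | ENNReal.ofReal t < u x} := fun u =>
          Antitone.measurable fun s t hst => measure_mono fun x hx =>
            (ENNReal.ofReal_le_ofReal hst).trans_lt hx
        rw [layer f hf hfle, layer g hg hgle, lintegral_add_left ((hm f).const_mul _),
          lintegral_const_mul _ (hm f), lintegral_const_mul _ (hm g)]
    _ ≤ ∫⁻ t in Ioo (0 : ℝ) 1, volume {x | ENNReal.ofReal t < min (h x) 1} := by
        refine setLIntegral_mono' measurableSet_Ioo fun t ht => ?_
        have hne : ∀ u : ℝ → ℝ≥0∞, ⨆ x, u x = 1 → {x | ENNReal.ofReal t < u x}.Nonempty := by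
          intro u hu
          have : ENNReal.ofReal t < ⨆ x, u x := by rw [hu]; simpa using ht.2
          exact lt_iSup_iff.1 this
        have hsm : ∀ c : ℝ, 0 < c → ∀ s : Set ℝ,
            ENNReal.ofReal c * volume s = volume (c • s) := by
          intro c hc s
          rw [Measure.addHaar_smul]; simp [abs_of_pos hc]
        rw [hsm a ha, hsm b hb]
        refine volume_add_le_of_add_subset ?_ ?_ ((hne f hf1).smul_set) ((hne g hg1).smul_set) ?_
        · exact (measurableSet_lt measurable_const hf).const_smul₀ a
        · exact (measurableSet_lt measurable_const hg).const_smul₀ b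
        · rintro _ ⟨_, ⟨x, hx, rfl⟩, _, ⟨y, hy, rfl⟩, rfl⟩
          simp only [mem_ofPred_eq] at hx hy
          refine lt_min ((lt_of_lt_of_le ?_ (hfgh x y))) (by simpa using ht.2)
          have ht0 : ENNReal.ofReal t ≠ 0 := by simpa using ht.1
          calc ENNReal.ofReal t = ENNReal.ofReal t ^ a * ENNReal.ofReal t ^ b := by
                rw [← ENNReal.rpow_add _ _ ht0 ENNReal.ofReal_ne_top, hab, ENNReal.rpow_one]
            _ < _ := ENNReal.mul_lt_mul (ENNReal.rpow_lt_rpow hx ha) (ENNReal.rpow_lt_rpow hy hb)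
    _ = ∫⁻ x, min (h x) 1 := (layer _ (hh.min measurable_const) fun x => min_le_right _ _).symm
    _ ≤ _ := lintegral_mono fun x => min_le_left _ _

lemma prekopaLeindler_real : PrekopaLeindler ℝ := by
  intro a b ha hb hab f g h hf hg hh hfgh
  -- bounded case
  have bdd : ∀ f g : ℝ → ℝ≥0∞, Measurable f → Measurable g → (⨆ x, f x ≠ ∞) → (⨆ x, g x ≠ ∞) →
      (∀ x y, f x ^ a * g y ^ b ≤ h (a • x + b • y)) →
      (∫⁻ x, f x) ^ a * (∫⁻ x, g x) ^ b ≤ ∫⁻ x, h x := by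
    intro f g hf hg hft hgt hfgh
    set A := ⨆ x, f x with hA
    set B := ⨆ x, g x with hB
    rcases eq_or_ne A 0 with hA0 | hA0
    · have : ∀ x, f x = 0 := by simpa [hA] using hA0
      simp [this, ha]
    rcases eq_or_ne B 0 with hB0 | hB0
    · have : ∀ x, g x = 0 := by simpa [hB] using hB0
      simp [this, hb]
    set c := A ^ a * B ^ b with hc
    have hc0 : c ≠ 0 := by simp [hc, hA0, hB0, hft, hgt]
    have hct : c ≠ ∞ := ENNReal.mul_ne_top (ENNReal.rpow_ne_top_of_nonneg ha.le hft)
      (ENNReal.rpow_ne_top_of_nonneg hb.le hgt)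
    have hci : c⁻¹ = A⁻¹ ^ a * B⁻¹ ^ b := by
      rw [hc, ENNReal.mul_inv, ENNReal.inv_rpow, ENNReal.inv_rpow]
      · left; simp [hA0, hft]
      · left; exact ENNReal.rpow_ne_top_of_nonneg ha.le hft
    have := lintegral_add_le_of_iSup_eq_one ha hb hab (hf.const_mul A⁻¹) (hg.const_mul B⁻¹)
      (hh.const_mul c⁻¹) (fun x y => by
        rw [ENNReal.mul_rpow_of_nonneg _ _ ha.le, ENNReal.mul_rpow_of_nonneg _ _ hb.le, hci,
          mul_mul_mul_comm]
        gcongr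
        exact hfgh x y)
      (by rw [← ENNReal.mul_iSup, ← hA, ENNReal.inv_mul_cancel hA0 hft])
      (by rw [← ENNReal.mul_iSup, ← hB, ENNReal.inv_mul_cancel hB0 hgt])
    have h2 := (ENNReal.rpow_mul_rpow_le_add ha hb hab _ _).trans this
    rw [lintegral_const_mul _ hf, lintegral_const_mul _ hg, lintegral_const_mul _ hh,
      ENNReal.mul_rpow_of_nonneg _ _ ha.le, ENNReal.mul_rpow_of_nonneg _ _ hb.le,
      mul_mul_mul_comm, ← hci] at h2
    exact (ENNReal.mul_le_mul_iff_right (by simpa using hct) (by simpa using hc0)).1 h2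
  have trunc : ∀ u : ℝ → ℝ≥0∞, Measurable u →
      Filter.Tendsto (fun N : ℕ => ∫⁻ x, min (u x) N) Filter.atTop (nhds (∫⁻ x, u x)) := by
    intro u hu
    refine lintegral_tendsto_of_tendsto_of_monotone
      (fun N => (hu.min measurable_const).aemeasurable) (ae_of_all _ fun x M N hMN => ?_)
      (ae_of_all _ fun x => ?_)
    · dsimp only; gcongr
    · have : Filter.Tendsto (fun N : ℕ => min (u x) (N : ℝ≥0∞)) Filter.atTop
          (nhds (min (u x) ∞)) := tendsto_const_nhds.min ENNReal.tendsto_nat_nhds_top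
      simpa using this
  have hN : ∀ N : ℕ, (∫⁻ x, min (f x) N) ^ a * (∫⁻ x, min (g x) N) ^ b ≤ ∫⁻ x, h x := by
    intro N
    refine bdd _ _ (hf.min measurable_const) (hg.min measurable_const) ?_ ?_ ?_
    · exact ((iSup_le fun x => min_le_right _ _).trans_lt (ENNReal.natCast_lt_top N)).ne
    · exact ((iSup_le fun x => min_le_right _ _).trans_lt (ENNReal.natCast_lt_top N)).ne
    · intro x y
      refine le_trans ?_ (hfgh x y)
      gcongr <;> exact min_le_left _ _
  rcases eq_or_ne (∫⁻ x, f x) 0 with hf0 | hf0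
  · simp [hf0, ha]
  rcases eq_or_ne (∫⁻ x, g x) 0 with hg0 | hg0
  · simp [hg0, hb]
  refine le_of_tendsto' (ENNReal.Tendsto.mul ((ENNReal.continuous_rpow_const.tendsto _).comp
    (trunc f hf)) (Or.inl ?_) ((ENNReal.continuous_rpow_const.tendsto _).comp (trunc g hg))
    (Or.inl ?_)) hN
  · simp [hf0, ha.not_gt]
  · simp [hg0, hb.not_gt]

lemma PrekopaLeindler.prod {X Y : Type*} [AddCommGroup X] [Module ℝ X] [MeasureSpace X]
    [AddCommGroup Y] [Module ℝ Y] [MeasureSpace Y] [SFinite (volume : Measure Y)]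
    [SFinite (volume : Measure X)] (hX : PrekopaLeindler X) (hY : PrekopaLeindler Y) :
    PrekopaLeindler (X × Y) := by
  intro a b ha hb hab f g h hf hg hh hfgh
  rw [Measure.volume_eq_prod, lintegral_prod _ hf.aemeasurable, lintegral_prod _ hg.aemeasurable,
    lintegral_prod _ hh.aemeasurable]
  refine hX a b ha hb hab _ _ _ hf.lintegral_prod_right' hg.lintegral_prod_right'
    hh.lintegral_prod_right' fun x x' => ?_
  exact hY a b ha hb hab _ _ _ (hf.comp measurable_prodMk_left) (hg.comp measurable_prodMk_left)
    (hh.comp measurable_prodMk_left) fun y y' => hfgh (x, y) (x', y')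

lemma PrekopaLeindler.of_measurePreserving {X Y : Type*} [AddCommGroup X] [Module ℝ X]
    [MeasureSpace X] [AddCommGroup Y] [Module ℝ Y] [MeasureSpace Y] (e : Y →ₗ[ℝ] X)
    (he : MeasurePreserving e volume volume) (hY : PrekopaLeindler Y) : PrekopaLeindler X := by
  intro a b ha hb hab f g h hf hg hh hfgh
  rw [← he.lintegral_comp hf, ← he.lintegral_comp hg, ← he.lintegral_comp hh]
  exact hY a b ha hb hab _ _ _ (hf.comp he.measurable) (hg.comp he.measurable)
    (hh.comp he.measurable) fun y y' => by simpa using hfgh (e y) (e y')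

lemma prekopaLeindler_pi (n : ℕ) : PrekopaLeindler (Fin n → ℝ) := by
  induction n with
  | zero =>
    intro a b ha hb hab f g h hf hg hh hfgh
    have : ∀ u : (Fin 0 → ℝ) → ℝ≥0∞, ∫⁻ x, u x = u 0 := by
      intro u
      rw [Measure.volume_pi_eq_dirac 0, lintegral_dirac]
    rw [this, this, this]
    simpa using hfgh 0 0
  | succ n ih =>
    refine (prekopaLeindler_real.prod ih).of_measurePreserving
      (Fin.consLinearEquiv ℝ (fun _ : Fin (n + 1) => ℝ)).toLinearMap ?_
    have := (volume_preserving_piFinSuccAbove (fun _ : Fin (n + 1) => ℝ) 0).symm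
    have h2 : ⇑(MeasurableEquiv.piFinSuccAbove (fun _ : Fin (n + 1) => ℝ) 0).symm =
        ⇑(Fin.consLinearEquiv ℝ (fun _ : Fin (n + 1) => ℝ)).toLinearMap := by
      funext x
      simp [MeasurableEquiv.piFinSuccAbove, Fin.insertNthEquiv]
      rfl
    rw [h2] at this
    exact this

lemma prekopaLeindler_euclidean (n : ℕ) : PrekopaLeindler (EuclideanSpace ℝ (Fin n)) :=
  (prekopaLeindler_pi n).of_measurePreserving (WithLp.linearEquiv 2 ℝ (Fin n → ℝ)).symm.toLinearMap
    (EuclideanSpace.volume_preserving_symm_measurableEquiv_toLp (Fin n)).symm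

/-- The multiplicative Brunn–Minkowski inequality. -/
lemma brunn_minkowski {n : ℕ} {A B C : Set (EuclideanSpace ℝ (Fin n))} (hA : MeasurableSet A)
    (hB : MeasurableSet B) (hC : MeasurableSet C) {a b : ℝ} (ha : 0 < a) (hb : 0 < b)
    (hab : a + b = 1) (h : a • A + b • B ⊆ C) :
    volume A ^ a * volume B ^ b ≤ volume C := by
  have := prekopaLeindler_euclidean n a b ha hb hab (A.indicator 1) (B.indicator 1)
    (C.indicator 1) (measurable_one.indicator hA) (measurable_one.indicator hB)
    (measurable_one.indicator hC) fun x y => by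
      by_cases hx : x ∈ A
      · by_cases hy : y ∈ B
        · have : a • x + b • y ∈ C :=
            h ⟨_, smul_mem_smul_set hx, _, smul_mem_smul_set hy, rfl⟩
          simp [this, hx, hy]
        · simp [hy, hb]
      · simp [hx, ha]
  simpa [lintegral_indicator_one hA, lintegral_indicator_one hB, lintegral_indicator_one hC]
    using this

/-! ### Volumes of sums of a convex body and segments -/

/-- Euclidean space of dimension `n`. -/
abbrev Euc (n : ℕ) := EuclideanSpace ℝ (Fin n)

/-- Nonempty bounded open convex sets. -/
structure OpenBody {n : ℕ} (L : Set (Euc n)) : Prop where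
  isOpen : IsOpen L
  isBounded : IsBounded L
  convex : Convex ℝ L
  nonempty : L.Nonempty

namespace OpenBody

variable {n : ℕ} {L M : Set (Euc n)}

lemma add (hL : OpenBody L) (hb : IsBounded M) (hc : Convex ℝ M) (hn : M.Nonempty) :
    OpenBody (L + M) :=
  ⟨hL.isOpen.add_right, isBounded_add hL.isBounded hb, hL.convex.add hc, hL.nonempty.add hn⟩

lemma smul (hL : OpenBody L) {a : ℝ} (ha : 0 < a) : OpenBody (a • L) :=
  ⟨hL.isOpen.smul₀ ha.ne', hL.isBounded.smul₀ a, hL.convex.smul a, hL.nonempty.smul_set⟩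

lemma vadd (hL : OpenBody L) (x : Euc n) : OpenBody (x +ᵥ L) := by
  have := hL.add (M := {x}) isBounded_singleton (convex_singleton x) (singleton_nonempty x)
  rwa [add_comm, singleton_add, ← image_vadd] at *

lemma volume_lt_top (hL : OpenBody L) : volume L < ∞ := hL.isBounded.measure_lt_top

lemma volume_pos (hL : OpenBody L) : 0 < volume L := hL.isOpen.measure_pos _ hL.nonempty

lemma real_pos (hL : OpenBody L) : 0 < volume.real L :=
  ENNReal.toReal_pos hL.volume_pos.ne' hL.volume_lt_top.ne

lemma real_mono (hM : OpenBody M) (h : L ⊆ M) : volume.real L ≤ volume.real M :=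
  measureReal_mono h hM.volume_lt_top.ne

lemma ball (x : Euc n) {r : ℝ} (hr : 0 < r) : OpenBody (Metric.ball x r) :=
  ⟨isOpen_ball, isBounded_ball, convex_ball x r, nonempty_ball.2 hr⟩

end OpenBody

/-- The segment from `0` to `r • θ`. -/
def seg {n : ℕ} (θ : Euc n) (r : ℝ) : Set (Euc n) := (fun t : ℝ => t • θ) '' Icc 0 r

section Seg

variable {n : ℕ} (θ : Euc n)

lemma isCompact_seg (r : ℝ) : IsCompact (seg θ r) :=
  isCompact_Icc.image (by fun_prop)

lemma convex_seg (r : ℝ) : Convex ℝ (seg θ r) :=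
  (convex_Icc (0 : ℝ) r).linear_image (LinearMap.toSpanSingleton ℝ (Euc n) θ)

lemma zero_mem_seg {r : ℝ} (hr : 0 ≤ r) : (0 : Euc n) ∈ seg θ r := ⟨0, ⟨le_rfl, hr⟩, by simp⟩

lemma seg_zero : seg θ 0 = 0 := by simp [seg, singleton_zero]

lemma seg_add {r s : ℝ} (hr : 0 ≤ r) (hs : 0 ≤ s) : seg θ (r + s) = seg θ r + seg θ s := by
  apply Subset.antisymm
  · rintro _ ⟨t, ⟨h0, h1⟩, rfl⟩
    refine ⟨min t r • θ, ⟨min t r, ⟨le_min h0 hr, min_le_right _ _⟩, rfl⟩,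
      (t - min t r) • θ, ⟨t - min t r, ⟨by linarith [min_le_left t r], ?_⟩, rfl⟩, ?_⟩
    · rcases min_cases t r with ⟨h, -⟩ | ⟨h, -⟩ <;> linarith
    · simp only [← add_smul]; congr 1; ring
  · rintro _ ⟨_, ⟨t, ⟨h0, h1⟩, rfl⟩, _, ⟨t', ⟨h0', h1'⟩, rfl⟩, rfl⟩
    exact ⟨t + t', ⟨by positivity, by linarith⟩, by simp [add_smul]⟩

lemma smul_seg {a : ℝ} (ha : 0 ≤ a) (r : ℝ) (hr : 0 ≤ r) : a • seg θ r = seg θ (a * r) := by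
  apply Subset.antisymm
  · rintro _ ⟨_, ⟨t, ⟨h0, h1⟩, rfl⟩, rfl⟩
    exact ⟨a * t, ⟨by positivity, by gcongr⟩, by simp [mul_smul]⟩
  · rintro _ ⟨t, ⟨h0, h1⟩, rfl⟩
    rcases ha.eq_or_lt with rfl | ha
    · have : t = 0 := le_antisymm (by simpa using h1) h0
      exact ⟨0, zero_mem_seg θ hr, by simp [this]⟩
    · refine ⟨(t / a) • θ, ⟨t / a, ⟨by positivity, by rwa [div_le_iff₀' ha]⟩, rfl⟩, ?_⟩
      simp only [smul_smul]; congr 1; field_simp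

variable {L M : Set (Euc n)}

lemma OpenBody.add_seg (hL : OpenBody L) {r : ℝ} (hr : 0 ≤ r) : OpenBody (L + seg θ r) :=
  hL.add (isCompact_seg θ r).isBounded (convex_seg θ r) ⟨0, zero_mem_seg θ hr⟩

lemma add_seg_sdiff (hL : Convex ℝ L) {r s : ℝ} (hr : 0 ≤ r) :
    (L + seg θ (r + s)) \ (L + seg θ r) = (r • θ) +ᵥ ((L + seg θ s) \ L) := by
  ext x
  simp only [mem_vadd_set_iff_neg_vadd_mem, vadd_eq_add]
  constructor
  · rintro ⟨⟨a, ha, _, ⟨t, ⟨h0, h1⟩, rfl⟩, rfl⟩, h2⟩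
    have hrt : r < t := by
      by_contra! h
      exact h2 ⟨a, ha, _, ⟨t, ⟨h0, h⟩, rfl⟩, rfl⟩
    refine ⟨⟨a, ha, (t - r) • θ, ⟨t - r, ⟨by linarith, by linarith⟩, rfl⟩, ?_⟩, fun h => h2 ?_⟩
    · simp only [sub_smul]; abel
    · exact ⟨_, h, r • θ, ⟨r, ⟨hr, le_rfl⟩, rfl⟩, by simp⟩
  · rintro ⟨⟨a, ha, _, ⟨t, ⟨h0, h1⟩, rfl⟩, hx⟩, h2⟩
    simp only at hx
    refine ⟨⟨a, ha, (r + t) • θ, ⟨r + t, ⟨by linarith, by linarith⟩, rfl⟩, ?_⟩, ?_⟩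
    · dsimp only; rw [add_smul, add_left_comm, hx]; simp
    · rintro ⟨a', ha', _, ⟨t', ⟨h0', h1'⟩, rfl⟩, hx'⟩
      simp only at hx'
      apply h2
      have e1 : -(r • θ) + x = a' - (r - t') • θ := by rw [← hx', sub_smul]; abel
      rcases (by linarith : (0 : ℝ) ≤ r - t').eq_or_lt with h | h
      · rw [e1, ← h]; simpa using ha'
      have hp : 0 < t + (r - t') := by linarith
      have : -(r • θ) + x = ((r - t') / (t + (r - t'))) • a + (t / (t + (r - t'))) • a' := by
        have e2 : a = -(r • θ) + x - t • θ := by rw [← hx]; abel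
        have e3 : a' = -(r • θ) + x + (r - t') • θ := by rw [e1]; abel
        rw [e2, e3]
        generalize -(r • θ) + x = y
        have : y = ((r - t') / (t + (r - t')) + t / (t + (r - t'))) • y := by
          rw [← add_div, add_comm (r - t'), div_self hp.ne', one_smul]
        conv_lhs => rw [this]
        module
      rw [this]
      exact hL ha ha' (by positivity) (by positivity) (by field_simp; ring)

lemma additive_monotone_eq {h : ℝ → ℝ} (hadd : ∀ r s, 0 ≤ r → 0 ≤ s → h (r + s) = h r + h s)
    (hmono : ∀ r s, 0 ≤ r → r ≤ s → h r ≤ h s) {r : ℝ} (hr : 0 ≤ r) : h r = r * h 1 := by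
  have h0 : h 0 = 0 := by simpa using hadd 0 0 le_rfl le_rfl
  have hN : ∀ (N : ℕ) (r : ℝ), 0 ≤ r → h (N * r) = N * h r := by
    intro N r hr
    induction N with
    | zero => simp [h0]
    | succ N ih =>
      push_cast
      rw [add_mul, one_mul, hadd _ _ (by positivity) hr, ih]; ring
  have h1 : 0 ≤ h 1 := h0 ▸ hmono 0 1 le_rfl zero_le_one
  have key : ∀ N : ℕ, 0 < N → |h r - r * h 1| ≤ h 1 / N := by
    intro N hNpos
    have hN' : (0 : ℝ) < N := by exact_mod_cast hNpos
    have hNr : 0 ≤ N * r := by positivity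
    have a1 := hmono _ _ (by positivity) (Nat.floor_le hNr)
    have a2 := hmono _ _ hNr (Nat.lt_floor_add_one (N * r)).le
    have b1 := hN ⌊N * r⌋₊ 1 zero_le_one
    have b2 := hN (⌊N * r⌋₊ + 1) 1 zero_le_one
    push_cast at b2
    rw [mul_one] at b1 b2
    rw [hN _ _ hr] at a1 a2
    have c1 := mul_le_mul_of_nonneg_right (Nat.floor_le hNr) h1
    have c2 := mul_le_mul_of_nonneg_right (Nat.lt_floor_add_one (N * r)).le h1
    rw [abs_le, neg_le, ← sub_nonneg, ← sub_nonneg (b := h r - _)]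
    constructor
    · have : h 1 / N - -(h r - r * h 1) = (h 1 + N * h r - N * r * h 1) / N := by
        field_simp; ring
      rw [this]; apply div_nonneg _ hN'.le; linarith
    · have : h 1 / N - (h r - r * h 1) = (h 1 - N * h r + N * r * h 1) / N := by
        field_simp; ring
      rw [this]; apply div_nonneg _ hN'.le; linarith
  have hlim : Filter.Tendsto (fun N : ℕ => h 1 / N) Filter.atTop (nhds 0) :=
    tendsto_const_div_atTop_nhds_zero_nat _
  have := ge_of_tendsto hlim (Filter.eventually_atTop.2 ⟨1, fun N hN => key N hN⟩)
  linarith [abs_nonpos_iff.1 this]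

/-- The rate of growth of the volume of `L` when a segment in direction `θ` is added. -/
def psi (L : Set (Euc n)) : ℝ := volume.real (L + seg θ 1) - volume.real L

lemma OpenBody.real_add_seg (hL : OpenBody L) {r : ℝ} (hr : 0 ≤ r) :
    volume.real (L + seg θ r) = volume.real L + r * psi θ L := by
  have hsub : ∀ r s, 0 ≤ r → 0 ≤ s → L + seg θ r ⊆ L + seg θ (r + s) := by
    intro r s hr hs
    rw [seg_add θ hr hs, ← add_assoc]
    exact subset_add_left _ (zero_mem_seg θ hs)
  have := additive_monotone_eq (h := fun r => volume.real (L + seg θ r) - volume.real L)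
    (fun r s hr hs => ?_) (fun r s hr hrs => ?_) hr
  · rw [psi, ← this]; ring
  · have e := add_seg_sdiff θ hL.convex (s := s) hr
    have e1 : volume.real ((L + seg θ (r + s)) \ (L + seg θ r)) =
        volume.real (L + seg θ (r + s)) - volume.real (L + seg θ r) :=
      measureReal_sdiff (hsub r s hr hs) (hL.add_seg θ hr).isOpen.measurableSet
        (hL.add_seg θ (add_nonneg hr hs)).volume_lt_top.ne
    have e2 : volume.real ((L + seg θ s) \ L) = volume.real (L + seg θ s) - volume.real L :=
      measureReal_sdiff (subset_add_left _ (zero_mem_seg θ hs)) hL.isOpen.measurableSet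
        (hL.add_seg θ hs).volume_lt_top.ne
    rw [e, measureReal_def, measure_vadd, ← measureReal_def, e2] at e1
    linarith
  · have h1 := hsub r (s - r) hr (by linarith)
    rw [add_sub_cancel] at h1
    have := (hL.add_seg θ (hr.trans hrs)).real_mono h1
    linarith

lemma OpenBody.psi_nonneg (hL : OpenBody L) : 0 ≤ psi θ L :=
  sub_nonneg.2 ((hL.add_seg θ zero_le_one).real_mono
    (subset_add_left _ (zero_mem_seg θ zero_le_one)))

lemma le_of_forall_add_mul_le {a b c d : ℝ} (h : ∀ r : ℝ, 0 < r → a + r * b ≤ c + r * d) :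
    b ≤ d := by
  by_contra! hlt
  have h1 := h ((|c - a| + 1) / (b - d)) (div_pos (by positivity) (by linarith))
  have h2 : (|c - a| + 1) / (b - d) * b - (|c - a| + 1) / (b - d) * d = |c - a| + 1 := by
    rw [← mul_sub, div_mul_cancel₀ _ (by linarith)]
  linarith [le_abs_self (c - a)]

lemma OpenBody.psi_mono (hL : OpenBody L) (hM : OpenBody M) (h : L ⊆ M) :
    psi θ L ≤ psi θ M := by
  refine le_of_forall_add_mul_le (a := volume.real L) (c := volume.real M) fun r hr => ?_
  rw [← hL.real_add_seg θ hr.le, ← hM.real_add_seg θ hr.le]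
  exact (hM.add_seg θ hr.le).real_mono (add_subset_add_right h)

lemma psi_vadd (x : Euc n) : psi θ (x +ᵥ L) = psi θ L := by
  simp only [psi, measureReal_def, vadd_add_assoc, measure_vadd]

lemma real_smul {a : ℝ} (ha : 0 ≤ a) (L : Set (Euc n)) :
    volume.real (a • L) = a ^ n * volume.real L := by
  rw [measureReal_def, Measure.addHaar_smul, ENNReal.toReal_mul, ENNReal.toReal_ofReal
    (abs_nonneg _), abs_of_nonneg (by positivity)]
  simp [measureReal_def]

lemma OpenBody.psi_smul (hL : OpenBody L) {a : ℝ} (ha : 0 < a) (hn : 1 ≤ n) :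
    psi θ (a • L) = a ^ (n - 1) * psi θ L := by
  have : a • L + seg θ 1 = a • (L + seg θ a⁻¹) := by
    rw [smul_add, smul_seg θ ha.le _ (by positivity), mul_inv_cancel₀ ha.ne']
  rw [psi, this, real_smul ha.le, hL.real_add_seg θ (by positivity), real_smul ha.le]
  obtain ⟨m, rfl⟩ : ∃ m, n = m + 1 := ⟨n - 1, by omega⟩
  simp only [add_tsub_cancel_right, pow_succ]
  field_simp
  ring

lemma OpenBody.brunn_minkowski (hL : OpenBody L) (hM : OpenBody M) {a b : ℝ} (ha : 0 < a)
    (hb : 0 < b) (hab : a + b = 1) :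
    volume.real L ^ a * volume.real M ^ b ≤ volume.real (a • L + b • M) := by
  have hC := (hL.smul ha).add (hM.smul hb).isBounded (hM.smul hb).convex (hM.smul hb).nonempty
  have := _root_.brunn_minkowski hL.isOpen.measurableSet hM.isOpen.measurableSet
    hC.isOpen.measurableSet ha hb hab subset_rfl
  have := ENNReal.toReal_mono hC.volume_lt_top.ne this
  simpa [ENNReal.toReal_mul, ← ENNReal.toReal_rpow, measureReal_def] using this

lemma OpenBody.psi_log_concave (hL : OpenBody L) (hM : OpenBody M) {a b : ℝ} (ha : 0 < a)
    (hb : 0 < b) (hab : a + b = 1) :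
    psi θ L ^ a * psi θ M ^ b ≤ psi θ (a • L + b • M) := by
  have hC := (hL.smul ha).add (hM.smul hb).isBounded (hM.smul hb).convex (hM.smul hb).nonempty
  refine le_of_forall_add_mul_le (a := 0) (c := volume.real (a • L + b • M)) fun r hr => ?_
  have h1 := (hL.add_seg θ hr.le).brunn_minkowski (hM.add_seg θ hr.le) ha hb hab
  have : a • (L + seg θ r) + b • (M + seg θ r) = (a • L + b • M) + seg θ r := by
    rw [smul_add, smul_add, add_add_add_comm, smul_seg θ ha.le r hr.le, smul_seg θ hb.le r hr.le,
      ← seg_add θ (by positivity) (by positivity), ← add_mul, hab, one_mul]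
  rw [this, hC.real_add_seg θ hr.le, hL.real_add_seg θ hr.le, hM.real_add_seg θ hr.le] at h1
  refine le_trans ?_ h1
  have hLp := hL.psi_nonneg θ
  have hMp := hM.psi_nonneg θ
  calc 0 + r * (psi θ L ^ a * psi θ M ^ b) = (r * psi θ L) ^ a * (r * psi θ M) ^ b := by
        rw [Real.mul_rpow hr.le hLp, Real.mul_rpow hr.le hMp, mul_mul_mul_comm,
          ← Real.rpow_add hr, hab, Real.rpow_one, zero_add]
    _ ≤ _ := by
        gcongr <;> linarith [hL.real_pos, hM.real_pos]

variable {θ}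

lemma OpenBody.psi_pos (hL : OpenBody L) (hθ : θ ≠ 0) : 0 < psi θ L := by
  obtain ⟨C, hC⟩ := hL.isBounded.exists_norm_le
  obtain ⟨x0, hx0⟩ := hL.nonempty
  have hC0 : 0 ≤ C := (norm_nonneg _).trans (hC _ hx0)
  have hθ' : 0 < ‖θ‖ := norm_pos_iff.2 hθ
  set r := (2 * C + 1) / ‖θ‖ with hr
  have hr0 : 0 < r := by positivity
  have hd : Disjoint L ((r • θ) +ᵥ L) := by
    rw [Set.disjoint_left]
    rintro x hx ⟨y, hy, rfl⟩
    have h1 := hC _ hx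
    have h2 := hC _ hy
    have h3 : ‖r • θ‖ = 2 * C + 1 := by
      rw [norm_smul, Real.norm_of_nonneg hr0.le, hr, div_mul_cancel₀ _ hθ'.ne']
    have h4 : ‖r • θ‖ ≤ ‖(r • θ) +ᵥ y‖ + ‖y‖ := by
      calc ‖r • θ‖ = ‖((r • θ) +ᵥ y) - y‖ := by simp
        _ ≤ _ := norm_sub_le _ _
    simp only at h1
    linarith
  have hsub : L ∪ ((r • θ) +ᵥ L) ⊆ L + seg θ r := by
    refine union_subset (subset_add_left _ (zero_mem_seg θ hr0.le)) ?_
    rintro _ ⟨y, hy, rfl⟩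
    exact ⟨y, hy, r • θ, ⟨r, ⟨hr0.le, le_rfl⟩, rfl⟩, by simp [add_comm]⟩
  have := (hL.add_seg θ hr0.le).real_mono hsub
  rw [measureReal_union hd (hL.vadd _).isOpen.measurableSet hL.volume_lt_top.ne
    (hL.vadd _).volume_lt_top.ne, hL.real_add_seg θ hr0.le] at this
  have h2 : volume.real ((r • θ) +ᵥ L) = volume.real L := by simp [measureReal_def]
  have : 0 < r * psi θ L := by linarith [hL.real_pos]
  exact pos_of_mul_pos_right this hr0.le

lemma OpenBody.psi_brunn_minkowski (hL : OpenBody L) (hM : OpenBody M) (hθ : θ ≠ 0) (hn : 2 ≤ n)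
    {a b : ℝ} (ha : 0 < a) (hb : 0 < b) :
    a * psi θ L ^ (1 / ((n : ℝ) - 1)) + b * psi θ M ^ (1 / ((n : ℝ) - 1)) ≤
      psi θ (a • L + b • M) ^ (1 / ((n : ℝ) - 1)) := by
  have hn' : (0 : ℝ) < (n : ℝ) - 1 := by
    have : (2 : ℝ) ≤ n := by exact_mod_cast hn
    linarith
  have hcast : ((n - 1 : ℕ) : ℝ) = (n : ℝ) - 1 := by
    rw [Nat.cast_sub (by omega)]; simp
  set q := 1 / ((n : ℝ) - 1) with hq
  have hpow : ∀ x : ℝ, 0 < x → (x ^ q) ^ (n - 1) = x := by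
    intro x hx
    rw [← Real.rpow_natCast, ← Real.rpow_mul hx.le, hcast, hq, one_div_mul_cancel hn'.ne',
      Real.rpow_one]
  have hLp := hL.psi_pos hθ
  have hMp := hM.psi_pos hθ
  set α := psi θ L ^ q with hα
  set γ := psi θ M ^ q with hγ
  have hα0 : 0 < α := by positivity
  have hγ0 : 0 < γ := by positivity
  have hN : ∀ {K : Set (Euc n)}, OpenBody K → psi θ ((psi θ K ^ q)⁻¹ • K) = 1 := by
    intro K hK
    have hKp := hK.psi_pos hθ
    rw [hK.psi_smul θ (by positivity) (by omega), inv_pow, hpow _ hKp, inv_mul_cancel₀ hKp.ne']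
  have hsum : 0 < a * α + b * γ := by positivity
  have h1 := (hL.smul (inv_pos.2 hα0)).psi_log_concave θ (hM.smul (inv_pos.2 hγ0))
    (a := a * α / (a * α + b * γ)) (b := b * γ / (a * α + b * γ)) (by positivity) (by positivity)
    (by field_simp)
  rw [hN hL, hN hM, Real.one_rpow, Real.one_rpow, one_mul, smul_smul, smul_smul] at h1
  have e : a • L + b • M = (a * α + b * γ) • ((a * α / (a * α + b * γ) * α⁻¹) • L +
      (b * γ / (a * α + b * γ) * γ⁻¹) • M) := by
    rw [smul_add, smul_smul, smul_smul]
    congr 2 <;> field_simp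
  have hC : OpenBody ((a * α / (a * α + b * γ) * α⁻¹) • L +
      (b * γ / (a * α + b * γ) * γ⁻¹) • M) := by
    have hM' := hM.smul (a := b * γ / (a * α + b * γ) * γ⁻¹) (by positivity)
    exact (hL.smul (by positivity)).add hM'.isBounded hM'.convex hM'.nonempty
  rw [e, hC.psi_smul θ hsum (by omega)]
  calc a * α + b * γ = ((a * α + b * γ) ^ (n - 1)) ^ q := by
        rw [← Real.rpow_natCast, ← Real.rpow_mul hsum.le, hcast, hq, mul_one_div_cancel hn'.ne',
          Real.rpow_one]
    _ ≤ _ := by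
        gcongr
        exact le_mul_of_one_le_right (by positivity) h1

end Seg

/-! ### Zonotopes -/

section Zono

variable {n : ℕ} {ι : Type*} [Fintype ι] (θ : ι → Euc n)

/-- The zonotope spanned by the segments `[0, s k • θ k]`. -/
def zono (s : ι → ℝ) : Set (Euc n) := ∑ k, seg (θ k) (s k)

lemma isCompact_zono (s : ι → ℝ) : IsCompact (zono θ s) :=
  Finset.sum_induction _ (fun A : Set (Euc n) => IsCompact A) (fun _ _ hA hB => hA.add hB)
    isCompact_singleton fun k _ => isCompact_seg (θ k) (s k)

lemma convex_zono (s : ι → ℝ) : Convex ℝ (zono θ s) :=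
  Finset.sum_induction _ (fun A : Set (Euc n) => Convex ℝ A) (fun _ _ hA hB => hA.add hB)
    (convex_singleton 0) fun k _ => convex_seg (θ k) (s k)

lemma mem_zono {s : ι → ℝ} {x : Euc n} :
    x ∈ zono θ s ↔ ∃ t : ι → ℝ, (∀ k, t k ∈ Icc 0 (s k)) ∧ ∑ k, t k • θ k = x := by
  rw [zono, Set.mem_finsetSum]
  constructor
  · rintro ⟨g, hg, rfl⟩
    choose! t ht1 ht2 using fun k => hg (Finset.mem_univ k)
    exact ⟨t, ht1, Finset.sum_congr rfl fun k _ => ht2 k⟩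
  · rintro ⟨t, ht, rfl⟩
    exact ⟨fun k => t k • θ k, fun {k} _ => ⟨t k, ht k, rfl⟩, rfl⟩

lemma zero_mem_zono {s : ι → ℝ} (hs : 0 ≤ s) : (0 : Euc n) ∈ zono θ s :=
  (mem_zono θ).2 ⟨0, fun k => ⟨le_rfl, hs k⟩, by simp⟩

lemma zono_add {s t : ι → ℝ} (hs : 0 ≤ s) (ht : 0 ≤ t) :
    zono θ (s + t) = zono θ s + zono θ t := by
  simp only [zono, Pi.add_apply, ← Finset.sum_add_distrib]
  exact Finset.sum_congr rfl fun k _ => seg_add _ (hs k) (ht k)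

lemma smul_zono {a : ℝ} (ha : 0 ≤ a) {s : ι → ℝ} (hs : 0 ≤ s) :
    a • zono θ s = zono θ (a • s) := by
  simp only [zono, Pi.smul_apply, Finset.smul_sum, smul_eq_mul]
  exact Finset.sum_congr rfl fun k _ => smul_seg _ ha _ (hs k)

lemma zono_single [DecidableEq ι] (k : ι) (r : ℝ) : zono θ (Pi.single k r) = seg (θ k) r := by
  rw [zono, Finset.sum_eq_single k]
  · simp
  · intro j _ hj
    rw [Pi.single_eq_of_ne hj, seg_zero]
  · simp

lemma OpenBody.add_zono {L : Set (Euc n)} (hL : OpenBody L) {s : ι → ℝ} (hs : 0 ≤ s) :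
    OpenBody (L + zono θ s) :=
  hL.add (isCompact_zono θ s).isBounded (convex_zono θ s) ⟨0, zero_mem_zono θ hs⟩

lemma OpenBody.exists_cubic_lower_bound {L : Set (Euc n)} (hL : OpenBody L) {e : Fin 3 → Euc n}
    (he : LinearIndependent ℝ e) : ∃ c > 0, ∃ M > 0, ∀ N : ℕ,
      c * (N : ℝ) ^ 3 ≤ volume.real (L + zono e fun _ => M * N) := by
  obtain ⟨x, hx⟩ := hL.nonempty
  obtain ⟨ε, hε, hball⟩ := Metric.isOpen_iff.1 hL.isOpen x hx
  have hinj : Function.Injective (Fintype.linearCombination ℝ e) :=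
    linearIndependent_iff_injective_fintypeLinearCombination.1 he
  obtain ⟨K, hK, hanti⟩ := (Fintype.linearCombination ℝ e).exists_antilipschitzWith
    (LinearMap.ker_eq_bot.2 hinj)
  set M : ℝ := 2 * ε * K with hM
  have hK' : (0 : ℝ) < K := hK
  have hM0 : 0 < M := by positivity
  refine ⟨volume.real (Metric.ball x ε), (OpenBody.ball x hε).real_pos, M, hM0, fun N => ?_⟩
  have hbody : OpenBody (L + zono e fun _ => M * N) :=
    hL.add_zono e fun _ => by simp only [Pi.zero_apply]; positivity
  set pt : (Fin 3 → Fin N) → Euc n := fun v => ∑ i, (M * (v i : ℕ)) • e i with hpt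
  have hsub : (⋃ v, pt v +ᵥ Metric.ball x ε) ⊆ L + zono e fun _ => M * N := by
    refine iUnion_subset fun v => ?_
    rintro _ ⟨y, hy, rfl⟩
    refine ⟨y, hball hy, pt v, (mem_zono e).2 ⟨_, fun i => ⟨by positivity, ?_⟩, rfl⟩, ?_⟩
    · have : ((v i : ℕ) : ℝ) ≤ N := by exact_mod_cast (v i).2.le
      gcongr
    · simp [add_comm]
  have hdisj : Pairwise (Function.onFun Disjoint fun v => pt v +ᵥ Metric.ball x ε) := by
    intro v w hvw
    rw [Function.onFun, vadd_ball, vadd_ball]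
    apply ball_disjoint_ball
    have h1 := hanti.le_mul_dist (fun i => M * (v i : ℕ)) (fun i => M * (w i : ℕ))
    simp only [Fintype.linearCombination_apply] at h1
    have h2 : M ≤ dist (fun i => M * ((v i : ℕ) : ℝ)) (fun i => M * ((w i : ℕ) : ℝ)) := by
      obtain ⟨i, hi⟩ := Function.ne_iff.1 hvw
      refine le_trans ?_ (dist_le_pi_dist _ _ i)
      rw [Real.dist_eq, ← mul_sub, abs_mul, abs_of_pos hM0]
      refine le_mul_of_one_le_right hM0.le ?_
      have : ((v i : ℕ) : ℤ) - ((w i : ℕ) : ℤ) ≠ 0 := by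
        intro h
        exact hi (Fin.ext (by omega))
      have := Int.one_le_abs this
      exact_mod_cast this
    simp only [vadd_eq_add, dist_add_right]
    have h3 : M ≤ K * dist (pt v) (pt w) := h2.trans h1
    have : K * (ε + ε) ≤ K * dist (pt v) (pt w) := by linarith
    exact le_of_mul_le_mul_left this hK'
  have := hbody.real_mono hsub
  rw [measureReal_iUnion_fintype hdisj
    (fun v => ((OpenBody.ball x hε).vadd _).isOpen.measurableSet)
    (fun v => ((OpenBody.ball x hε).vadd _).volume_lt_top.ne)] at this
  refine le_trans (le_of_eq ?_) this
  have h4 : ∀ v, volume.real (pt v +ᵥ Metric.ball x ε) = volume.real (Metric.ball x ε) := fun v => by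
    rw [measureReal_def, measure_vadd, measureReal_def]
  rw [Finset.sum_congr rfl fun v _ => h4 v]
  simp [mul_comm]

end Zono

/-! ### Functions affine in each variable -/

section MultiAffine

variable {ι : Type*} [Fintype ι] [DecidableEq ι]

/-- The unit forward difference in the direction of the `k`-th coordinate. -/
def fdiff (k : ι) (F : (ι → ℝ) → ℝ) (s : ι → ℝ) : ℝ := F (s + Pi.single k 1) - F s

/-- Differentiable functions which are affine in each variable. -/
structure MultiAffine (F : (ι → ℝ) → ℝ) : Prop where
  differentiable : Differentiable ℝ F
  add_single : ∀ s k r, F (s + Pi.single k r) = F s + r * fdiff k F s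

namespace MultiAffine

variable {F : (ι → ℝ) → ℝ}

lemma fdiff (hF : MultiAffine F) (k : ι) : MultiAffine (fdiff k F) where
  differentiable := (hF.differentiable.comp (by fun_prop)).sub hF.differentiable
  add_single s j r := by
    simp only [_root_.fdiff]
    rw [add_right_comm s (Pi.single j r), add_right_comm s (Pi.single j 1),
      hF.add_single s, hF.add_single (s + Pi.single k 1)]
    simp only [_root_.fdiff]; ring

lemma fderiv_single (hF : MultiAffine F) (s : ι → ℝ) (k : ι) :
    fderiv ℝ F s (Pi.single k 1) = _root_.fdiff k F s := by
  have h1 : HasDerivAt (fun t : ℝ => F (s + t • Pi.single k (1 : ℝ)))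
      (fderiv ℝ F s (Pi.single k 1)) 0 := by
    have := (hF.differentiable (s + (0 : ℝ) • Pi.single k 1)).hasFDerivAt
    have h2 : HasDerivAt (fun t : ℝ => s + t • Pi.single k (1 : ℝ)) (Pi.single k 1) 0 := by
      simpa using ((hasDerivAt_id (0 : ℝ)).smul_const (Pi.single k (1 : ℝ))).const_add s
    simpa [Function.comp_def] using this.comp_hasDerivAt 0 h2
  have h2 : HasDerivAt (fun t : ℝ => F (s + t • Pi.single k (1 : ℝ)))
      (_root_.fdiff k F s) 0 := by
    have e : (fun t : ℝ => F (s + t • Pi.single k (1 : ℝ))) =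
        fun t => F s + t * _root_.fdiff k F s := by
      funext t
      rw [← hF.add_single, ← Pi.single_smul, smul_eq_mul, mul_one]
    rw [e]
    simpa using ((hasDerivAt_id (0 : ℝ)).mul_const (_root_.fdiff k F s)).const_add (F s)
  exact h1.unique h2

lemma fderiv_apply (hF : MultiAffine F) (s c : ι → ℝ) :
    fderiv ℝ F s c = ∑ k, c k * _root_.fdiff k F s := by
  conv_lhs => rw [pi_eq_sum_univ' c, map_sum]
  refine Finset.sum_congr rfl fun k _ => ?_
  rw [map_smul, smul_eq_mul, ← hF.fderiv_single]

lemma hasDerivAt_ray (hF : MultiAffine F) (x c : ι → ℝ) (t : ℝ) :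
    HasDerivAt (fun t : ℝ => F (x + t • c)) (∑ k, c k * _root_.fdiff k F (x + t • c)) t := by
  have h2 : HasDerivAt (fun t : ℝ => x + t • c) c t := by
    simpa using ((hasDerivAt_id t).smul_const c).const_add x
  have := (hF.differentiable (x + t • c)).hasFDerivAt.comp_hasDerivAt t h2
  rwa [hF.fderiv_apply] at this

lemma hasDerivAt_ray_two (hF : MultiAffine F) (x c : ι → ℝ) (t : ℝ) :
    HasDerivAt (fun t : ℝ => ∑ k, c k * _root_.fdiff k F (x + t • c))
      (∑ k, ∑ j, c k * c j * _root_.fdiff j (_root_.fdiff k F) (x + t • c)) t := by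
  have := HasDerivAt.fun_sum fun k (_ : k ∈ (Finset.univ : Finset ι)) =>
    ((hF.fdiff k).hasDerivAt_ray x c t).const_mul (c k)
  simpa only [Finset.mul_sum, mul_assoc] using this

end MultiAffine

/-- A function affine in each variable on the nonnegative orthant is the restriction of a
globally multi-affine function. -/
lemma exists_multiAffine {F : (ι → ℝ) → ℝ} (hF : ∀ s, 0 ≤ s → ∀ k r, 0 ≤ r →
    F (s + Pi.single k r) = F s + r * fdiff k F s) :
    ∃ G, MultiAffine G ∧ ∀ s, 0 ≤ s → G s = F s := by
  set P : Finset ι → (ι → ℝ) → ℝ := fun I s => ∏ i, if i ∈ I then s i else 1 - s i with hP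
  set one : Finset ι → ι → ℝ := fun I i => if i ∈ I then 1 else 0 with hone
  set G : (ι → ℝ) → ℝ := fun s => ∑ I, P I s * F (one I) with hG
  have hPs : ∀ I s k r, P I (s + Pi.single k r) = P I s + r * (P I (s + Pi.single k 1) - P I s) := by
    intro I s k r
    have : ∀ r, P I (s + Pi.single k r) = (if k ∈ I then s k + r else 1 - (s k + r)) *
        ∏ i ∈ Finset.univ.erase k, if i ∈ I then s i else 1 - s i := by
      intro r
      rw [hP]
      simp only
      rw [← Finset.mul_prod_erase _ _ (Finset.mem_univ k)]
      congr 1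
      · simp
      · refine Finset.prod_congr rfl fun i hi => ?_
        simp [Pi.single_eq_of_ne (Finset.ne_of_mem_erase hi)]
    have h0 := this 0
    rw [Pi.single_zero, add_zero] at h0
    rw [this, this, h0]
    split_ifs <;> ring
  have hGM : MultiAffine G := by
    refine ⟨?_, fun s k r => ?_⟩
    · refine Differentiable.fun_sum fun I _ => Differentiable.mul_const ?_ _
      have : ContDiff ℝ 1 (P I) := contDiff_prod fun i _ => by
        split_ifs <;> fun_prop
      exact this.differentiable one_ne_zero
    · simp only [hG, fdiff, ← Finset.sum_sub_distrib, Finset.mul_sum, ← Finset.sum_add_distrib]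
      refine Finset.sum_congr rfl fun I _ => ?_
      rw [hPs]; ring
  refine ⟨G, hGM, ?_⟩
  have key : ∀ J : Finset ι, ∀ s, 0 ≤ s → (∀ i ∉ J, s i = 0 ∨ s i = 1) → G s = F s := by
    intro J
    induction J using Finset.induction_on with
    | empty =>
      intro s _ hs
      set I : Finset ι := Finset.univ.filter fun i => s i = 1 with hI
      have hsI : s = one I := by
        funext i
        by_cases h : s i = 1
        · simp [hone, hI, h]
        · have := (hs i (by simp)).resolve_right h
          simp [hone, hI, this]
      rw [hsI, hG]
      simp only
      rw [Finset.sum_eq_single I]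
      · have : P I (one I) = 1 := by
          simp only [hP, hone]
          refine Finset.prod_eq_one fun i _ => ?_
          by_cases h : i ∈ I <;> simp [h]
        rw [this, one_mul]
      · intro I' _ hne
        have : P I' (one I) = 0 := by
          obtain ⟨i, hi⟩ : ∃ i, ¬ (i ∈ I' ↔ i ∈ I) := by
            by_contra! h
            exact hne (Finset.ext h)
          refine Finset.prod_eq_zero (Finset.mem_univ i) ?_
          simp only [hone]
          by_cases h2 : i ∈ I
          · have h1 : i ∉ I' := fun h => hi (iff_of_true h h2)
            simp [h1, h2]
          · have h1 : i ∈ I' := by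
              by_contra h
              exact hi (iff_of_false h h2)
            simp [h1, h2]
        rw [this, zero_mul]
      · simp
    | insert k J hk ih =>
      intro s hs0 hs
      set s' := Function.update s k 0 with hs'
      have hss : s = s' + Pi.single k (s k) := by
        funext i
        by_cases h : i = k
        · subst h; simp [hs']
        · simp [hs', h]
      have hs'0 : 0 ≤ s' := by
        intro i
        by_cases h : i = k
        · subst h; simp [hs']
        · simpa [hs', h] using hs0 i
      have hone0 : (0 : ι → ℝ) ≤ Pi.single k 1 := by
        simp
      have e1 : G s' = F s' := ih s' hs'0 fun i hi => by
        by_cases h : i = k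
        · subst h; simp [hs']
        · simpa [hs', h] using hs i (by simp [h, hi])
      have e2 : G (s' + Pi.single k 1) = F (s' + Pi.single k 1) :=
        ih _ (add_nonneg hs'0 hone0) fun i hi => by
          by_cases h : i = k
          · subst h; simp [hs']
          · simpa [hs', h] using hs i (by simp [h, hi])
      rw [hss, hGM.add_single, hF s' hs'0 k _ (hs0 k), e1]
      simp only [fdiff, e1, e2]
  exact fun s hs => key Finset.univ s hs (by simp)

end MultiAffine

/-! ### Concavity of powers and second derivatives -/

lemma deriv2_nonpos_of_concave {h h' : ℝ → ℝ} {h'' q ε : ℝ} (hε : 0 < ε) (hq : 0 < q)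
    (hpos : ∀ t ∈ Ioo (-ε) ε, 0 < h t) (h1 : ∀ t ∈ Ioo (-ε) ε, HasDerivAt h (h' t) t)
    (h2 : HasDerivAt h' h'' 0) (hc : ConcaveOn ℝ (Ioo (-ε) ε) fun t => h t ^ q) :
    h 0 * h'' ≤ (1 - q) * h' 0 ^ 2 := by
  have h0 : (0 : ℝ) ∈ Ioo (-ε) ε := ⟨by linarith, hε⟩
  have hp0 := hpos 0 h0
  have hd : ∀ t ∈ Ioo (-ε) ε, HasDerivAt (fun t => h t ^ q) (h' t * q * h t ^ (q - 1)) t :=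
    fun t ht => (h1 t ht).rpow_const (Or.inl (hpos t ht).ne')
  have hanti : AntitoneOn (fun t => h' t * q * h t ^ (q - 1)) (Ioo (-ε) ε) := by
    have := hc.antitoneOn_deriv fun t ht => (hd t ht).differentiableAt
    exact this.congr fun t ht => (hd t ht).deriv
  have hd2 : HasDerivAt (fun t => h' t * q * h t ^ (q - 1))
      (h'' * q * h 0 ^ (q - 1) + h' 0 * q * (h' 0 * (q - 1) * h 0 ^ (q - 1 - 1))) 0 :=
    (h2.mul_const q).mul ((h1 0 h0).rpow_const (Or.inl hp0.ne'))
  have hnon : h'' * q * h 0 ^ (q - 1) + h' 0 * q * (h' 0 * (q - 1) * h 0 ^ (q - 1 - 1)) ≤ 0 := by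
    have := hanti.derivWithin_nonpos (x := 0)
    rwa [hd2.hasDerivWithinAt.derivWithin (isOpen_Ioo.uniqueDiffWithinAt h0)] at this
  have e : h 0 ^ (q - 1) = h 0 ^ (q - 1 - 1) * h 0 := by
    rw [← Real.rpow_add_one hp0.ne']; congr 1; ring
  rw [e] at hnon
  have h3 : 0 < q * h 0 ^ (q - 1 - 1) := by positivity
  have : q * h 0 ^ (q - 1 - 1) * (h 0 * h'' - (1 - q) * h' 0 ^ 2) ≤ 0 := by
    linarith
  have := nonpos_of_mul_nonpos_right this h3
  linarith

lemma concaveOn_rpow_of_deriv2 {h h' h'' : ℝ → ℝ} {q : ℝ} (hq : 0 < q)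
    (hcont : ContinuousOn h (Ici 0)) (hpos : ∀ t, 0 < t → 0 < h t)
    (h1 : ∀ t, 0 < t → HasDerivAt h (h' t) t) (h2 : ∀ t, 0 < t → HasDerivAt h' (h'' t) t)
    (hle : ∀ t, 0 < t → h t * h'' t ≤ (1 - q) * h' t ^ 2) :
    ConcaveOn ℝ (Ici 0) fun t => h t ^ q := by
  have hd : ∀ t, 0 < t → HasDerivAt (fun t => h t ^ q) (h' t * q * h t ^ (q - 1)) t :=
    fun t ht => (h1 t ht).rpow_const (Or.inl (hpos t ht).ne')
  have hd2 : ∀ t, 0 < t → HasDerivAt (fun t => h' t * q * h t ^ (q - 1))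
      (h'' t * q * h t ^ (q - 1) + h' t * q * (h' t * (q - 1) * h t ^ (q - 1 - 1))) t :=
    fun t ht => ((h2 t ht).mul_const q).mul ((h1 t ht).rpow_const (Or.inl (hpos t ht).ne'))
  refine concaveOn_of_hasDerivWithinAt2_nonpos (convex_Ici 0)
    (hcont.rpow_const fun _ _ => Or.inr hq.le) (f' := fun t => h' t * q * h t ^ (q - 1))
    (f'' := fun t => h'' t * q * h t ^ (q - 1) +
      h' t * q * (h' t * (q - 1) * h t ^ (q - 1 - 1))) ?_ ?_ ?_
  · intro t ht
    rw [interior_Ici] at ht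
    exact (hd t ht).hasDerivWithinAt
  · intro t ht
    rw [interior_Ici] at ht
    exact (hd2 t ht).hasDerivWithinAt
  · intro t ht
    rw [interior_Ici] at ht
    have hp := hpos t ht
    have e : h t ^ (q - 1) = h t ^ (q - 1 - 1) * h t := by
      rw [← Real.rpow_add_one hp.ne']; congr 1; ring
    rw [e]
    have h3 : 0 < q * h t ^ (q - 1 - 1) := by positivity
    nlinarith [hle t ht]

/-! ### A hyperbolic quadratic form argument -/

section Hyperbolic

variable {ι : Type*} [Fintype ι]

/-- A weighted graph Laplacian of a connected graph is onto the orthogonal complement of its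
kernel. -/
lemma exists_laplacian_eq {q : ι → ι → ℝ} {c b : ι → ℝ} (hq : ∀ i j, 0 ≤ q i j)
    (hsymm : ∀ i j, q i j = q j i) (hc : ∀ i, 0 < c i)
    (hconn : ∀ i j, 0 < q i j ∨ ∃ l, 0 < q i l ∧ 0 < q l j) (hb : ∑ i, c i * b i = 0) :
    ∃ g : ι → ℝ, ∀ i, ∑ j, q i j * c j * (g i - g j) = b i := by
  have hself : ∀ g h : ι → ℝ, ∑ i, c i * h i * ∑ j, q i j * c j * (g i - g j) =
      ∑ i, c i * g i * ∑ j, q i j * c j * (h i - h j) := by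
    intro g h
    have e : ∀ g h : ι → ℝ, ∑ i, c i * h i * ∑ j, q i j * c j * (g i - g j) =
        ∑ i, ∑ j, q i j * c i * c j * (h i * g i) - ∑ i, ∑ j, q i j * c i * c j * (h i * g j) := by
      intro g h
      rw [← Finset.sum_sub_distrib]
      refine Finset.sum_congr rfl fun i _ => ?_
      rw [Finset.mul_sum, ← Finset.sum_sub_distrib]
      exact Finset.sum_congr rfl fun j _ => by ring
    rw [e, e]
    congr 1
    · exact Finset.sum_congr rfl fun i _ => Finset.sum_congr rfl fun j _ => by ring
    · rw [Finset.sum_comm]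
      exact Finset.sum_congr rfl fun i _ => Finset.sum_congr rfl fun j _ => by
        rw [hsymm]; ring
  have hquad : ∀ g : ι → ℝ, 2 * ∑ i, c i * g i * ∑ j, q i j * c j * (g i - g j) =
      ∑ i, ∑ j, q i j * c i * c j * (g i - g j) ^ 2 := by
    intro g
    have e1 : ∑ i, c i * g i * ∑ j, q i j * c j * (g i - g j) =
        ∑ i, ∑ j, q i j * c i * c j * (g i * (g i - g j)) :=
      Finset.sum_congr rfl fun i _ => by
        rw [Finset.mul_sum]; exact Finset.sum_congr rfl fun j _ => by ring
    have e2 : ∑ i, ∑ j, q i j * c i * c j * (g i * (g i - g j)) =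
        ∑ i, ∑ j, q i j * c i * c j * (g j * (g j - g i)) := by
      rw [Finset.sum_comm]
      exact Finset.sum_congr rfl fun i _ => Finset.sum_congr rfl fun j _ => by rw [hsymm]; ring
    rw [two_mul, e1]
    nth_rw 2 [e2]
    simp only [← Finset.sum_add_distrib]
    exact Finset.sum_congr rfl fun i _ => Finset.sum_congr rfl fun j _ => by ring
  set Λ : (ι → ℝ) →ₗ[ℝ] (ι → ℝ) :=
    { toFun := fun g i => ∑ j, q i j * c j * (g i - g j) + ∑ j, c j * g j
      map_add' := fun g h => by
        funext i
        simp only [Pi.add_apply]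
        simp only [← Finset.sum_add_distrib]
        exact Finset.sum_congr rfl fun j _ => by ring
      map_smul' := fun a g => by
        funext i
        simp only [Pi.smul_apply, smul_eq_mul, RingHom.id_apply, mul_add, Finset.mul_sum,
          ← Finset.sum_add_distrib]
        exact Finset.sum_congr rfl fun j _ => by ring } with hΛ
  have hΛa : ∀ g i, Λ g i = ∑ j, q i j * c j * (g i - g j) + ∑ j, c j * g j := fun _ _ => rfl
  have hzero : ∀ g : ι → ℝ, ∑ i, c i * ∑ j, q i j * c j * (g i - g j) = 0 := by
    intro g
    have := hself g 1
    simpa using this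
  have hmean : ∀ g : ι → ℝ, ∑ i, c i * Λ g i = (∑ i, c i) * ∑ j, c j * g j := by
    intro g
    simp only [hΛa, mul_add, Finset.sum_add_distrib, hzero, zero_add, ← Finset.sum_mul]
  rcases isEmpty_or_nonempty ι with hι | ⟨⟨i0⟩⟩
  · exact ⟨0, fun i => (hι.false i).elim⟩
  have hcs : 0 < ∑ i, c i := Finset.sum_pos (fun i _ => hc i) ⟨i0, Finset.mem_univ _⟩
  have hinj : Function.Injective Λ := by
    rw [← LinearMap.ker_eq_bot, LinearMap.ker_eq_bot']
    intro g hg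
    have h1 := hmean g
    simp only [hg, Pi.zero_apply, mul_zero, Finset.sum_const_zero] at h1
    have h2 : ∑ j, c j * g j = 0 := by
      rcases mul_eq_zero.1 h1.symm with h | h
      · exact absurd h hcs.ne'
      · exact h
    have h3 : ∀ i, ∑ j, q i j * c j * (g i - g j) = 0 := by
      intro i
      have := congrFun hg i
      rwa [hΛa, h2, add_zero] at this
    have h4 := hquad g
    simp only [h3, mul_zero, Finset.sum_const_zero] at h4
    have hnn : ∀ i j, 0 ≤ q i j * c i * c j * (g i - g j) ^ 2 := fun i j =>
      mul_nonneg (mul_nonneg (mul_nonneg (hq i j) (hc i).le) (hc j).le) (sq_nonneg _)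
    have h5 : ∀ i j, 0 < q i j → g i = g j := by
      intro i j hij
      have a1 := (Finset.sum_eq_zero_iff_of_nonneg
        fun i _ => Finset.sum_nonneg fun j _ => hnn i j).1 h4.symm i (Finset.mem_univ _)
      have a2 := (Finset.sum_eq_zero_iff_of_nonneg fun j _ => hnn i j).1 a1 j (Finset.mem_univ _)
      have : 0 < q i j * c i * c j := mul_pos (mul_pos hij (hc i)) (hc j)
      have a3 := (mul_eq_zero.1 a2).resolve_left this.ne'
      exact sub_eq_zero.1 (pow_eq_zero_iff two_ne_zero |>.1 a3)
    have h6 : ∀ i j, g i = g j := by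
      intro i j
      rcases hconn i j with h | ⟨l, hl1, hl2⟩
      · exact h5 i j h
      · exact (h5 i l hl1).trans (h5 l j hl2)
    have h7 : (∑ j, c j) * g i0 = 0 := by
      rw [Finset.sum_mul, ← h2]
      exact Finset.sum_congr rfl fun j _ => by rw [h6 j i0]
    funext i
    rw [h6 i i0]
    exact (mul_eq_zero.1 h7).resolve_left hcs.ne'
  obtain ⟨g, hg⟩ := LinearMap.surjective_of_injective hinj b
  refine ⟨g, fun i => ?_⟩
  have h1 := hmean g
  rw [hg, hb] at h1
  have h2 := (mul_eq_zero.1 h1.symm).resolve_left hcs.ne'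
  have h3 := congrFun hg i
  rwa [hΛa, h2, add_zero] at h3

/-- Reverse Cauchy–Schwarz inequality for a quadratic form of hyperbolic signature. -/
lemma reverse_cauchy_schwarz {d u Bff Bfc Bcc lf lc : ℝ} (hd : 1 ≤ d) (hu : 0 < u)
    (hB : ∀ x : ℝ, d * u * (Bff - 2 * x * Bfc + x ^ 2 * Bcc) ≤ (d - 1) * (lf - x * lc) ^ 2)
    (hBc : d * u * Bcc ≤ (d - 1) * lc ^ 2) (hcc : 0 < Bcc) :
    (d * (d - 1) * u + 2 * (d - 1) * lf + Bff) * Bcc ≤ ((d - 1) * lc + Bfc) ^ 2 := by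
  have hlc : lc ≠ 0 := by
    rintro rfl
    have : 0 < d * u * Bcc := by positivity
    simp at hBc
    linarith
  set x := (d * u + lf) / lc with hx
  have e : lf - x * lc = - (d * u) := by rw [hx]; field_simp; ring
  have h1 := hB x
  rw [e] at h1
  have h2 : Bff - 2 * x * Bfc + x ^ 2 * Bcc ≤ (d - 1) * (d * u) := by
    have hdu : 0 < d * u := by positivity
    have : d * u * (Bff - 2 * x * Bfc + x ^ 2 * Bcc) ≤ d * u * ((d - 1) * (d * u)) := by linarith
    exact le_of_mul_le_mul_left this hdu
  have e2 : lf = x * lc - d * u := by linarith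
  have h3 : d * (d - 1) * u + 2 * (d - 1) * lf + Bff ≤
      2 * x * ((d - 1) * lc + Bfc) - x ^ 2 * Bcc := by
    rw [e2]; linarith
  have h4 := mul_le_mul_of_nonneg_right h3 hcc.le
  nlinarith [sq_nonneg ((d - 1) * lc + Bfc - x * Bcc)]

/-- A special case of the Alexandrov–Fenchel inequality in terms of second and third
differences. -/
lemma alexandrov_fenchel_of_concave {d : ℝ} (hd : 1 < d) {u c : ι → ℝ} {a : ι → ι → ℝ}
    {t : ι → ι → ι → ℝ} (hu : ∀ k, 0 < u k) (hc : ∀ k, 0 < c k) (ha : ∀ i j, a i j = a j i)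
    (ht0 : ∀ i j k, 0 ≤ t i j k) (ht1 : ∀ i j k, t i j k = t j i k)
    (ht2 : ∀ i j k, t i j k = t i k j)
    (hconc : ∀ k (f : ι → ℝ), d * u k * ∑ i, ∑ j, f i * f j * t k i j ≤
      (d - 1) * (∑ j, f j * a k j) ^ 2)
    (hconn : ∀ i j, (∃ l, 0 < t i j l) ∨ ∃ m, (∃ l, 0 < t i m l) ∧ ∃ l, 0 < t m j l) :
    d * (∑ k, c k * u k) * (∑ k, ∑ i, ∑ j, c k * (c i * c j * t k i j)) ≤
      (d - 1) * (∑ k, ∑ j, c k * (c j * a k j)) ^ 2 := by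
  set q : ι → ι → ℝ := fun i j => ∑ l, c l * t i j l with hq
  have hq0 : ∀ i j, 0 ≤ q i j := fun i j =>
    Finset.sum_nonneg fun l _ => mul_nonneg (hc l).le (ht0 i j l)
  have hqs : ∀ i j, q i j = q j i := fun i j => by simp only [hq, ht1 i j]
  have hqp : ∀ i j l, 0 < t i j l → 0 < q i j := fun i j l h =>
    Finset.sum_pos' (fun l _ => mul_nonneg (hc l).le (ht0 i j l))
      ⟨l, Finset.mem_univ _, mul_pos (hc l) h⟩
  have hconn' : ∀ i j, 0 < q i j ∨ ∃ l, 0 < q i l ∧ 0 < q l j := by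
    intro i j
    rcases hconn i j with ⟨l, h⟩ | ⟨m, ⟨l, h⟩, l', h'⟩
    · exact Or.inl (hqp _ _ _ h)
    · exact Or.inr ⟨m, hqp _ _ _ h, hqp _ _ _ h'⟩
  rcases isEmpty_or_nonempty ι with hι | ⟨⟨i0⟩⟩
  · simp
  set w : ι → ℝ := fun k => ∑ j, q k j * c j with hw
  have hw0 : ∀ k, 0 < w k := by
    intro k
    obtain ⟨j, hj⟩ : ∃ j, 0 < q k j := by
      rcases hconn' k k with h | ⟨l, h, -⟩
      exacts [⟨_, h⟩, ⟨_, h⟩]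
    exact Finset.sum_pos' (fun l _ => mul_nonneg (hq0 k l) (hc l).le)
      ⟨j, Finset.mem_univ _, mul_pos hj (hc j)⟩
  have hwt : ∀ k, ∑ i, ∑ j, c i * c j * t k i j = w k := by
    intro k
    simp only [hw, hq, Finset.sum_mul]
    exact Finset.sum_congr rfl fun i _ => Finset.sum_congr rfl fun j _ => by ring
  set W := ∑ k, c k * w k with hW
  have hW0 : 0 < W := Finset.sum_pos (fun k _ => mul_pos (hc k) (hw0 k)) ⟨i0, Finset.mem_univ _⟩
  have hWt : ∑ k, ∑ i, ∑ j, c k * (c i * c j * t k i j) = W := by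
    simp only [← Finset.mul_sum, hwt, hW]
  set A := ∑ k, ∑ j, c k * (c j * a k j) with hA
  set l : ι → ℝ := fun k => ∑ j, c j * a k j with hl
  have hAl : A = ∑ k, c k * l k := by simp only [hA, hl, Finset.mul_sum]
  set α := (d - 1) * A / W with hα
  have hαW : α * W = (d - 1) * A := by rw [hα, div_mul_cancel₀ _ hW0.ne']
  obtain ⟨g, hg⟩ := exists_laplacian_eq (b := fun k => (d - 1) * l k - α * w k) hq0 hqs hc hconn'
    (by
      simp only [mul_sub, Finset.sum_sub_distrib, mul_left_comm (c _), ← Finset.mul_sum]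
      rw [← hAl, ← hW, hαW, sub_self])
  set f : ι → ℝ := fun k => c k * g k with hf
  have hqf : ∀ k, ∑ j, q k j * f j = w k * g k - ((d - 1) * l k - α * w k) := by
    intro k
    rw [← hg k, hw]
    simp only [Finset.sum_mul, ← Finset.sum_sub_distrib]
    exact Finset.sum_congr rfl fun j _ => by simp only [hf]; ring
  have hk : ∀ k, d * (d - 1) * u k + 2 * (d - 1) * (∑ j, f j * a k j) +
      ∑ i, ∑ j, f i * f j * t k i j ≤ w k * (g k + α) ^ 2 := by
    intro k
    have hfc : ∑ i, ∑ j, f i * c j * t k i j = ∑ j, q k j * f j := by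
      simp only [hq, Finset.sum_mul]
      exact Finset.sum_congr rfl fun i _ => Finset.sum_congr rfl fun j _ => by ring
    have hfc' : ∑ i, ∑ j, c i * f j * t k i j = ∑ i, ∑ j, f i * c j * t k i j := by
      rw [Finset.sum_comm]
      exact Finset.sum_congr rfl fun i _ => Finset.sum_congr rfl fun j _ => by rw [ht2]; ring
    have := reverse_cauchy_schwarz (d := d) (u := u k) (Bff := ∑ i, ∑ j, f i * f j * t k i j)
      (Bfc := ∑ i, ∑ j, f i * c j * t k i j) (Bcc := ∑ i, ∑ j, c i * c j * t k i j)
      (lf := ∑ j, f j * a k j) (lc := l k) hd.le (hu k) (fun x => by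
        have h := hconc k (fun i => f i - x * c i)
        have e1 : ∑ i, ∑ j, (f i - x * c i) * (f j - x * c j) * t k i j =
            ∑ i, ∑ j, f i * f j * t k i j - 2 * x * ∑ i, ∑ j, f i * c j * t k i j +
              x ^ 2 * ∑ i, ∑ j, c i * c j * t k i j := by
          have : 2 * x * ∑ i, ∑ j, f i * c j * t k i j = x * ∑ i, ∑ j, f i * c j * t k i j +
            x * ∑ i, ∑ j, c i * f j * t k i j := by rw [hfc']; ring
          rw [this]
          simp only [Finset.mul_sum, ← Finset.sum_sub_distrib, ← Finset.sum_add_distrib]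
          exact Finset.sum_congr rfl fun i _ => Finset.sum_congr rfl fun j _ => by ring
        have e2 : ∑ j, (f j - x * c j) * a k j = ∑ j, f j * a k j - x * l k := by
          simp only [hl, Finset.mul_sum, ← Finset.sum_sub_distrib]
          exact Finset.sum_congr rfl fun j _ => by ring
        rwa [e1, e2] at h) (hconc k c) (by rw [hwt]; exact hw0 k)
    rw [hwt, hfc, hqf] at this
    have e : ((d - 1) * l k + (w k * g k - ((d - 1) * l k - α * w k))) ^ 2 =
        w k * (g k + α) ^ 2 * w k := by ring
    rw [e] at this
    exact le_of_mul_le_mul_right this (hw0 k)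
  have hsum := Finset.sum_le_sum fun k (_ : k ∈ Finset.univ) =>
    mul_le_mul_of_nonneg_left (hk k) (hc k).le
  have e1 : ∑ k, c k * (d * (d - 1) * u k + 2 * (d - 1) * (∑ j, f j * a k j) +
      ∑ i, ∑ j, f i * f j * t k i j) = d * (d - 1) * (∑ k, c k * u k) +
      2 * (∑ k, f k * ((d - 1) * l k)) + ∑ i, f i * ∑ j, q i j * f j := by
    have h1 : ∑ k, f k * ((d - 1) * l k) = (d - 1) * ∑ k, c k * ∑ j, f j * a k j := by
      simp only [hl, Finset.mul_sum]
      rw [Finset.sum_comm]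
      exact Finset.sum_congr rfl fun i _ => Finset.sum_congr rfl fun j _ => by rw [ha]; ring
    have h2 : ∑ i, f i * ∑ j, q i j * f j = ∑ k, c k * ∑ i, ∑ j, f i * f j * t k i j := by
      simp only [hq, Finset.mul_sum, Finset.sum_mul]
      have : ∀ i, ∑ j, ∑ l, f i * (c l * t i j l * f j) =
          ∑ l, ∑ j, f i * (c l * t i j l * f j) := fun i => Finset.sum_comm
      simp only [this]
      rw [Finset.sum_comm]
      exact Finset.sum_congr rfl fun i _ => Finset.sum_congr rfl fun j _ =>
        Finset.sum_congr rfl fun k _ => by rw [ht2 j k i, ht1 j i k]; ring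
    rw [h1, h2]
    simp only [mul_add, Finset.sum_add_distrib, Finset.mul_sum]
    congr 2
    · exact Finset.sum_congr rfl fun i _ => by ring
    · exact Finset.sum_congr rfl fun i _ => Finset.sum_congr rfl fun j _ => by ring
  rw [e1] at hsum
  simp only [hqf] at hsum
  have hlap : 0 ≤ ∑ k, c k * g k * ((d - 1) * l k - α * w k) := by
    have e : ∑ k, c k * g k * ((d - 1) * l k - α * w k) =
        ∑ i, ∑ j, q i j * c i * c j * (g i * (g i - g j)) :=
      Finset.sum_congr rfl fun i _ => by
        rw [← hg i, Finset.mul_sum]; exact Finset.sum_congr rfl fun j _ => by ring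
    have e2 : ∑ i, ∑ j, q i j * c i * c j * (g i * (g i - g j)) =
        ∑ i, ∑ j, q i j * c i * c j * (g j * (g j - g i)) := by
      rw [Finset.sum_comm]
      exact Finset.sum_congr rfl fun i _ => Finset.sum_congr rfl fun j _ => by rw [hqs]; ring
    have e3 : 2 * ∑ i, ∑ j, q i j * c i * c j * (g i * (g i - g j)) =
        ∑ i, ∑ j, q i j * c i * c j * (g i - g j) ^ 2 := by
      rw [two_mul]
      nth_rw 2 [e2]
      simp only [← Finset.sum_add_distrib]
      exact Finset.sum_congr rfl fun i _ => Finset.sum_congr rfl fun j _ => by ring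
    have e4 : 0 ≤ ∑ i, ∑ j, q i j * c i * c j * (g i - g j) ^ 2 :=
      Finset.sum_nonneg fun i _ => Finset.sum_nonneg fun j _ =>
        mul_nonneg (mul_nonneg (mul_nonneg (hq0 i j) (hc i).le) (hc j).le) (sq_nonneg _)
    rw [e]; linarith
  have e2 : ∑ k, c k * (w k * (g k + α) ^ 2) - (2 * (∑ k, f k * ((d - 1) * l k)) +
      ∑ i, f i * (w i * g i - ((d - 1) * l i - α * w i))) =
      α ^ 2 * W - ∑ k, c k * g k * ((d - 1) * l k - α * w k) := by
    simp only [hW, Finset.mul_sum, ← Finset.sum_add_distrib, ← Finset.sum_sub_distrib]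
    exact Finset.sum_congr rfl fun k _ => by simp only [hf]; ring
  have hfin : d * (d - 1) * (∑ k, c k * u k) ≤ α ^ 2 * W := by linarith
  rw [hWt]
  have h5 := mul_le_mul_of_nonneg_right hfin hW0.le
  have h6 : α ^ 2 * W * W = (d - 1) ^ 2 * A ^ 2 := by
    calc α ^ 2 * W * W = (α * W) ^ 2 := by ring
      _ = _ := by rw [hαW]; ring
  rw [h6] at h5
  have h7 : (d - 1) * (d * (∑ k, c k * u k) * W) ≤ (d - 1) * ((d - 1) * A ^ 2) := by linarith
  exact le_of_mul_le_mul_left h7 (by linarith)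

end Hyperbolic

/-! ### Brunn–Minkowski inequality for mixed volumes with zonotopes -/

section SurfConcave

variable {n : ℕ} {ι : Type*} [Fintype ι] {θ : ι → Euc n} {L : Set (Euc n)}

/-- The mixed volume of `L` with the zonotope of the segments `[0, c k • θ k]`, normalised as a
surface area. -/
def surf (θ : ι → Euc n) (c : ι → ℝ) (L : Set (Euc n)) : ℝ := ∑ k, c k * psi (θ k) L

lemma le_cubic_coeff {c a0 a1 a2 a3 : ℝ}
    (h : ∀ N : ℕ, c * (N : ℝ) ^ 3 ≤ a0 + a1 * N + a2 * (N : ℝ) ^ 2 + a3 * (N : ℝ) ^ 3) :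
    c ≤ a3 := by
  by_contra! hlt
  obtain ⟨N, hN⟩ := exists_nat_gt ((|a0| + |a1| + |a2|) / (c - a3) + 1)
  have hN1 : (1 : ℝ) ≤ N := by
    have : 0 ≤ (|a0| + |a1| + |a2|) / (c - a3) := div_nonneg (by positivity) (by linarith)
    linarith
  have h1 : |a0| + |a1| + |a2| < (c - a3) * N := by
    rw [mul_comm, ← div_lt_iff₀ (by linarith)]; linarith
  have h2 : a0 ≤ |a0| * (N : ℝ) ^ 2 :=
    (le_abs_self _).trans (le_mul_of_one_le_right (abs_nonneg _) (one_le_pow₀ hN1))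
  have h3 : a1 * N ≤ |a1| * (N : ℝ) ^ 2 :=
    mul_le_mul (le_abs_self _) (by nlinarith) (by linarith) (abs_nonneg _)
  have h4 : a2 * (N : ℝ) ^ 2 ≤ |a2| * (N : ℝ) ^ 2 := by gcongr; exact le_abs_self _
  have h5 : 0 < (N : ℝ) ^ 2 := by positivity
  have h6 := mul_lt_mul_of_pos_right h1 h5
  nlinarith [h N]

section Differences

variable [DecidableEq ι]

lemma OpenBody.fdiff_real_add_zono (hL : OpenBody L) {s : ι → ℝ} (hs : 0 ≤ s) (k : ι) {r : ℝ}
    (hr : 0 ≤ r) : volume.real (L + zono θ (s + Pi.single k r)) =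
      volume.real (L + zono θ s) + r * psi (θ k) (L + zono θ s) := by
  rw [zono_add θ hs (by simpa using hr), zono_single, ← add_assoc,
    (hL.add_zono θ hs).real_add_seg _ hr]

/-- The globally multi-affine extension of the volume of `L` plus a zonotope. -/
lemma OpenBody.exists_multiAffine (hL : OpenBody L) (θ : ι → Euc n) :
    ∃ U : (ι → ℝ) → ℝ, MultiAffine U ∧ (∀ s, 0 ≤ s → U s = volume.real (L + zono θ s)) ∧
      ∀ k s, 0 ≤ s → fdiff k U s = psi (θ k) (L + zono θ s) := by
  have hF : ∀ s : ι → ℝ, 0 ≤ s → ∀ k,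
      fdiff k (fun s => volume.real (L + zono θ s)) s = psi (θ k) (L + zono θ s) := by
    intro s hs k
    rw [fdiff, hL.fdiff_real_add_zono hs k zero_le_one]; ring
  obtain ⟨U, hU, hUF⟩ := _root_.exists_multiAffine
    (F := fun s => volume.real (L + zono θ s)) fun s hs k r hr => by
      rw [hF s hs, hL.fdiff_real_add_zono hs k hr]
  refine ⟨U, hU, hUF, fun k s hs => ?_⟩
  rw [← hF s hs, fdiff, fdiff, hUF s hs, hUF _ (add_nonneg hs (by simp))]

lemma fdiff_comm (i j : ι) (F : (ι → ℝ) → ℝ) : fdiff i (fdiff j F) = fdiff j (fdiff i F) := by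
  funext s
  simp only [fdiff]
  rw [add_right_comm]; ring

lemma multiAffine_add_three {U : (ι → ℝ) → ℝ} (hU : MultiAffine U) (s : ι → ℝ) (i j k : ι)
    (r : ℝ) : U (s + Pi.single k r + Pi.single i r + Pi.single j r) =
      U s + r * (fdiff i U s + fdiff j U s + fdiff k U s) +
      r ^ 2 * (fdiff i (fdiff k U) s + fdiff j (fdiff k U) s + fdiff j (fdiff i U) s) +
      r ^ 3 * fdiff j (fdiff i (fdiff k U)) s := by
  rw [hU.add_single, (hU.fdiff j).add_single, hU.add_single, (hU.fdiff i).add_single,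
    (hU.fdiff j).add_single, ((hU.fdiff j).fdiff i).add_single, hU.add_single,
    fdiff_comm i j, fdiff_comm k j, fdiff_comm k i, fdiff_comm k j, fdiff_comm k i]
  ring

lemma OpenBody.le_third_difference (hL : OpenBody L) {U : (ι → ℝ) → ℝ} (hU : MultiAffine U)
    (hUv : ∀ s, 0 ≤ s → U s = volume.real (L + zono θ s)) {s : ι → ℝ} (hs : 0 ≤ s) (i j k : ι) :
    0 ≤ fdiff j (fdiff i (fdiff k U)) s ∧
      (LinearIndependent ℝ ![θ k, θ i, θ j] → 0 < fdiff j (fdiff i (fdiff k U)) s) := by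
  have hnn : ∀ (l : ι) {r : ℝ}, 0 ≤ r → (0 : ι → ℝ) ≤ Pi.single l r := by
    intro l r hr; simpa using hr
  have hval : ∀ r : ℝ, 0 ≤ r → U (s + Pi.single k r + Pi.single i r + Pi.single j r) =
      volume.real ((L + zono θ s) + zono ![θ k, θ i, θ j] fun _ => r) := by
    intro r hr
    have h1 := add_nonneg hs (hnn k hr)
    have h2 := add_nonneg h1 (hnn i hr)
    rw [hUv _ (add_nonneg h2 (hnn j hr)), zono_add θ h2 (hnn j hr), zono_add θ h1 (hnn i hr),
      zono_add θ hs (hnn k hr), zono_single, zono_single, zono_single]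
    simp only [zono, Fin.sum_univ_three, add_assoc]
    rfl
  constructor
  · refine le_cubic_coeff (a0 := U s) (a1 := fdiff i U s + fdiff j U s + fdiff k U s)
      (a2 := fdiff i (fdiff k U) s + fdiff j (fdiff k U) s + fdiff j (fdiff i U) s) fun N => ?_
    have := multiAffine_add_three hU s i j k N
    rw [hval _ (by positivity)] at this
    have h0 : 0 ≤ volume.real ((L + zono θ s) + zono ![θ k, θ i, θ j] fun _ => (N : ℝ)) :=
      measureReal_nonneg
    linarith
  · intro hind
    obtain ⟨c, hc, M, hM, h⟩ := (hL.add_zono θ hs).exists_cubic_lower_bound hind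
    have : c ≤ M ^ 3 * fdiff j (fdiff i (fdiff k U)) s := by
      refine le_cubic_coeff (a0 := U s) (a1 := M * (fdiff i U s + fdiff j U s + fdiff k U s))
        (a2 := M ^ 2 * (fdiff i (fdiff k U) s + fdiff j (fdiff k U) s + fdiff j (fdiff i U) s))
        fun N => (h N).trans (le_of_eq ?_)
      have := multiAffine_add_three hU s i j k (M * N)
      rw [hval _ (by positivity)] at this
      rw [this]; ring
    exact pos_of_mul_pos_right (hc.trans_le this) (by positivity)

lemma OpenBody.second_order (hL : OpenBody L) (hn : 2 ≤ n) (hθ : ∀ k, θ k ≠ 0)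
    {U : (ι → ℝ) → ℝ} (hU : MultiAffine U)
    (hUp : ∀ k s, 0 ≤ s → fdiff k U s = psi (θ k) (L + zono θ s)) {x : ι → ℝ} (hx : ∀ i, 0 < x i)
    (k : ι) (f : ι → ℝ) :
    ((n : ℝ) - 1) * fdiff k U x * ∑ i, ∑ j, f i * f j * fdiff j (fdiff i (fdiff k U)) x ≤
      ((n : ℝ) - 1 - 1) * (∑ j, f j * fdiff j (fdiff k U) x) ^ 2 := by
  have hd : (0 : ℝ) < (n : ℝ) - 1 := by
    have : (2 : ℝ) ≤ n := by exact_mod_cast hn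
    linarith
  obtain ⟨ε, hε, hpos⟩ : ∃ ε : ℝ, 0 < ε ∧ ∀ t ∈ Ioo (-ε) ε, 0 ≤ x + t • f := by
    have : ∀ᶠ t : ℝ in nhds 0, ∀ i, 0 < (x + t • f) i := by
      rw [Filter.eventually_all]
      intro i
      have hcont : ContinuousAt (fun t : ℝ => (x + t • f) i) 0 := by
        simp only [Pi.add_apply, Pi.smul_apply, smul_eq_mul]; fun_prop
      refine hcont.eventually (lt_mem_nhds ?_)
      simpa using hx i
    obtain ⟨ε, hε, h⟩ := Metric.eventually_nhds_iff.1 this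
    refine ⟨ε, hε, fun t ht i => (h ?_ i).le⟩
    rw [Real.dist_eq, sub_zero, abs_lt]; exact ht
  have hconc : ConcaveOn ℝ (Ioo (-ε) ε)
      fun t : ℝ => fdiff k U (x + t • f) ^ (1 / ((n : ℝ) - 1)) := by
    refine concaveOn_iff_forall_pos.2 ⟨convex_Ioo _ _, fun t ht t' ht' a b ha hb hab => ?_⟩
    have h1 := hpos t ht
    have h2 := hpos t' ht'
    have h3 := hpos (a • t + b • t') (convex_Ioo (-ε) ε ht ht' ha.le hb.le hab)
    rw [hUp k _ h1, hUp k _ h2, hUp k _ h3]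
    have e : a • (L + zono θ (x + t • f)) + b • (L + zono θ (x + t' • f)) =
        L + zono θ (x + (a • t + b • t') • f) := by
      have e1 : x + (a • t + b • t') • f = a • (x + t • f) + b • (x + t' • f) := by
        conv_lhs => rw [← one_smul ℝ x, ← hab]
        simp only [smul_eq_mul]
        module
      rw [e1, zono_add θ (smul_nonneg ha.le h1) (smul_nonneg hb.le h2),
        ← smul_zono θ ha.le h1, ← smul_zono θ hb.le h2, smul_add, smul_add, add_add_add_comm,
        ← hL.convex.add_smul ha.le hb.le, hab, one_smul]
    rw [← e]
    exact (hL.add_zono θ h1).psi_brunn_minkowski (hL.add_zono θ h2) (hθ k) hn ha hb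
  have := deriv2_nonpos_of_concave hε (by positivity)
    (fun t ht => by
      rw [hUp k _ (hpos t ht)]
      exact (hL.add_zono θ (hpos t ht)).psi_pos (hθ k))
    (fun t _ => (hU.fdiff k).hasDerivAt_ray x f t) ((hU.fdiff k).hasDerivAt_ray_two x f 0) hconc
  simp only [zero_smul, add_zero] at this
  have h2 := mul_le_mul_of_nonneg_left this hd.le
  have e : ((n : ℝ) - 1) * ((1 - 1 / ((n : ℝ) - 1)) *
      (∑ j, f j * fdiff j (fdiff k U) x) ^ 2) =
      ((n : ℝ) - 1 - 1) * (∑ j, f j * fdiff j (fdiff k U) x) ^ 2 := by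
    field_simp
  rw [e] at h2
  linarith

end Differences

lemma exists_linearIndependent_three (hn : 3 ≤ n) (hspan : Submodule.span ℝ (range θ) = ⊤)
    {x y : Euc n} (hxy : LinearIndependent ℝ ![x, y]) :
    ∃ l, LinearIndependent ℝ ![x, y, θ l] := by
  by_contra! h
  have h1 : ∀ l, θ l ∈ Submodule.span ℝ (range ![x, y]) := by
    intro l
    by_contra hl
    refine h l ?_
    have e : ![x, y, θ l] = (Fin.snoc ![x, y] (θ l) : Fin 3 → Euc n) := by
      funext i
      fin_cases i <;> rfl
    rw [e]
    exact hxy.finSnoc hl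
  have h2 : Submodule.span ℝ (range ![x, y]) = ⊤ := by
    rw [eq_top_iff, ← hspan, Submodule.span_le]
    rintro _ ⟨l, rfl⟩
    exact h1 l
  have h3 := finrank_range_le_card (R := ℝ) ![x, y]
  rw [Set.finrank, h2, finrank_top, finrank_euclideanSpace_fin, Fintype.card_fin] at h3
  omega

lemma linearIndependent_pair_or (hn : 2 ≤ n) (hθ : ∀ k, θ k ≠ 0)
    (hspan : Submodule.span ℝ (range θ) = ⊤) (i j : ι) :
    LinearIndependent ℝ ![θ i, θ j] ∨
      ∃ m, LinearIndependent ℝ ![θ i, θ m] ∧ LinearIndependent ℝ ![θ m, θ j] := by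
  by_cases hij : LinearIndependent ℝ ![θ i, θ j]
  · exact Or.inl hij
  right
  rw [LinearIndependent.pair_iff' (hθ i)] at hij
  push Not at hij
  obtain ⟨a, ha⟩ := hij
  have ha0 : a ≠ 0 := by
    rintro rfl
    exact hθ j (by rw [← ha, zero_smul])
  obtain ⟨m, hm⟩ : ∃ m, θ m ∉ Submodule.span ℝ {θ i} := by
    by_contra! h
    have h2 : Submodule.span ℝ {θ i} = ⊤ := by
      rw [eq_top_iff, ← hspan, Submodule.span_le]
      rintro _ ⟨l, rfl⟩
      exact h l
    have h3 := finrank_span_singleton (K := ℝ) (hθ i)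
    rw [h2, finrank_top, finrank_euclideanSpace_fin] at h3
    omega
  rw [Submodule.mem_span_singleton] at hm
  push Not at hm
  have him : LinearIndependent ℝ ![θ i, θ m] := (LinearIndependent.pair_iff' (hθ i)).2 hm
  refine ⟨m, him, ?_⟩
  rw [LinearIndependent.pair_iff' (hθ m)]
  intro b hb
  rw [← ha] at hb
  have hb0 : b ≠ 0 := by
    rintro rfl
    rw [zero_smul] at hb
    exact smul_ne_zero ha0 (hθ i) hb.symm
  exact hm (b⁻¹ * a) (by rw [mul_smul, ← hb, smul_smul, inv_mul_cancel₀ hb0, one_smul])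

theorem OpenBody.concaveOn_surf (hL : OpenBody L) (hn : 2 ≤ n) (hθ : ∀ k, θ k ≠ 0)
    (hspan : Submodule.span ℝ (range θ) = ⊤) {c : ι → ℝ} (hc : ∀ k, 0 < c k) :
    ConcaveOn ℝ (Ici 0) fun τ : ℝ => surf θ c (L + zono θ (τ • c)) ^ (1 / ((n : ℝ) - 1)) := by
  classical
  have hd : (0 : ℝ) < (n : ℝ) - 1 := by
    have : (2 : ℝ) ≤ n := by exact_mod_cast hn
    linarith
  have hne : Nonempty ι := by
    by_contra h
    rw [not_nonempty_iff] at h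
    rw [range_eq_empty, Submodule.span_empty] at hspan
    have := congrArg (fun S : Submodule ℝ (Euc n) => Module.finrank ℝ S) hspan
    simp only [finrank_bot, finrank_top, finrank_euclideanSpace_fin] at this
    omega
  obtain ⟨U, hU, hUv, hUp⟩ := hL.exists_multiAffine θ
  set φ : ℝ → ℝ := fun τ => ∑ k, c k * fdiff k U (0 + τ • c) with hφ
  have hcn : ∀ {τ : ℝ}, 0 ≤ τ → 0 ≤ τ • c := fun hτ i => mul_nonneg hτ (hc i).le
  have hφs : ∀ τ, 0 ≤ τ → φ τ = surf θ c (L + zono θ (τ • c)) := by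
    intro τ hτ
    simp only [hφ, surf, zero_add]
    exact Finset.sum_congr rfl fun k _ => by rw [hUp k _ (hcn hτ)]
  have h1 : ∀ τ, HasDerivAt φ (∑ k, ∑ j, c k * c j * fdiff j (fdiff k U) (0 + τ • c)) τ :=
    fun τ => hU.hasDerivAt_ray_two 0 c τ
  have h2 : ∀ τ, HasDerivAt
      (fun τ : ℝ => ∑ k, ∑ j, c k * c j * fdiff j (fdiff k U) (0 + τ • c))
      (∑ k, ∑ i, ∑ j, c k * (c i * c j * fdiff j (fdiff i (fdiff k U)) (0 + τ • c))) τ := by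
    intro τ
    have := HasDerivAt.fun_sum fun k (_ : k ∈ (Finset.univ : Finset ι)) =>
      ((hU.fdiff k).hasDerivAt_ray_two 0 c τ).const_mul (c k)
    simpa only [Finset.mul_sum, mul_assoc] using this
  have hup : ∀ τ : ℝ, 0 < τ → ∀ k, 0 < fdiff k U (0 + τ • c) := by
    intro τ hτ k
    rw [zero_add, hUp k _ (hcn hτ.le)]
    exact (hL.add_zono θ (hcn hτ.le)).psi_pos (hθ k)
  have main : ConcaveOn ℝ (Ici 0) fun τ => φ τ ^ (1 / ((n : ℝ) - 1)) := by
    refine concaveOn_rpow_of_deriv2 (by positivity)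
      (fun τ _ => (h1 τ).continuousAt.continuousWithinAt)
      (fun τ hτ => Finset.sum_pos (fun k _ => mul_pos (hc k) (hup τ hτ k)) Finset.univ_nonempty)
      (fun τ _ => h1 τ) (fun τ _ => h2 τ) fun τ hτ => ?_
    have hx : ∀ i, 0 < (0 + τ • c) i := fun i => by simpa using mul_pos hτ (hc i)
    have hx0 : 0 ≤ 0 + τ • c := fun i => (hx i).le
    have hconc := fun k f => hL.second_order hn hθ hU hUp hx k f
    rcases hn.eq_or_lt with rfl | hn3
    · have h3 : ∑ k, ∑ i, ∑ j, c k * (c i * c j * fdiff j (fdiff i (fdiff k U)) (0 + τ • c)) ≤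
          0 := by
        refine Finset.sum_nonpos fun k _ => ?_
        simp only [← Finset.mul_sum]
        refine mul_nonpos_of_nonneg_of_nonpos (hc k).le ?_
        have := hconc k c
        norm_num at this
        simp only [zero_add] at this ⊢
        have h4 := hup τ hτ k
        rw [zero_add] at h4
        exact nonpos_of_mul_nonpos_right this h4
      have h4 : 0 ≤ φ τ := Finset.sum_nonneg fun k _ => (mul_pos (hc k) (hup τ hτ k)).le
      norm_num
      exact mul_nonpos_of_nonneg_of_nonpos h4 (by simpa using h3)
    · have hd1 : (1 : ℝ) < (n : ℝ) - 1 := by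
        have : (3 : ℝ) ≤ n := by exact_mod_cast hn3
        linarith
      have hthird := fun i j k => hL.le_third_difference hU hUv hx0 i j k
      have hcomm := fun i j k => congrArg (fun F => F (0 + τ • c))
        (fdiff_comm i j (fdiff k U))
      have hpair : ∀ i j, LinearIndependent ℝ ![θ i, θ j] →
          ∃ l, 0 < fdiff l (fdiff j (fdiff i U)) (0 + τ • c) := by
        intro i j hij
        obtain ⟨l, hl⟩ := exists_linearIndependent_three hn3 hspan hij
        exact ⟨l, (hthird j l i).2 hl⟩
      have := alexandrov_fenchel_of_concave hd1 (u := fun k => fdiff k U (0 + τ • c)) (c := c)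
        (a := fun k j => fdiff j (fdiff k U) (0 + τ • c))
        (t := fun k i j => fdiff j (fdiff i (fdiff k U)) (0 + τ • c)) (hup τ hτ) hc
        (fun i j => by simp only [fdiff_comm j i]) (fun i j k => (hthird j k i).1)
        (fun i j k => by simp only [fdiff_comm j i])
        (fun i j k => by simp only [fdiff_comm k j]) hconc
        (fun i j => by
          rcases linearIndependent_pair_or hn hθ hspan i j with h | ⟨m, hm1, hm2⟩
          · exact Or.inl (hpair i j h)
          · exact Or.inr ⟨m, hpair i m hm1, hpair m j hm2⟩)
      have e : (1 - 1 / ((n : ℝ) - 1)) = ((n : ℝ) - 1 - 1) / ((n : ℝ) - 1) := by field_simp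
      rw [e, div_mul_eq_mul_div, le_div_iff₀ hd]
      simp only [mul_assoc] at this ⊢
      linarith
  exact main.congr fun τ hτ => by simp only [hφs τ hτ]

end SurfConcave

/-! ### Zonotopes approximating the ball -/

section Approx

open scoped RealInnerProductSpace

variable {n : ℕ} {ι : Type*} [Fintype ι] {θ : ι → Euc n} {c : ι → ℝ}

lemma inner_le_of_mem_zono {x : Euc n} (hx : x ∈ zono θ c) (u : Euc n) :
    ⟪x, u⟫ ≤ ∑ k, c k * max 0 ⟪θ k, u⟫ := by
  obtain ⟨t, ht, rfl⟩ := (mem_zono θ).1 hx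
  rw [sum_inner]
  refine Finset.sum_le_sum fun k _ => ?_
  rw [real_inner_smul_left]
  exact (mul_le_mul_of_nonneg_left (le_max_right 0 _) (ht k).1).trans
    (mul_le_mul_of_nonneg_right (ht k).2 (le_max_left _ _))

lemma exists_mem_zono_inner_eq (hc : 0 ≤ c) (u : Euc n) :
    ∃ x ∈ zono θ c, ⟪x, u⟫ = ∑ k, c k * max 0 ⟪θ k, u⟫ := by
  classical
  refine ⟨_, (mem_zono θ).2 ⟨fun k => if 0 ≤ ⟪θ k, u⟫ then c k else 0, fun k => ?_, rfl⟩, ?_⟩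
  · dsimp only
    split_ifs
    · exact ⟨hc k, le_rfl⟩
    · exact ⟨le_rfl, hc k⟩
  · rw [sum_inner]
    refine Finset.sum_congr rfl fun k _ => ?_
    rw [real_inner_smul_left]
    dsimp only
    split_ifs with h
    · rw [max_eq_right h]
    · rw [max_eq_left (not_le.1 h).le]; simp

lemma zono_subset_closedBall {r : ℝ} (hr : 0 ≤ r)
    (h : ∀ u, ∑ k, c k * max 0 ⟪θ k, u⟫ ≤ r * ‖u‖) : zono θ c ⊆ closedBall 0 r := by
  intro x hx
  rw [mem_closedBall_zero_iff]
  have h1 := (inner_le_of_mem_zono hx x).trans (h x)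
  rw [real_inner_self_eq_norm_mul_norm] at h1
  rcases (norm_nonneg x).eq_or_lt with h0 | h0
  · rwa [← h0]
  · exact le_of_mul_le_mul_right h1 h0

lemma closedBall_subset_zono (hc : 0 ≤ c) {r : ℝ}
    (h : ∀ u, r * ‖u‖ ≤ ∑ k, c k * max 0 ⟪θ k, u⟫) : closedBall 0 r ⊆ zono θ c := by
  intro x hx
  by_contra hxz
  obtain ⟨f, a, h1, h2⟩ := geometric_hahn_banach_closed_point (convex_zono θ c)
    (isCompact_zono θ c).isClosed hxz
  set u := (InnerProductSpace.toDual ℝ (Euc n)).symm f with hu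
  have hf : ∀ y, f y = ⟪y, u⟫ := fun y => by
    rw [real_inner_comm, hu, InnerProductSpace.toDual_symm_apply]
  obtain ⟨z, hz, hzu⟩ := exists_mem_zono_inner_eq hc u
  have h3 := h1 z hz
  rw [hf, hzu] at h3
  rw [hf] at h2
  have h4 : ⟪x, u⟫ ≤ r * ‖u‖ := (real_inner_le_norm x u).trans
    (mul_le_mul_of_nonneg_right (mem_closedBall_zero_iff.1 hx) (norm_nonneg u))
  linarith [h u]

lemma exists_integral_abs_inner (hn : 1 ≤ n) : ∃ w : ℝ, 0 < w ∧ ∀ u : Euc n,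
    ∫ x in closedBall (0 : Euc n) 1, |⟪x, u⟫| = w * ‖u‖ := by
  set e : Euc n := EuclideanSpace.single ⟨0, hn⟩ 1 with he
  have hen : ‖e‖ = 1 := by simp [he]
  have hcont : ∀ u : Euc n, Continuous fun x : Euc n => |⟪x, u⟫| := fun u => by fun_prop
  have hint : ∀ u : Euc n, IntegrableOn (fun x => |⟪x, u⟫|) (closedBall (0 : Euc n) 1) :=
    fun u => (hcont u).continuousOn.integrableOn_compact (isCompact_closedBall _ _)
  refine ⟨∫ x in closedBall (0 : Euc n) 1, |⟪x, e⟫|, ?_, fun u => ?_⟩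
  · rw [setIntegral_pos_iff_support_of_nonneg_ae (ae_of_all _ fun _ => abs_nonneg _) (hint e)]
    refine lt_of_lt_of_le ?_ (measure_mono (?_ : ball ((1 / 2 : ℝ) • e) (1 / 2) ⊆ _))
    · exact measure_ball_pos _ _ (by norm_num)
    · intro x hx
      rw [mem_ball_iff_norm] at hx
      have h1 : ‖(1 / 2 : ℝ) • e‖ = 1 / 2 := by rw [norm_smul, hen]; norm_num
      constructor
      · rw [Function.mem_support]
        have h2 : ⟪x, e⟫ = 1 / 2 + ⟪x - (1 / 2 : ℝ) • e, e⟫ := by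
          rw [inner_sub_left, real_inner_smul_left, real_inner_self_eq_norm_mul_norm, hen]; ring
        have h3 := abs_real_inner_le_norm (x - (1 / 2 : ℝ) • e) e
        rw [hen, mul_one] at h3
        have h4 := (abs_le.1 h3).1
        have : 0 < ⟪x, e⟫ := by linarith
        exact (abs_pos.2 this.ne').ne'
      · rw [mem_closedBall_zero_iff]
        calc ‖x‖ = ‖(1 / 2 : ℝ) • e + (x - (1 / 2 : ℝ) • e)‖ := by rw [add_sub_cancel]
          _ ≤ _ := norm_add_le _ _
          _ ≤ 1 := by linarith
  · rcases eq_or_ne u 0 with rfl | hu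
    · simp
    · have hu' := norm_pos_iff.2 hu
      set ρ := Submodule.reflection (ℝ ∙ (‖u‖ • e - u))ᗮ with hρ
      have hρe : ρ (‖u‖ • e) = u :=
        Submodule.reflection_sub (by rw [norm_smul, hen, norm_norm, mul_one])
      have hpre : ρ ⁻¹' closedBall (0 : Euc n) 1 = closedBall 0 1 := by
        ext x
        simp
      rw [← ρ.measurePreserving.setIntegral_preimage_emb
        ρ.toHomeomorph.measurableEmbedding, hpre]
      conv_lhs => rw [← hρe]
      simp only [ρ.inner_map_map, real_inner_smul_right, abs_mul, abs_norm]
      rw [integral_const_mul, mul_comm]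

lemma exists_discrete_approx {w ε : ℝ} (hε : 0 < ε)
    (hw : ∀ u : Euc n, ∫ x in closedBall (0 : Euc n) 1, |⟪x, u⟫| = w * ‖u‖) :
    ∃ (T : Finset (Euc n)) (m : Euc n → ℝ), (∀ y ∈ T, y ≠ 0 ∧ 0 < m y) ∧
      ∀ u, |∑ y ∈ T, m y * |⟪y, u⟫| - w * ‖u‖| ≤ ε * ‖u‖ := by
  set μ : Measure (Euc n) := volume.restrict (closedBall 0 1) with hμ
  have : IsFiniteMeasure μ := ⟨by
    rw [hμ, Measure.restrict_apply_univ]; exact measure_closedBall_lt_top⟩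
  have hid : Integrable (fun x : Euc n => x) μ :=
    continuous_id.continuousOn.integrableOn_compact (isCompact_closedBall _ _)
  obtain ⟨g, hg, hgm⟩ := (memLp_one_iff_integrable.2 hid).exists_simpleFunc_eLpNorm_sub_lt
    (by norm_num) (ENNReal.ofReal_pos.2 hε).ne'
  have hgi := memLp_one_iff_integrable.1 hgm
  have hsub : ∫ x, ‖x - g x‖ ∂μ ≤ ε := by
    rw [eLpNorm_one_eq_lintegral_enorm] at hg
    have := ENNReal.toReal_mono ENNReal.ofReal_ne_top hg.le
    rw [ENNReal.toReal_ofReal hε.le] at this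
    exact (integral_norm_eq_lintegral_enorm (hid.sub hgi).aestronglyMeasurable).trans_le this
  classical
  refine ⟨g.range.filter fun y => y ≠ 0 ∧ 0 < μ.real (g ⁻¹' {y}), fun y => μ.real (g ⁻¹' {y}),
    fun y hy => (Finset.mem_filter.1 hy).2, fun u => ?_⟩
  have hsum : ∑ y ∈ g.range.filter (fun y => y ≠ 0 ∧ 0 < μ.real (g ⁻¹' {y})),
      μ.real (g ⁻¹' {y}) * |⟪y, u⟫| = ∫ x, |⟪g x, u⟫| ∂μ := by
    have h1 : (fun x => |⟪g x, u⟫|) =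
        fun x => ∑ y ∈ g.range, (g ⁻¹' {y}).indicator (fun _ => |⟪y, u⟫|) x := by
      funext x
      rw [Finset.sum_eq_single (g x)]
      · simp
      · intro y _ hy
        exact indicator_of_notMem (fun h => hy h.symm) _
      · intro h
        exact absurd (g.mem_range_self x) h
    rw [h1, integral_finsetSum _ fun y _ =>
      (integrable_const _).indicator (g.measurableSet_fiber y)]
    rw [Finset.sum_filter]
    refine Finset.sum_congr rfl fun y _ => ?_
    rw [integral_indicator_const _ (g.measurableSet_fiber y), smul_eq_mul]
    split_ifs with h
    · rfl
    · rw [not_and_or, not_not, not_lt] at h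
      rcases h with rfl | h
      · simp
      · rw [le_antisymm h measureReal_nonneg, zero_mul]
  have hi1 : Integrable (fun x => |⟪g x, u⟫|) μ := (hgi.inner_const u).abs
  have hi2 : Integrable (fun x : Euc n => |⟪x, u⟫|) μ := (hid.inner_const u).abs
  rw [hsum, ← hw u, ← integral_sub hi1 hi2]
  refine (abs_integral_le_integral_abs).trans ?_
  calc ∫ x, |(|⟪g x, u⟫| - |⟪x, u⟫|)| ∂μ ≤ ∫ x, ‖x - g x‖ * ‖u‖ ∂μ := by
        refine integral_mono (hi1.sub hi2).abs ((hid.sub hgi).norm.mul_const _) fun x => ?_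
        refine (abs_abs_sub_abs_le_abs_sub _ _).trans ?_
        rw [abs_sub_comm, ← inner_sub_left]
        exact abs_real_inner_le_norm _ _
    _ ≤ ε * ‖u‖ := by
        rw [integral_mul_const]
        exact mul_le_mul_of_nonneg_right hsub (norm_nonneg u)

/-- The closed unit ball is approximated by zonotopes. -/
theorem exists_zonotope_approx (hn : 1 ≤ n) {η : ℝ} (hη : 1 < η) :
    ∃ (ι : Type) (_ : Fintype ι) (θ : ι → Euc n) (c : ι → ℝ), (∀ k, θ k ≠ 0) ∧
      Submodule.span ℝ (range θ) = ⊤ ∧ (∀ k, 0 < c k) ∧ zono θ c ⊆ closedBall 0 1 ∧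
      closedBall 0 1 ⊆ η • zono θ c := by
  obtain ⟨w, hw, hwu⟩ := exists_integral_abs_inner hn
  set ε := w * (η - 1) / (η + 1) with hε
  have hε0 : 0 < ε := by
    rw [hε]
    have : 0 < η - 1 := by linarith
    have : 0 < η + 1 := by linarith
    positivity
  obtain ⟨T, m, hT, hTm⟩ := exists_discrete_approx hε0 hwu
  set s := 1 / (w + ε) with hs
  have hs0 : 0 < s := by positivity
  set θ : T × Bool → Euc n := fun k => if k.2 then (k.1 : Euc n) else -(k.1 : Euc n) with hθ
  set c : T × Bool → ℝ := fun k => s * m k.1 with hc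
  have hc0 : ∀ k, 0 < c k := fun k => mul_pos hs0 (hT k.1 k.1.2).2
  have hθ0 : ∀ k, θ k ≠ 0 := by
    rintro ⟨k, _ | _⟩
    · simpa [hθ] using (hT k k.2).1
    · simpa [hθ] using (hT k k.2).1
  have hsup : ∀ u, ∑ k, c k * max 0 ⟪θ k, u⟫ = s * ∑ y ∈ T, m y * |⟪y, u⟫| := by
    intro u
    rw [Fintype.sum_prod_type, ← Finset.sum_coe_sort T, Finset.mul_sum]
    refine Finset.sum_congr rfl fun y _ => ?_
    simp only [Fintype.sum_bool, hc, hθ, if_true, Bool.false_eq_true, if_false, inner_neg_left]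
    rcases le_total 0 ⟪(y : Euc n), u⟫ with h | h
    · rw [max_eq_right h, max_eq_left (by linarith), abs_of_nonneg h]; ring
    · rw [max_eq_left h, max_eq_right (by linarith), abs_of_nonpos h]; ring
  have hη0 : 0 < η := by linarith
  have hball : closedBall 0 1 ⊆ η • zono θ c := by
    rw [smul_zono θ hη0.le fun k => (hc0 k).le]
    refine closedBall_subset_zono (fun k => mul_nonneg hη0.le (hc0 k).le) fun u => ?_
    change 1 * ‖u‖ ≤ ∑ k, η * c k * _
    simp only [mul_assoc]
    rw [← Finset.mul_sum, hsup]
    have h1 := (abs_le.1 (hTm u)).1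
    have h2 : w + ε = η * (w - ε) := by
      rw [hε]
      field_simp
      ring
    have h3 : η * s * (w - ε) = 1 := by
      rw [hs, mul_one_div, div_mul_eq_mul_div, ← h2, div_self (by positivity)]
    calc 1 * ‖u‖ = η * s * ((w - ε) * ‖u‖) := by rw [← mul_assoc, h3]
      _ ≤ η * s * ∑ y ∈ T, m y * |⟪y, u⟫| := by
        refine mul_le_mul_of_nonneg_left ?_ (by positivity)
        linarith
      _ = _ := by ring
  refine ⟨T × Bool, inferInstance, θ, c, hθ0, ?_, hc0, ?_, hball⟩
  · rw [eq_top_iff]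
    intro x _
    have hz : ∀ z ∈ zono θ c, z ∈ Submodule.span ℝ (range θ) := by
      intro z hz
      obtain ⟨t, -, rfl⟩ := (mem_zono θ).1 hz
      exact Submodule.sum_mem _ fun k _ => Submodule.smul_mem _ _
        (Submodule.subset_span (mem_range_self k))
    rcases eq_or_ne x 0 with rfl | hx
    · exact Submodule.zero_mem _
    · have hx' := norm_pos_iff.2 hx
      obtain ⟨z, hz', hzx⟩ := hball (show ‖x‖⁻¹ • x ∈ closedBall (0 : Euc n) 1 by
        rw [mem_closedBall_zero_iff, norm_smul, norm_inv, norm_norm,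
          inv_mul_cancel₀ hx'.ne'])
      have : x = (‖x‖ * η) • z := by
        rw [mul_smul, show η • z = ‖x‖⁻¹ • x from hzx, smul_smul, mul_inv_cancel₀ hx'.ne', one_smul]
      rw [this]
      exact Submodule.smul_mem _ _ (hz z hz')
  · refine zono_subset_closedBall zero_le_one fun u => ?_
    rw [hsup]
    have h1 := (abs_le.1 (hTm u)).2
    calc s * ∑ y ∈ T, m y * |⟪y, u⟫| ≤ s * ((w + ε) * ‖u‖) := by
          refine mul_le_mul_of_nonneg_left ?_ hs0.le
          linarith
      _ = 1 * ‖u‖ := by rw [← mul_assoc, hs, one_div_mul_cancel (by positivity)]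

end Approx

/-! ### Erosion of convex bodies and inner parallel sets -/

section Erosion

variable {n : ℕ} {ι : Type*} [Fintype ι] {θ : ι → Euc n} {c : ι → ℝ} {L M : Set (Euc n)}

lemma OpenBody.surf_mono (hL : OpenBody L) (hM : OpenBody M) (hc : ∀ k, 0 < c k) (h : L ⊆ M) :
    surf θ c L ≤ surf θ c M :=
  Finset.sum_le_sum fun k _ => mul_le_mul_of_nonneg_left (hL.psi_mono (θ k) hM h) (hc k).le

lemma OpenBody.surf_nonneg (hL : OpenBody L) (hc : ∀ k, 0 < c k) : 0 ≤ surf θ c L :=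
  Finset.sum_nonneg fun k _ => mul_nonneg (hc k).le (hL.psi_nonneg (θ k))

lemma surf_vadd (x : Euc n) : surf θ c (x +ᵥ L) = surf θ c L := by
  simp only [surf, psi_vadd]

lemma OpenBody.surf_smul (hL : OpenBody L) {a : ℝ} (ha : 0 < a) (hn : 1 ≤ n) :
    surf θ c (a • L) = a ^ (n - 1) * surf θ c L := by
  simp only [surf, hL.psi_smul _ ha hn, Finset.mul_sum]
  exact Finset.sum_congr rfl fun k _ => by ring

lemma OpenBody.le_real_inter_vadd (hL : OpenBody L) (θ : Euc n) {r : ℝ} (hr : 0 ≤ r) :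
    volume.real L ≤ volume.real (L ∩ ((-(r • θ)) +ᵥ L)) + r * psi θ L := by
  set x : Euc n := -(r • θ) with hx
  have hb := (hL.vadd x)
  have h1 : volume.real (L ∪ (x +ᵥ L)) + volume.real (L ∩ (x +ᵥ L)) =
      volume.real L + volume.real (x +ᵥ L) :=
    measureReal_union_add_inter hb.isOpen.measurableSet hL.volume_lt_top.ne hb.volume_lt_top.ne
  have h2 : volume.real (x +ᵥ L) = volume.real L := by
    simp [measureReal_def, measure_vadd]
  have h3 : volume.real (L ∪ (x +ᵥ L)) ≤ volume.real (x +ᵥ (L + seg θ r)) := by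
    refine ((hL.add_seg θ hr).vadd x).real_mono (union_subset ?_ ?_)
    · intro y hy
      refine ⟨y + r • θ, ⟨y, hy, r • θ, ⟨r, ⟨hr, le_rfl⟩, rfl⟩, rfl⟩, ?_⟩
      simp [hx]
    · exact vadd_set_mono fun y hy => ⟨y, hy, 0, zero_mem_seg θ hr, add_zero y⟩
  have h4 : volume.real (x +ᵥ (L + seg θ r)) = volume.real (L + seg θ r) := by
    simp [measureReal_def, measure_vadd]
  rw [h4, hL.real_add_seg θ hr] at h3
  linarith

lemma OpenBody.exists_erosion (hL : OpenBody L) (θ : ι → Euc n) (hc : ∀ k, 0 ≤ c k)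
    (S : Finset ι) :
    ∃ K : Set (Euc n), IsOpen K ∧ Convex ℝ K ∧
      (∀ x ∈ K, ∀ z ∈ ∑ k ∈ S, seg (θ k) (c k), x + z ∈ L) ∧
      volume.real L ≤ volume.real K + ∑ k ∈ S, c k * psi (θ k) L := by
  classical
  induction S using Finset.induction_on with
  | empty =>
    refine ⟨L, hL.isOpen, hL.convex, fun x hx z hz => ?_, by simp⟩
    rw [Finset.sum_empty, Set.mem_zero] at hz
    rwa [hz, add_zero]
  | insert a S ha ih =>
    obtain ⟨K, hKo, hKc, hK, hvol⟩ := ih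
    have hnn : 0 ≤ c a * psi (θ a) L := mul_nonneg (hc a) (hL.psi_nonneg _)
    have hKL : K ⊆ L := fun x hx => by
      have := hK x hx 0 (by
        rw [Set.mem_finsetSum]
        exact ⟨0, fun {k} _ => zero_mem_seg _ (hc k), by simp⟩)
      rwa [add_zero] at this
    rcases K.eq_empty_or_nonempty with rfl | hne
    · exact ⟨∅, isOpen_empty, convex_empty, by simp, by
        rw [Finset.sum_insert ha]; linarith⟩
    have hKb : OpenBody K := ⟨hKo, hL.isBounded.subset hKL, hKc, hne⟩
    refine ⟨K ∩ ((-(c a • θ a)) +ᵥ K), hKo.inter (hKo.vadd _), hKc.inter (hKc.vadd _), ?_, ?_⟩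
    · rintro x ⟨hx, y, hy, hyx⟩ z hz
      rw [Finset.sum_insert ha] at hz
      obtain ⟨_, ⟨t, ht, rfl⟩, z', hz', rfl⟩ := hz
      rw [← add_assoc]
      refine hK _ ?_ z' hz'
      have hyx' : y = x + c a • θ a := by
        rw [← hyx]; simp
      rcases ht.1.eq_or_lt with h0 | h0
      · simpa [← h0] using hx
      have hca : 0 < c a := h0.trans_le ht.2
      have := hKc.add_smul_mem hx (by rwa [← hyx'])
        (show t / c a ∈ Icc (0 : ℝ) 1 from ⟨by positivity, (div_le_one hca).2 ht.2⟩)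
      rwa [smul_smul, div_mul_cancel₀ _ hca.ne'] at this
    · have h1 := hKb.le_real_inter_vadd (θ a) (hc a)
      have h2 := mul_le_mul_of_nonneg_left (hKb.psi_mono (θ a) hL hKL) (hc a)
      rw [Finset.sum_insert ha]
      linarith

lemma OpenBody.real_le_real_erosion (hL : OpenBody L) (hc : ∀ k, 0 < c k) {η : ℝ} (hη : 0 < η)
    (hball : closedBall 0 1 ⊆ η • zono θ c) {ε : ℝ} (hε : 0 ≤ ε) :
    volume.real L ≤ volume.real {x | closedBall x ε ⊆ L} + ε * η * surf θ c L := by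
  have hc' : ∀ k, 0 ≤ ((ε * η) • c) k := fun k => mul_nonneg (by positivity) (hc k).le
  obtain ⟨K, -, -, hK, hvol⟩ := hL.exists_erosion θ hc' Finset.univ
  have hsub : closedBall 0 ε ⊆ zono θ ((ε * η) • c) := by
    rw [← smul_zono θ (by positivity) fun k => (hc k).le, mul_smul]
    refine subset_trans ?_ (smul_set_mono hball)
    rw [_root_.smul_closedBall _ _ zero_le_one, smul_zero, mul_one, Real.norm_of_nonneg hε]
  have h1 : volume.real K ≤ volume.real {x | closedBall x ε ⊆ L} := by
    refine measureReal_mono (fun x hx y hy => ?_) ?_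
    · have := hK x hx (y - x) (hsub (by
        rwa [mem_closedBall_zero_iff, ← mem_closedBall_iff_norm]))
      rwa [add_sub_cancel] at this
    · exact (hL.isBounded.subset fun x (hx : closedBall x ε ⊆ L) => hx (mem_closedBall_self hε)).measure_lt_top.ne
  have h2 : ∑ k, ((ε * η) • c) k * psi (θ k) L = ε * η * surf θ c L := by
    simp only [surf, Finset.mul_sum, Pi.smul_apply, smul_eq_mul]
    exact Finset.sum_congr rfl fun k _ => by ring
  linarith

lemma pow_add_mul_pow_le {x ε : ℝ} (hx : 0 ≤ x) (hε : 0 ≤ ε) (n : ℕ) :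
    x ^ n + n * ε * x ^ (n - 1) ≤ (x + ε) ^ n := by
  induction n with
  | zero => simp
  | succ n ih =>
    rw [Nat.add_sub_cancel, pow_succ (x + ε)]
    have h1 : x ^ n ≤ (x + ε) ^ n := pow_le_pow_left₀ hx (by linarith) n
    have h2 : (n : ℝ) * ε * x ^ (n - 1) * x = n * ε * x ^ n := by
      rcases n with _ | n
      · simp
      · rw [Nat.add_sub_cancel, pow_succ]; ring
    have h3 := mul_le_mul_of_nonneg_right ih hx
    have h4 := mul_le_mul_of_nonneg_right h1 hε
    push_cast
    rw [pow_succ]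
    nlinarith

lemma real_ball (x : Euc n) {r : ℝ} (hr : 0 < r) :
    volume.real (ball x r) = r ^ n * volume.real (ball (0 : Euc n) 1) := by
  simp only [measureReal_def]
  rw [Measure.addHaar_ball_of_pos _ _ hr]
  simp [ENNReal.toReal_ofReal, hr.le]

lemma le_surf_ball (hc : ∀ k, 0 < c k) {η : ℝ} (hη : 0 < η)
    (hball : closedBall 0 1 ⊆ η • zono θ c) :
    n * volume.real (ball (0 : Euc n) 1) ≤ η * surf θ c (ball (0 : Euc n) 1) := by
  set ω := volume.real (ball (0 : Euc n) 1)
  have h : ∀ ε ∈ Ioo (0 : ℝ) 1, n * (1 - ε) ^ (n - 1) * ω ≤ η * surf θ c (ball (0 : Euc n) 1) := by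
    intro ε hε
    have hsub : {x : Euc n | closedBall x ε ⊆ ball 0 1} ⊆ ball 0 (1 - ε) := by
      intro x hx
      rw [mem_ball_zero_iff]
      have hx' : closedBall x ε ⊆ ball 0 1 := hx
      rcases eq_or_ne x 0 with rfl | h0
      · rw [norm_zero]; linarith [hε.2]
      have hxn := norm_pos_iff.2 h0
      have : x + (ε / ‖x‖) • x ∈ closedBall x ε := by
        rw [mem_closedBall_iff_norm, add_sub_cancel_left, norm_smul, norm_div, norm_norm,
          div_mul_cancel₀ _ hxn.ne', Real.norm_of_nonneg hε.1.le]
      have := hx' this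
      rw [mem_ball_zero_iff, show x + (ε / ‖x‖) • x = (1 + ε / ‖x‖) • x by module, norm_smul, Real.norm_of_nonneg (by
        have := hε.1; positivity), add_mul, one_mul, div_mul_cancel₀ _ hxn.ne'] at this
      linarith
    have h1 := (OpenBody.ball (0 : Euc n) one_pos).real_le_real_erosion hc hη hball hε.1.le
    have h2 : volume.real {x : Euc n | closedBall x ε ⊆ ball 0 1} ≤ (1 - ε) ^ n * ω := by
      rw [← real_ball 0 (by linarith [hε.2])]
      exact (OpenBody.ball (0 : Euc n) (by linarith [hε.2])).real_mono hsub
    have h3 := pow_add_mul_pow_le (x := 1 - ε) (by linarith [hε.2]) hε.1.le n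
    rw [sub_add_cancel, one_pow] at h3
    have h4 := mul_le_mul_of_nonneg_right h3 (measureReal_nonneg : 0 ≤ ω)
    refine le_of_mul_le_mul_left ?_ hε.1
    nlinarith
  have hlim : Filter.Tendsto (fun ε : ℝ => n * (1 - ε) ^ (n - 1) * ω) (nhdsWithin 0 (Ioi 0))
      (nhds (n * (1 - 0) ^ (n - 1) * ω)) :=
    ((by fun_prop : Continuous fun ε : ℝ => n * (1 - ε) ^ (n - 1) * ω).tendsto 0).mono_left
      nhdsWithin_le_nhds
  simp only [sub_zero, one_pow, mul_one] at hlim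
  exact le_of_tendsto hlim (Filter.eventually_of_mem (Ioo_mem_nhdsGT one_pos) h)

end Erosion

/-! ### Comparison of inner parallel sets -/

section InnerParallel

variable {n : ℕ} {K : Set (Euc n)}

/-- The set of points at distance more than `t` from the complement of `K`. -/
def innerParallel (K : Set (Euc n)) (t : ℝ) : Set (Euc n) := {x | t < infDist x Kᶜ}

lemma OpenBody.compl_nonempty (hK : OpenBody K) (hn : 2 ≤ n) : (Kᶜ).Nonempty := by
  have : Nontrivial (Euc n) := by
    have : Nontrivial (Fin n) := Fin.nontrivial_iff_two_le.2 hn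
    infer_instance
  rw [nonempty_compl]
  rintro rfl
  exact NormedSpace.unbounded_univ ℝ (Euc n) hK.isBounded

lemma mem_inner_parallel_iff (hc : (Kᶜ).Nonempty) {t : ℝ} {x : Euc n} :
    x ∈ innerParallel K t ↔ ∃ s, t < s ∧ Metric.ball x s ⊆ K := by
  constructor
  · exact fun h => ⟨_, h, ball_infDist_compl_subset⟩
  · rintro ⟨s, hs, h⟩
    refine hs.trans_le ((le_infDist hc).2 fun y hy => ?_)
    by_contra! hlt
    exact hy (h (by rwa [mem_ball']))

lemma inner_parallel_subset {t : ℝ} (ht : 0 ≤ t) : innerParallel K t ⊆ K := by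
  intro x hx
  by_contra h
  have : infDist x Kᶜ = 0 := infDist_zero_of_mem h
  exact (ht.trans_lt (hx : t < infDist x Kᶜ)).ne' this

lemma OpenBody.inner_parallel_zero (hK : OpenBody K) (hn : 2 ≤ n) : innerParallel K 0 = K := by
  refine (inner_parallel_subset le_rfl).antisymm fun x hx => ?_
  rw [mem_inner_parallel_iff (hK.compl_nonempty hn)]
  exact Metric.isOpen_iff.1 hK.isOpen x hx

lemma OpenBody.inner_parallel (hK : OpenBody K) (hn : 2 ≤ n) {t : ℝ} (ht : 0 ≤ t)
    (hne : (innerParallel K t).Nonempty) : OpenBody (innerParallel K t) := by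
  have hc := hK.compl_nonempty hn
  refine ⟨isOpen_lt continuous_const (continuous_infDist_pt _),
    hK.isBounded.subset (inner_parallel_subset ht), ?_, hne⟩
  intro x hx y hy a b ha hb hab
  rw [mem_inner_parallel_iff hc] at hx hy ⊢
  obtain ⟨s, hs, hxs⟩ := hx
  obtain ⟨s', hs', hys⟩ := hy
  refine ⟨min s s', lt_min hs hs', fun z hz => ?_⟩
  have hw : ‖z - (a • x + b • y)‖ < min s s' := by rwa [mem_ball_iff_norm] at hz
  set w := z - (a • x + b • y) with hwd
  have h1 : x + w ∈ K := hxs (by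
    rw [mem_ball_iff_norm, add_sub_cancel_left]; exact hw.trans_le (min_le_left _ _))
  have h2 : y + w ∈ K := hys (by
    rw [mem_ball_iff_norm, add_sub_cancel_left]; exact hw.trans_le (min_le_right _ _))
  have h3 := hK.convex h1 h2 ha hb hab
  have : a • (x + w) + b • (y + w) = z := by
    have : a • (x + w) + b • (y + w) = a • x + b • y + (a + b) • w := by module
    rw [this, hab, one_smul, hwd]; abel
  rwa [this] at h3

lemma inner_parallel_add_closedBall_subset (hc : (Kᶜ).Nonempty) (t : ℝ) :
    innerParallel K t + closedBall 0 t ⊆ K := by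
  rintro _ ⟨x, hx, y, hy, rfl⟩
  obtain ⟨s, hs, h⟩ := (mem_inner_parallel_iff hc).1 hx
  refine h ?_
  rw [mem_ball_iff_norm, add_sub_cancel_left]
  exact (mem_closedBall_zero_iff.1 hy).trans_lt hs

lemma OpenBody.erosion_inner_parallel_subset (hK : OpenBody K) (hn : 2 ≤ n) {t ε : ℝ}
    (hε : 0 ≤ ε) (ht : 0 ≤ t) :
    {x | closedBall x ε ⊆ innerParallel K t} ⊆ innerParallel K (t + ε) := by
  intro x hx
  by_contra h
  have hx : closedBall x ε ⊆ innerParallel K t := hx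
  have h' : infDist x Kᶜ ≤ t + ε := not_lt.1 h
  obtain ⟨w, hw, hxw⟩ := hK.isOpen.isClosed_compl.exists_infDist_eq_dist (hK.compl_nonempty hn) x
  rw [hxw] at h'
  obtain ⟨y, hy1, hy2⟩ : ∃ y, dist x y ≤ ε ∧ dist y w ≤ t :=
    exists_dist_le_le hε ht h'
  have := hx (mem_closedBall'.2 hy1)
  exact absurd ((this : t < infDist y Kᶜ).trans_le (infDist_le_dist_of_mem hw)) (not_lt.2 hy2)

lemma concaveOn_le_sub_mul {g : ℝ → ℝ} (hg : ConcaveOn ℝ (Ici 0) g) {m G t : ℝ} (ht : 0 ≤ t)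
    (hm : ∀ τ, 0 ≤ τ → τ * m ≤ g τ) (hG : g t ≤ G) : g 0 ≤ G - t * m := by
  have h : ∀ τ ∈ Ioi t, (1 - t / τ) * g 0 ≤ G - t * m := by
    intro τ hτ
    have hτ0 : 0 < τ := ht.trans_lt hτ
    have h1 := hg.2 (mem_Ici.2 le_rfl) (mem_Ici.2 hτ0.le)
      (sub_nonneg.2 ((div_le_one hτ0).2 (le_of_lt hτ))) (by positivity : 0 ≤ t / τ) (by ring)
    have h2 := mul_le_mul_of_nonneg_left (hm τ hτ0.le) (by positivity : 0 ≤ t / τ)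
    simp only [smul_eq_mul, mul_zero, zero_add] at h1
    have h3 : t / τ * (τ * m) = t * m := by field_simp
    rw [div_mul_cancel₀ _ hτ0.ne'] at h1
    linarith
  have hlim : Filter.Tendsto (fun τ : ℝ => (1 - t / τ) * g 0) Filter.atTop (nhds ((1 - 0) * g 0)) :=
    ((tendsto_const_nhds.sub (tendsto_const_nhds.div_atTop Filter.tendsto_id))).mul_const _
  have := le_of_tendsto hlim ((Filter.eventually_gt_atTop t).mono h)
  linarith

/-- All zonotopal quermassintegrals of `K` are bounded by those of a ball of radius `R`. -/
def SurfLE (K : Set (Euc n)) (R : ℝ) : Prop :=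
  ∀ (ι : Type) (_ : Fintype ι) (θ : ι → Euc n) (c : ι → ℝ), (∀ k, θ k ≠ 0) → (∀ k, 0 < c k) →
    zono θ c ⊆ closedBall 0 1 →
    surf θ c K ≤ n * volume.real (Metric.ball (0 : Euc n) 1) * R ^ (n - 1)

lemma OpenBody.surf_inner_parallel_le {ι : Type} [Fintype ι] {θ : ι → Euc n} {c : ι → ℝ}
    (hK : OpenBody K) (hn : 2 ≤ n) {R : ℝ} (hR : 0 ≤ R) (hper : SurfLE K R)
    (hθ : ∀ k, θ k ≠ 0) (hspan : Submodule.span ℝ (range θ) = ⊤) (hc : ∀ k, 0 < c k)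
    (hsub : zono θ c ⊆ closedBall 0 1) {η : ℝ} (hη : 1 < η)
    (hball : closedBall 0 1 ⊆ η • zono θ c) {t : ℝ} (ht : 0 ≤ t)
    (hne : (innerParallel K t).Nonempty) :
    t / η ^ 2 ≤ R ∧ surf θ c (innerParallel K t) ≤
      n * volume.real (Metric.ball (0 : Euc n) 1) * (R - t / η ^ 2) ^ (n - 1) := by
  have hL := hK.inner_parallel hn ht hne
  have hη0 : 0 < η := by linarith
  set L := innerParallel K t
  set ω := volume.real (Metric.ball (0 : Euc n) 1)
  have hω : 0 < ω := (OpenBody.ball (0 : Euc n) one_pos).real_pos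
  have hn0 : (0 : ℝ) < n := by exact_mod_cast (by omega : 0 < n)
  have hd : (0 : ℝ) < (n : ℝ) - 1 := by
    have : (2 : ℝ) ≤ n := by exact_mod_cast hn
    linarith
  have hdn : ((n - 1 : ℕ) : ℝ) = (n : ℝ) - 1 := by
    rw [Nat.cast_sub (by omega), Nat.cast_one]
  have hroot : ∀ {a b : ℝ}, 0 ≤ a → 0 ≤ b →
      (a * b ^ (n - 1)) ^ (1 / ((n : ℝ) - 1)) = a ^ (1 / ((n : ℝ) - 1)) * b := by
    intro a b ha hb
    rw [Real.mul_rpow ha (by positivity), ← Real.rpow_natCast, hdn, ← Real.rpow_mul hb,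
      mul_one_div_cancel hd.ne', Real.rpow_one]
  set A := (n * ω) ^ (1 / ((n : ℝ) - 1))
  have hA : 0 < A := Real.rpow_pos_of_pos (by positivity) _
  have hc' : ∀ τ : ℝ, 0 ≤ τ → 0 ≤ τ • c := fun τ hτ k => mul_nonneg hτ (hc k).le
  have hconc := hL.concaveOn_surf hn hθ hspan hc
  have key := concaveOn_le_sub_mul hconc (m := A / η ^ 2) (G := A * R) ht ?_ ?_
  · have h0 : L + zono θ ((0 : ℝ) • c) = L := by
      rw [← smul_zono θ le_rfl (fun k => (hc k).le), zero_smul_set ⟨0, zero_mem_zono θ fun k => (hc k).le⟩,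
        add_zero]
    simp only [h0] at key
    have hs := hL.surf_nonneg (θ := θ) hc
    have hs' : 0 ≤ surf θ c L ^ (1 / ((n : ℝ) - 1)) := Real.rpow_nonneg hs _
    have h1 : surf θ c L ^ (1 / ((n : ℝ) - 1)) ≤ A * (R - t / η ^ 2) := by
      calc _ ≤ _ := key
        _ = _ := by ring
    have h2 : 0 ≤ R - t / η ^ 2 := nonneg_of_mul_nonneg_right (hs'.trans h1) hA
    refine ⟨by linarith, ?_⟩
    have h3 := pow_le_pow_left₀ hs' h1 (n - 1)
    have hpow : ∀ {a : ℝ}, 0 ≤ a → (a ^ (1 / ((n : ℝ) - 1))) ^ (n - 1) = a := by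
      intro a ha
      rw [← Real.rpow_natCast, hdn, ← Real.rpow_mul ha, one_div_mul_cancel hd.ne', Real.rpow_one]
    rwa [mul_pow, hpow hs, hpow (by positivity)] at h3
  · intro τ hτ
    rcases hτ.eq_or_lt with rfl | hτ0
    · rw [zero_mul]
      exact Real.rpow_nonneg ((hL.add_zono θ (hc' 0 le_rfl)).surf_nonneg hc) _
    obtain ⟨x, hx⟩ := hne
    have hsub' : x +ᵥ (τ / η) • Metric.ball (0 : Euc n) 1 ⊆ L + zono θ (τ • c) := by
      rw [← smul_zono θ hτ fun k => (hc k).le]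
      rintro _ ⟨_, ⟨y, hy, rfl⟩, rfl⟩
      obtain ⟨z, hz, rfl⟩ := hball (ball_subset_closedBall hy)
      refine ⟨x, hx, τ • z, ⟨z, hz, rfl⟩, ?_⟩
      simp only [vadd_eq_add, smul_smul, div_mul_cancel₀ _ hη0.ne']
    have hb := OpenBody.ball (0 : Euc n) one_pos
    have h1 := ((hb.smul (div_pos hτ0 hη0)).vadd x).surf_mono (hL.add_zono θ (hc' τ hτ)) hc hsub'
      (θ := θ)
    rw [surf_vadd, hb.surf_smul (div_pos hτ0 hη0) (by omega)] at h1
    have h2 := le_surf_ball hc hη0 hball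
    have h3 : n * ω * (τ / η ^ 2) ^ (n - 1) ≤ surf θ c (L + zono θ (τ • c)) := by
      refine le_trans ?_ h1
      have h4 : (τ / η ^ 2) ^ (n - 1) * η ≤ (τ / η) ^ (n - 1) := by
        have : τ / η = τ / η ^ 2 * η := by field_simp
        rw [this, mul_pow]
        gcongr
        exact le_self_pow₀ hη.le (by omega)
      calc n * ω * (τ / η ^ 2) ^ (n - 1) ≤ η * surf θ c (Metric.ball 0 1) * (τ / η ^ 2) ^ (n - 1) := by
            gcongr
        _ = (τ / η ^ 2) ^ (n - 1) * η * surf θ c (Metric.ball 0 1) := by ring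
        _ ≤ _ := mul_le_mul_of_nonneg_right h4 (hb.surf_nonneg hc)
    calc τ * (A / η ^ 2) = (n * ω * (τ / η ^ 2) ^ (n - 1)) ^ (1 / ((n : ℝ) - 1)) := by
          rw [hroot (by positivity) (by positivity)]; ring
      _ ≤ _ := Real.rpow_le_rpow (by positivity) h3 (by positivity)
  · have hM := hL.add_zono θ (hc' t ht)
    have h1 : L + zono θ (t • c) ⊆ K := by
      refine subset_trans (add_subset_add_left ?_)
        (inner_parallel_add_closedBall_subset (hK.compl_nonempty hn) t)
      rw [← smul_zono θ ht fun k => (hc k).le]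
      refine (smul_set_mono hsub).trans ?_
      rw [_root_.smul_closedBall _ _ zero_le_one, smul_zero, mul_one, Real.norm_of_nonneg ht]
    rw [← hroot (by positivity) hR]
    exact Real.rpow_le_rpow (hM.surf_nonneg hc)
      ((hM.surf_mono hK hc h1).trans (hper ι _ θ c hθ hc hsub)) (by positivity)

lemma OpenBody.real_inner_parallel_step (hK : OpenBody K) (hn : 2 ≤ n) {R : ℝ} (hR : 0 ≤ R)
    (hper : SurfLE K R) {t ε : ℝ} (ht : 0 ≤ t) (hε : 0 ≤ ε) :
    volume.real (innerParallel K t) - volume.real (innerParallel K (t + ε)) ≤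
      max (R - (t - ε)) 0 ^ n * volume.real (Metric.ball (0 : Euc n) 1) -
        max (R - t) 0 ^ n * volume.real (Metric.ball (0 : Euc n) 1) := by
  set ω := volume.real (Metric.ball (0 : Euc n) 1)
  have hω : 0 < ω := (OpenBody.ball (0 : Euc n) one_pos).real_pos
  rcases (innerParallel K t).eq_empty_or_nonempty with hemp | hne
  · rw [hemp, measureReal_empty, zero_sub]
    have h1 : max (R - t) 0 ^ n ≤ max (R - (t - ε)) 0 ^ n :=
      pow_le_pow_left₀ (le_max_right _ _) (max_le_max (by linarith) le_rfl) n
    have := mul_le_mul_of_nonneg_right h1 hω.le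
    linarith [measureReal_nonneg (μ := volume) (s := innerParallel K (t + ε))]
  have hL := hK.inner_parallel hn ht hne
  have hfin : volume (innerParallel K (t + ε)) ≠ ∞ :=
    (hK.isBounded.subset (inner_parallel_subset (by positivity))).measure_lt_top.ne
  have h1 : ∀ η ∈ Ioi (1 : ℝ), t / η ^ 2 ≤ R ∧
      volume.real (innerParallel K t) - volume.real (innerParallel K (t + ε)) ≤
        ε * η * (n * ω * (R - t / η ^ 2) ^ (n - 1)) := by
    intro η hη
    obtain ⟨ι, _, θ, c, hθ, hspan, hc, hsub, hball⟩ := exists_zonotope_approx (n := n) (by omega) hη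
    obtain ⟨h1, h2⟩ := hK.surf_inner_parallel_le hn hR hper hθ hspan hc hsub hη hball ht hne
    have hη0 : (0 : ℝ) < η := zero_lt_one.trans hη
    have h3 := hL.real_le_real_erosion hc hη0 hball hε
    have h4 := measureReal_mono (hK.erosion_inner_parallel_subset hn hε ht) hfin
    have h5 := mul_le_mul_of_nonneg_left h2 (by positivity : 0 ≤ ε * η)
    exact ⟨h1, by linarith⟩
  have hl1 : Filter.Tendsto (fun η : ℝ => t / η ^ 2) (nhdsWithin 1 (Ioi 1)) (nhds (t / 1 ^ 2)) := by
    have : ContinuousAt (fun η : ℝ => t / η ^ 2) 1 :=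
      continuousAt_const.div (by fun_prop) (by norm_num)
    exact this.tendsto.mono_left nhdsWithin_le_nhds
  have hl2 : Filter.Tendsto (fun η : ℝ => ε * η * (n * ω * (R - t / η ^ 2) ^ (n - 1)))
      (nhdsWithin 1 (Ioi 1)) (nhds (ε * 1 * (n * ω * (R - t / 1 ^ 2) ^ (n - 1)))) := by
    refine (Filter.Tendsto.const_mul _ (Filter.tendsto_id'.2 nhdsWithin_le_nhds)).mul
      (((tendsto_const_nhds.sub hl1).pow _).const_mul _)
  have hRt : t / 1 ^ 2 ≤ R :=
    le_of_tendsto hl1 (Filter.eventually_of_mem self_mem_nhdsWithin fun η hη => (h1 η hη).1)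
  have hV := ge_of_tendsto hl2 (Filter.eventually_of_mem self_mem_nhdsWithin fun η hη => (h1 η hη).2)
  simp only [one_pow, div_one, mul_one] at hRt hV
  rw [max_eq_left (by linarith), max_eq_left (by linarith), ← sub_mul]
  have h6 := pow_add_mul_pow_le (sub_nonneg.2 hRt) hε n
  have h7 : R - (t - ε) = R - t + ε := by ring
  rw [h7]
  have h8 := mul_le_mul_of_nonneg_right h6 hω.le
  nlinarith

lemma OpenBody.real_inner_parallel_sub_le (hK : OpenBody K) (hn : 2 ≤ n) {R : ℝ} (hR : 0 ≤ R)
    (hper : SurfLE K R) {a b : ℝ} (ha : 0 ≤ a) (hab : a ≤ b) :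
    volume.real (innerParallel K a) - volume.real (innerParallel K b) ≤
      max (R - a) 0 ^ n * volume.real (Metric.ball (0 : Euc n) 1) -
        max (R - b) 0 ^ n * volume.real (Metric.ball (0 : Euc n) 1) := by
  set ω := volume.real (Metric.ball (0 : Euc n) 1)
  set W : ℝ → ℝ := fun t => max (R - t) 0 ^ n * ω with hW
  set V : ℝ → ℝ := fun t => volume.real (innerParallel K t) with hV
  have hWc : Continuous W := by fun_prop
  have hstep : ∀ N : ℕ, V a - V b ≤ W (a - (b - a) / (N + 1 : ℝ)) - W (b - (b - a) / (N + 1 : ℝ)) := by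
    intro N
    set ε := (b - a) / (N + 1 : ℝ) with hε
    have hε0 : 0 ≤ ε := div_nonneg (by linarith) (by positivity)
    have h : ∀ i : ℕ, V a - V (a + i * ε) ≤ W (a - ε) - W (a + i * ε - ε) := by
      intro i
      induction i with
      | zero => simp
      | succ i ih =>
        have := hK.real_inner_parallel_step hn hR hper (t := a + i * ε) (by positivity) hε0
        have h1 : a + ((i + 1 : ℕ) : ℝ) * ε = a + i * ε + ε := by push_cast; ring
        have h2 : a + i * ε + ε - ε = a + i * ε := by ring
        simp only [h1, h2] at *
        simp only [hV, hW] at *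
        linarith
    have h3 := h (N + 1)
    have h4 : a + ((N + 1 : ℕ) : ℝ) * ε = b := by
      rw [hε]; push_cast; field_simp; ring
    rwa [h4] at h3
  have hlim : Filter.Tendsto (fun N : ℕ => (b - a) / (N + 1 : ℝ)) Filter.atTop (nhds 0) :=
    tendsto_const_nhds.div_atTop
      (Filter.tendsto_atTop_add_const_right _ _ tendsto_natCast_atTop_atTop)
  have hl : Filter.Tendsto (fun N : ℕ => W (a - (b - a) / (N + 1 : ℝ)) - W (b - (b - a) / (N + 1 : ℝ)))
      Filter.atTop (nhds (W (a - 0) - W (b - 0))) :=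
    ((hWc.tendsto _).comp (tendsto_const_nhds.sub hlim)).sub
      ((hWc.tendsto _).comp (tendsto_const_nhds.sub hlim))
  have := ge_of_tendsto' hl hstep
  simpa only [sub_zero] using this

end InnerParallel

/-! ### Comparison of the distributions of the distance to the boundary -/

section Distribution

lemma continuousWithinAt_measureReal_Iic (μ : Measure ℝ) [IsFiniteMeasure μ] (x : ℝ) :
    ContinuousWithinAt (fun t => μ.real (Iic t)) (Ici x) x := by
  rw [← continuousWithinAt_Ioi_iff_Ici]
  have h := tendsto_measure_biInter_gt (μ := μ) (s := fun t : ℝ => Iic t) (a := x)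
    (fun _ _ => measurableSet_Iic.nullMeasurableSet) (fun _ _ _ h => Iic_subset_Iic.2 h)
    ⟨x + 1, by simp, measure_ne_top _ _⟩
  have h2 : ⋂ r > x, Iic r = Iic x := by
    ext y
    simp only [gt_iff_lt, mem_iInter, mem_Iic]
    exact ⟨fun h => le_of_forall_gt_imp_ge_of_dense h, fun h r hr => h.trans hr.le⟩
  rw [h2] at h
  exact (ENNReal.tendsto_toReal (measure_ne_top _ _)).comp h

lemma measure_le_of_Ioc (μ ν : Measure ℝ) [IsFiniteMeasure μ] [IsFiniteMeasure ν]
    (h : ∀ a b, a ≤ b → μ.real (Ioc a b) ≤ ν.real (Ioc a b)) : μ ≤ ν := by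
  have hIoc : ∀ (ρ : Measure ℝ) [IsFiniteMeasure ρ] (a b : ℝ), a ≤ b →
      ρ.real (Ioc a b) = ρ.real (Iic b) - ρ.real (Iic a) := by
    intro ρ _ a b hab
    rw [← Iic_sdiff_Iic, measureReal_sdiff (Iic_subset_Iic.2 hab) measurableSet_Iic]
  let F : StieltjesFunction ℝ :=
    { toFun := fun t => ν.real (Iic t) - μ.real (Iic t)
      mono' := fun a b hab => by
        have := h a b hab
        rw [hIoc _ _ _ hab, hIoc _ _ _ hab] at this
        linarith
      right_continuous' := fun x => (continuousWithinAt_measureReal_Iic ν x).sub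
        (continuousWithinAt_measureReal_Iic μ x) }
  have hF : μ + F.measure = ν := by
    refine (Measure.ext_of_Ioc _ _ fun a b hab => ?_).symm
    have hF' : F b - F a = ν.real (Ioc a b) - μ.real (Ioc a b) := by
      rw [hIoc _ _ _ hab.le, hIoc _ _ _ hab.le]
      change ν.real (Iic b) - μ.real (Iic b) - (ν.real (Iic a) - μ.real (Iic a)) = _
      ring
    rw [Measure.add_apply, F.measure_Ioc, hF', ENNReal.ofReal_sub _ measureReal_nonneg,
      ofReal_measureReal, ofReal_measureReal, add_tsub_cancel_of_le]
    rw [← ofReal_measureReal, ← ofReal_measureReal (μ := ν)]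
    exact ENNReal.ofReal_le_ofReal (h a b hab.le)
  rw [← hF]
  exact Measure.le_add_right le_rfl

variable {n : ℕ} {K : Set (Euc n)}

lemma OpenBody.map_infDist_le (hK : OpenBody K) (hn : 2 ≤ n) {R : ℝ} (hR : 0 ≤ R)
    (hper : SurfLE K R) :
    (volume.restrict K).map (fun x => infDist x Kᶜ) ≤
      (volume.restrict (Metric.ball (0 : Euc n) R)).map fun x => R - ‖x‖ := by
  have hfK : IsFiniteMeasure (volume.restrict K) :=
    ⟨by rw [Measure.restrict_apply_univ]; exact hK.volume_lt_top⟩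
  have hfB : IsFiniteMeasure (volume.restrict (Metric.ball (0 : Euc n) R)) :=
    ⟨by rw [Measure.restrict_apply_univ]; exact measure_ball_lt_top⟩
  have hm1 : Measurable fun x : Euc n => infDist x Kᶜ := (continuous_infDist_pt _).measurable
  have hm2 : Measurable fun x : Euc n => R - ‖x‖ := by fun_prop
  have hball : ∀ r : ℝ, volume.real (Metric.ball (0 : Euc n) r) =
      max r 0 ^ n * volume.real (Metric.ball (0 : Euc n) 1) := by
    intro r
    rcases le_or_gt r 0 with hr | hr
    · rw [ball_eq_empty.2 hr, max_eq_right hr, zero_pow (by omega), zero_mul, measureReal_empty]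
    · rw [real_ball 0 hr, max_eq_left hr.le]
  have hpos : ∀ a b, 0 ≤ a → a ≤ b →
      ((volume.restrict K).map (fun x => infDist x Kᶜ)).real (Ioc a b) ≤
      ((volume.restrict (Metric.ball (0 : Euc n) R)).map fun x => R - ‖x‖).real (Ioc a b) := by
    intro a b ha hab
    rw [map_measureReal_apply hm1 measurableSet_Ioc, map_measureReal_apply hm2 measurableSet_Ioc,
      measureReal_restrict_apply (hm1 measurableSet_Ioc),
      measureReal_restrict_apply (hm2 measurableSet_Ioc)]
    have h1 : (fun x => infDist x Kᶜ) ⁻¹' Ioc a b ∩ K = innerParallel K a \ innerParallel K b := by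
      ext x
      constructor
      · rintro ⟨h, -⟩
        exact ⟨h.1, not_lt.2 h.2⟩
      · rintro ⟨h, h'⟩
        exact ⟨⟨h, not_lt.1 h'⟩, inner_parallel_subset ha h⟩
    have h2 : (fun x : Euc n => R - ‖x‖) ⁻¹' Ioc a b ∩ Metric.ball 0 R =
        Metric.ball 0 (R - a) \ Metric.ball 0 (R - b) := by
      ext x
      simp only [mem_inter_iff, mem_preimage, mem_Ioc, mem_ball_zero_iff, mem_sdiff, not_lt]
      constructor
      · rintro ⟨⟨h, h'⟩, -⟩
        exact ⟨by linarith, by linarith⟩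
      · rintro ⟨h, h'⟩
        exact ⟨⟨by linarith, by linarith⟩, by linarith⟩
    have hfa : volume (innerParallel K a) ≠ ∞ :=
      (hK.isBounded.subset (inner_parallel_subset ha)).measure_lt_top.ne
    have hsub : innerParallel K b ⊆ innerParallel K a := fun x hx => hab.trans_lt hx
    have hmb : MeasurableSet (innerParallel K b) := measurableSet_lt measurable_const hm1
    rw [h1, h2, measureReal_sdiff hsub hmb hfa, measureReal_sdiff (ball_subset_ball (by linarith))
      measurableSet_ball measure_ball_lt_top.ne, hball (R - a), hball (R - b)]
    exact hK.real_inner_parallel_sub_le hn hR hper ha hab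
  refine measure_le_of_Ioc _ _ fun a b hab => ?_
  rcases le_or_gt 0 a with ha | ha
  · exact hpos a b ha hab
  have hzero : ((volume.restrict K).map (fun x => infDist x Kᶜ)).real (Iic 0) = 0 := by
    rw [map_measureReal_apply hm1 measurableSet_Iic,
      measureReal_restrict_apply (hm1 measurableSet_Iic)]
    have : (fun x => infDist x Kᶜ) ⁻¹' Iic 0 ∩ K = ∅ := by
      refine eq_empty_of_forall_notMem fun x hx => ?_
      have h : x ∈ innerParallel K 0 := by rw [hK.inner_parallel_zero hn]; exact hx.2
      exact not_lt.2 hx.1 (show 0 < infDist x Kᶜ from h)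
    rw [this, measureReal_empty]
  rcases le_or_gt b 0 with hb | hb
  · rw [measureReal_mono_null (fun x hx => hx.2.trans hb) hzero]
    exact measureReal_nonneg
  · calc _ ≤ ((volume.restrict K).map (fun x => infDist x Kᶜ)).real (Iic 0 ∪ Ioc 0 b) := by
          refine measureReal_mono (fun x hx => ?_)
          rcases le_or_gt x 0 with h | h
          · exact Or.inl h
          · exact Or.inr ⟨h, hx.2⟩
      _ ≤ _ := measureReal_union_le _ _
      _ ≤ _ := by
          rw [hzero, zero_add]
          exact (hpos 0 b le_rfl hb.le).trans (measureReal_mono (Ioc_subset_Ioc_left ha.le))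

end Distribution

/-! ### Surface measure of convex bodies -/

section Prism

open Measure

variable {n : ℕ}

lemma volume_eq_lintegral_section {ν : Euc n} (hν : ‖ν‖ = 1) {t : Set (Euc n)}
    (ht : MeasurableSet t) :
    volume t = ∫⁻ x : ℝ, μHE[n - 1] (t ∩ {y | inner ℝ ν y = x}) := by
  have hν0 : ν ≠ 0 := by rintro rfl; simp at hν
  have h := EuclideanGeometry.euclideanHausdorffMeasure_eq_lintegral (0 : Euc n) hν0 ht
  rw [finrank_euclideanSpace_fin, EuclideanSpace.euclideanHausdorffMeasure_eq_volume] at h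
  have h1 : ‖ν‖ₑ = 1 := by
    rw [← ofReal_norm, hν, ENNReal.ofReal_one]
  rw [h, h1, one_mul]
  congr with x
  congr 2
  ext y
  simp only [AffineSubspace.mem_coe, AffineSubspace.mem_mk', Submodule.mem_orthogonal_singleton_iff_inner_right]
  simp [inner_sub_right, inner_smul_right, hν, sub_eq_zero]

/-- The oblique prism with base `F`, contained in the hyperplane `⟪ν, ·⟫ = b`, whose generators
are the translates of `t • θ` for `t ∈ I`. -/
def prism (ν θ : Euc n) (b : ℝ) (F : Set (Euc n)) (I : Set ℝ) : Set (Euc n) :=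
  {y | (inner ℝ ν y - b) / inner ℝ ν θ ∈ I ∧ y - ((inner ℝ ν y - b) / inner ℝ ν θ) • θ ∈ F}

lemma add_smul_mem_prism {ν θ : Euc n} {b : ℝ} {F : Set (Euc n)} {I : Set ℝ}
    (hF : F ⊆ {y | inner ℝ ν y = b}) (hθ : inner ℝ ν θ ≠ 0) {x : Euc n} (hx : x ∈ F) {t : ℝ}
    (ht : t ∈ I) : x + t • θ ∈ prism ν θ b F I := by
  have h : (inner ℝ ν (x + t • θ) - b) / inner ℝ ν θ = t := by
    rw [inner_add_right, inner_smul_right, hF hx]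
    field_simp
    ring
  constructor
  · rwa [h]
  · rwa [h, add_sub_cancel_right]

lemma volume_prism {ν θ : Euc n} {b : ℝ} {F : Set (Euc n)} {I : Set ℝ} (hν : ‖ν‖ = 1)
    (hθ : 0 < inner ℝ ν θ) (hFm : MeasurableSet F) (hI : MeasurableSet I)
    (hF : F ⊆ {y | inner ℝ ν y = b}) :
    volume (prism ν θ b F I) = ENNReal.ofReal (inner ℝ ν θ) * volume I * μHE[n - 1] F := by
  set s : ℝ := inner ℝ ν θ with hs
  have hmeas : MeasurableSet (prism ν θ b F I) := by
    have h1 : Measurable fun y : Euc n => (inner ℝ ν y - b) / s := by fun_prop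
    have h2 : Measurable fun y : Euc n => y - ((inner ℝ ν y - b) / s) • θ := by fun_prop
    exact (h1 hI).inter (h2 hFm)
  rw [volume_eq_lintegral_section hν hmeas]
  have hsec : ∀ x : ℝ, μHE[n - 1] (prism ν θ b F I ∩ {y | inner ℝ ν y = x}) =
      ((fun x => (x - b) / s) ⁻¹' I).indicator (fun _ => μHE[n - 1] F) x := by
    intro x
    by_cases hx : (x - b) / s ∈ I
    · rw [indicator_of_mem (by exact hx)]
      have : prism ν θ b F I ∩ {y | inner ℝ ν y = x} = (((x - b) / s) • θ) +ᵥ F := by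
        ext y
        rw [mem_vadd_set_iff_neg_vadd_mem, vadd_eq_add, neg_add_eq_sub]
        constructor
        · rintro ⟨⟨-, h⟩, rfl⟩
          exact h
        · intro h
          have h1 : inner ℝ ν y = x := by
            have := hF h
            rw [mem_ofPred_eq, inner_sub_right, inner_smul_right, ← hs, div_mul_cancel₀ _ hθ.ne'] at this
            linarith
          refine ⟨⟨?_, ?_⟩, h1⟩ <;> rw [h1]
          · exact hx
          · exact h
      rw [this, measure_vadd]
    · rw [indicator_of_notMem (by exact hx)]
      have : prism ν θ b F I ∩ {y | inner ℝ ν y = x} = ∅ := by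
        refine eq_empty_of_forall_notMem ?_
        rintro y ⟨⟨h, -⟩, rfl⟩
        exact hx h
      rw [this, measure_empty]
  simp only [hsec]
  have hm : Measurable fun x : ℝ => (x - b) / s := by fun_prop
  rw [lintegral_indicator (hm hI), setLIntegral_const]
  have hv : volume ((fun x : ℝ => (x - b) / s) ⁻¹' I) = ENNReal.ofReal s * volume I := by
    have h1 : (fun x : ℝ => (x - b) / s) ⁻¹' I = (fun x : ℝ => x + -b) ⁻¹' ((fun x : ℝ => x * s⁻¹) ⁻¹' I) := by
      ext x
      simp only [mem_preimage, sub_eq_add_neg, div_eq_mul_inv]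
    rw [h1, measure_preimage_add_right, Real.volume_preimage_mul_right (inv_ne_zero hθ.ne'), inv_inv,
      abs_of_pos hθ]
  rw [hv, mul_comm]

lemma inter_frontier_nonempty {X : Type*} [TopologicalSpace X] {s t : Set X}
    (ht : IsPreconnected t) (h1 : (t ∩ s).Nonempty) (h2 : (t ∩ sᶜ).Nonempty) :
    (t ∩ frontier s).Nonempty := by
  by_contra! h
  have hmem : ∀ x ∈ t, x ∈ interior s ∨ x ∈ interior sᶜ := by
    intro x hx
    by_contra! hn
    rw [interior_compl] at hn
    exact h.subset ⟨hx, not_not.1 hn.2, hn.1⟩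
  obtain ⟨x, hx, hxs⟩ := h1
  obtain ⟨y, hy, hys⟩ := h2
  obtain ⟨z, -, hz⟩ := ht _ _ isOpen_interior isOpen_interior hmem
    ⟨x, hx, (hmem x hx).resolve_right fun h' => interior_subset h' hxs⟩
    ⟨y, hy, (hmem y hy).resolve_left fun h' => hys (interior_subset h')⟩
  exact (interior_subset hz.2) (interior_subset hz.1)

lemma exists_mem_frontier_add_smul {B : Set (Euc n)} (hB : IsBounded B) {x ν : Euc n}
    (hν : ‖ν‖ = 1) (hx : x ∈ closure B) : ∃ t : ℝ, 0 ≤ t ∧ x + t • ν ∈ frontier B := by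
  obtain ⟨C, hC⟩ := hB.closure.exists_norm_le
  have hpre : IsPreconnected ((fun t : ℝ => x + t • ν) '' Ici 0) :=
    isPreconnected_Ici.image _ (by fun_prop)
  have h0 := (norm_nonneg x).trans (hC x hx)
  have hout : x + (C + ‖x‖ + 1) • ν ∉ closure B := fun h => by
    have h1 := hC _ h
    have h2 := norm_sub_le (x + (C + ‖x‖ + 1) • ν) x
    rw [add_sub_cancel_left, norm_smul, hν, mul_one, Real.norm_of_nonneg (by positivity)] at h2
    linarith
  obtain ⟨y, ⟨t, ht, rfl⟩, hy⟩ := inter_frontier_nonempty (s := closure B) hpre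
    ⟨x, ⟨0, by simp, by simp⟩, hx⟩
    ⟨_, ⟨C + ‖x‖ + 1, mem_Ici.2 (by positivity), rfl⟩, hout⟩
  exact ⟨t, ht, frontier_closure_subset hy⟩

/-- A supporting unit normal at a boundary point of a convex set. -/
lemma exists_unit_normal {A : Set (Euc n)} (hA : Convex ℝ A) (hAi : (interior A).Nonempty)
    {x : Euc n} (hx : x ∉ interior A) :
    ∃ ν : Euc n, ‖ν‖ = 1 ∧ ∀ y ∈ closure A, inner ℝ ν y ≤ inner ℝ ν x := by
  obtain ⟨f, hf⟩ := geometric_hahn_banach_open_point hA.interior isOpen_interior hx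
  obtain ⟨z, hz⟩ := hAi
  set w := (InnerProductSpace.toDual ℝ (Euc n)).symm f with hw
  have hfw : ∀ y, f y = inner ℝ w y := fun y => by
    rw [hw, InnerProductSpace.toDual_symm_apply]
  have hw0 : 0 < ‖w‖ := by
    rw [norm_pos_iff]
    intro h0
    have := hf z hz
    simp [hfw, h0] at this
  have hle : ∀ y ∈ closure A, inner ℝ w y ≤ inner ℝ w x := by
    intro y hy
    rw [← hA.closure_interior_eq_closure_of_nonempty_interior ⟨z, hz⟩] at hy
    have hcl : IsClosed {y | inner ℝ w y ≤ inner ℝ w x} :=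
      isClosed_le (by fun_prop) continuous_const
    refine closure_minimal (fun y hy => ?_) hcl hy
    have := hf y hy
    rw [hfw, hfw] at this
    exact this.le
  refine ⟨‖w‖⁻¹ • w, by rw [norm_smul, norm_inv, norm_norm, inv_mul_cancel₀ hw0.ne'], fun y hy => ?_⟩
  rw [real_inner_smul_left, real_inner_smul_left]
  exact mul_le_mul_of_nonneg_left (hle y hy) (by positivity)

/-- The nearest point projection onto a closed convex set. -/
lemma exists_lipschitz_projection {A : Set (Euc n)} (hA : Convex ℝ A) (hne : A.Nonempty)
    (hcl : IsClosed A) :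
    ∃ π : Euc n → Euc n, LipschitzWith 1 π ∧
      ∀ x ν : Euc n, x ∈ A → (∀ y ∈ A, inner ℝ ν y ≤ inner ℝ ν x) → ∀ t : ℝ, 0 ≤ t →
        π (x + t • ν) = x := by
  have h : ∀ u : Euc n, ∃ v ∈ A, ∀ w ∈ A, inner ℝ (u - v) (w - v) ≤ 0 := by
    intro u
    obtain ⟨v, hv, huv⟩ := exists_norm_eq_iInf_of_complete_convex hne hcl.isComplete hA u
    exact ⟨v, hv, (norm_eq_iInf_iff_real_inner_le_zero hA hv).1 huv⟩
  choose π hπA hπ using h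
  have key : ∀ u v x : Euc n, x ∈ A → (∀ w ∈ A, inner ℝ (v - x) (w - x) ≤ 0) →
      ‖π u - x‖ * ‖π u - x‖ ≤ ‖u - v‖ * ‖π u - x‖ := by
    intro u v x hx hv
    have h1 := hπ u x hx
    have h2 := hv (π u) (hπA u)
    have h3 : inner ℝ (π u - x) (π u - x) = inner ℝ (u - v) (π u - x) +
        inner ℝ (u - π u) (x - π u) + inner ℝ (v - x) (π u - x) := by
      rw [← neg_sub (π u) x, inner_neg_right, ← sub_eq_add_neg, ← inner_sub_left, ← inner_add_left]
      congr 1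
      abel
    rw [← real_inner_self_eq_norm_mul_norm, h3]
    linarith [real_inner_le_norm (u - v) (π u - x)]
  have key' : ∀ u v x : Euc n, x ∈ A → (∀ w ∈ A, inner ℝ (v - x) (w - x) ≤ 0) →
      ‖π u - x‖ ≤ ‖u - v‖ := by
    intro u v x hx hv
    rcases (norm_nonneg (π u - x)).eq_or_lt with h0 | h0
    · rw [← h0]; exact norm_nonneg _
    · exact le_of_mul_le_mul_right (key u v x hx hv) h0
  refine ⟨π, LipschitzWith.of_dist_le_mul fun u v => ?_, fun x ν hx hν t ht => ?_⟩
  · rw [NNReal.coe_one, one_mul, dist_eq_norm, dist_eq_norm]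
    exact key' u v (π v) (hπA v) (hπ v)
  · have := key' (x + t • ν) (x + t • ν) x hx fun w hw => by
      rw [add_sub_cancel_left, real_inner_smul_left, inner_sub_right]
      exact mul_nonpos_of_nonneg_of_nonpos ht (sub_nonpos.2 (hν w hw))
    rw [sub_self, norm_zero] at this
    exact sub_eq_zero.1 (norm_le_zero_iff.1 this)

lemma euclideanHausdorffMeasure_image_le {f : Euc n → Euc n} (hf : LipschitzWith 1 f) (d : ℕ)
    (s : Set (Euc n)) : μHE[d] (f '' s) ≤ μHE[d] s := by
  simp_rw [euclideanHausdorffMeasure_def, Measure.smul_apply]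
  simp only [ENNReal.smul_def, smul_eq_mul]
  refine mul_le_mul_right ?_ _
  simpa using (hf.lipschitzOnWith (s := s)).hausdorffMeasure_image_le (d := d) (by positivity)

/-- The surface measure is monotone on convex bodies. -/
lemma surface_mono {A B : Set (Euc n)} (hA : Convex ℝ A) (hAi : (interior A).Nonempty)
    (hB : IsBounded B) (hAB : A ⊆ B) (d : ℕ) : μHE[d] (frontier A) ≤ μHE[d] (frontier B) := by
  obtain ⟨π, hπ, hfix⟩ := exists_lipschitz_projection hA.closure
    (hAi.mono (interior_subset.trans subset_closure)) isClosed_closure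
  refine le_trans (measure_mono fun x hx => ?_) (euclideanHausdorffMeasure_image_le hπ d _)
  obtain ⟨ν, hν, hsupp⟩ := exists_unit_normal hA hAi hx.2
  obtain ⟨t, ht, htB⟩ := exists_mem_frontier_add_smul hB hν (closure_mono hAB hx.1)
  exact ⟨_, htB, hfix x ν hx.1 hsupp t ht⟩

end Prism

/-! ### Outer polytopes -/

section Polytope

open Measure

variable {n : ℕ}

/-- The intersection of the half-spaces `⟪ν, ·⟫ ≤ h ν` for `ν ∈ T`. -/
def polytope (T : Finset (Euc n)) (h : Euc n → ℝ) : Set (Euc n) := {x | ∀ ν ∈ T, inner ℝ ν x ≤ h ν}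

/-- The facet of a polytope with outer normal `ν`. -/
def facet (T : Finset (Euc n)) (h : Euc n → ℝ) (ν : Euc n) : Set (Euc n) :=
  polytope T h ∩ {x | inner ℝ ν x = h ν}

/-- `T` is a set of unit vectors, and the half-spaces `⟪ν, ·⟫ ≤ h ν` for `ν ∈ T` contain `L` and
have the origin in their interiors. -/
structure IsOuter (L : Set (Euc n)) (T : Finset (Euc n)) (h : Euc n → ℝ) : Prop where
  unit : ∀ ν ∈ T, ‖ν‖ = 1
  pos : ∀ ν ∈ T, 0 < h ν
  le : ∀ ν ∈ T, ∀ x ∈ L, inner ℝ ν x ≤ h ν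

variable {L : Set (Euc n)} {T : Finset (Euc n)} {h : Euc n → ℝ}

lemma isClosed_polytope : IsClosed (polytope T h) := by
  have : polytope T h = ⋂ ν ∈ T, {x | inner ℝ ν x ≤ h ν} := by
    ext x; simp [polytope]
  rw [this]
  exact isClosed_biInter fun ν _ => isClosed_le (by fun_prop) continuous_const

lemma convex_polytope : Convex ℝ (polytope T h) := by
  intro x hx y hy a b ha hb hab ν hν
  rw [inner_add_right, inner_smul_right, inner_smul_right]
  calc _ ≤ a * h ν + b * h ν := by
        gcongr
        · exact hx ν hν
        · exact hy ν hν
    _ = h ν := by rw [← add_mul, hab, one_mul]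

lemma IsOuter.subset (hT : IsOuter L T h) : L ⊆ polytope T h := fun x hx ν hν => hT.le ν hν x hx

lemma isClosed_facet (ν : Euc n) : IsClosed (facet T h ν) :=
  isClosed_polytope.inter (isClosed_eq (by fun_prop) continuous_const)

lemma frontier_polytope_subset : frontier (polytope T h) ⊆ ⋃ ν ∈ T, facet T h ν := by
  intro x hx
  have hxP : x ∈ polytope T h := isClosed_polytope.frontier_subset hx
  by_contra hn
  simp only [mem_iUnion, not_exists] at hn
  have hopen : IsOpen {y : Euc n | ∀ ν ∈ T, inner ℝ ν y < h ν} := by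
    have : {y : Euc n | ∀ ν ∈ T, inner ℝ ν y < h ν} = ⋂ ν ∈ T, {y | inner ℝ ν y < h ν} := by
      ext x; simp
    rw [this]
    exact isOpen_biInter_finset fun ν _ => isOpen_lt (by fun_prop) continuous_const
  exact hx.2 (interior_maximal (fun y (hy : ∀ ν ∈ T, inner ℝ ν y < h ν) ν hν => (hy ν hν).le) hopen
    fun ν hν => (hxP ν hν).lt_of_ne fun he => hn ν hν ⟨hxP, he⟩)

lemma IsOuter.facet_subset_frontier (hT : IsOuter L T h) {ν : Euc n} (hν : ν ∈ T) :
    facet T h ν ⊆ frontier (polytope T h) := by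
  rintro x ⟨hx, hxν⟩
  refine ⟨subset_closure hx, fun hi => ?_⟩
  have hc : Filter.Tendsto (fun t : ℝ => x + t • ν) (nhdsWithin 0 (Ioi 0)) (nhds x) := by
    have : ContinuousAt (fun t : ℝ => x + t • ν) 0 := by fun_prop
    simpa using this.tendsto.mono_left (nhdsWithin_le_nhds (s := Ioi 0))
  obtain ⟨t, ht, ht0⟩ := ((hc.eventually (mem_interior_iff_mem_nhds.1 hi)).and
    self_mem_nhdsWithin).exists
  have := ht ν hν
  have hxν : inner ℝ ν x = h ν := hxν
  rw [inner_add_right, inner_smul_right, real_inner_self_eq_norm_sq, hT.unit ν hν, hxν] at this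
  have ht0 : 0 < t := ht0
  linarith

lemma volume_eq_zero_of_inner_eq {w : Euc n} (hw : w ≠ 0) {a : ℝ} {S : Set (Euc n)}
    (hS : ∀ x ∈ S, inner ℝ w x = a) : volume S = 0 := by
  have hw' : 0 < ‖w‖ := norm_pos_iff.2 hw
  have hm : MeasurableSet {x : Euc n | inner ℝ w x = a} :=
    (isClosed_eq (by fun_prop) continuous_const).measurableSet
  refine measure_mono_null (t := {x : Euc n | inner ℝ w x = a}) (fun x hx => hS x hx) ?_
  rw [volume_eq_lintegral_section (ν := ‖w‖⁻¹ • w) (by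
    rw [norm_smul, norm_inv, norm_norm, inv_mul_cancel₀ hw'.ne']) hm]
  have : ∀ᵐ x : ℝ, x ≠ ‖w‖⁻¹ * a := by simp [ae_iff]
  refine (lintegral_congr_ae ?_).trans lintegral_zero
  filter_upwards [this] with x hx
  have : {x : Euc n | inner ℝ w x = a} ∩ {y | inner ℝ (‖w‖⁻¹ • w) y = x} = ∅ := by
    refine eq_empty_of_forall_notMem ?_
    rintro y ⟨h1, h2⟩
    rw [mem_ofPred_eq] at h1 h2
    rw [real_inner_smul_left, h1] at h2
    exact hx h2.symm
  rw [this, measure_empty]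

lemma IsOuter.facet_inter_facet (hT : IsOuter L T h) {ν ν' : Euc n} (hν : ν ∈ T) (hν' : ν' ∈ T)
    (hne : ν ≠ ν') : μHE[n - 1] (facet T h ν ∩ facet T h ν') = 0 := by
  set G := facet T h ν ∩ facet T h ν' with hG
  have hGc : IsClosed G := (isClosed_facet ν).inter (isClosed_facet ν')
  have hinner : (inner ℝ ν ν : ℝ) = 1 := by
    rw [real_inner_self_eq_norm_sq, hT.unit ν hν, one_pow]
  have hGν : G ⊆ {y | inner ℝ ν y = h ν} := fun x hx => hx.1.2
  have hvol := volume_prism (θ := ν) (I := Icc 0 1) (hT.unit ν hν) (by rw [hinner]; exact one_pos)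
    hGc.measurableSet measurableSet_Icc hGν
  simp only [hinner, ENNReal.ofReal_one, Real.volume_Icc, sub_zero, one_mul] at hvol
  rw [← hvol]
  set w := ν' - (inner ℝ ν ν' : ℝ) • ν with hw
  by_cases hw0 : w = 0
  · have hν'ν : ν' = (inner ℝ ν ν' : ℝ) • ν := sub_eq_zero.1 hw0
    have habs : |(inner ℝ ν ν' : ℝ)| = 1 := by
      have := congrArg norm hν'ν
      rwa [norm_smul, hT.unit ν hν, hT.unit ν' hν', mul_one, Real.norm_eq_abs, eq_comm] at this
    rcases eq_or_eq_neg_of_abs_eq habs with h1 | h1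
    · rw [h1, one_smul] at hν'ν
      exact absurd hν'ν.symm hne
    · have hemp : G = ∅ := by
        refine eq_empty_of_forall_notMem fun x hx => ?_
        have e1 : inner ℝ ν x = h ν := hx.1.2
        have e2 : inner ℝ ν' x = h ν' := hx.2.2
        have e3 : inner ℝ ν' x = -(h ν) := by
          have := congrArg (fun z => (inner ℝ z x : ℝ)) hν'ν
          rw [h1] at this
          simpa only [neg_smul, one_smul, inner_neg_left, e1] using this
        linarith [hT.pos ν hν, hT.pos ν' hν']
      have : prism ν ν (h ν) G (Icc 0 1) = ∅ := by
        refine eq_empty_of_forall_notMem fun x hx => ?_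
        rw [hemp] at hx
        exact hx.2
      rw [this, measure_empty]
  · refine volume_eq_zero_of_inner_eq hw0 (a := h ν' - inner ℝ ν ν' * h ν) fun y hy => ?_
    obtain ⟨-, hy⟩ := hy
    have e1 : inner ℝ ν _ = h ν := hy.1.2
    have e2 : inner ℝ ν' _ = h ν' := hy.2.2
    set x := y - ((inner ℝ ν y - h ν) / inner ℝ ν ν) • ν with hx
    have hyx : y = x + ((inner ℝ ν y - h ν) / inner ℝ ν ν) • ν := by rw [hx]; abel
    rw [hyx, hw, inner_add_right, inner_smul_right, inner_sub_left, inner_sub_left, real_inner_smul_left,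
      real_inner_smul_left, e1, e2, hinner, real_inner_comm ν ν']
    ring

lemma IsOuter.sum_facet_le (hT : IsOuter L T h) :
    ∑ ν ∈ T, μHE[n - 1] (facet T h ν) ≤ μHE[n - 1] (frontier (polytope T h)) := by
  rw [← measure_biUnion_finset₀ (fun ν hν ν' hν' hne => hT.facet_inter_facet hν hν' hne)
    fun ν _ => (isClosed_facet ν).measurableSet.nullMeasurableSet]
  exact measure_mono (iUnion₂_subset fun ν hν => hT.facet_subset_frontier hν)

lemma surface_le_sum_facet :
    μHE[n - 1] (frontier (polytope T h)) ≤ ∑ ν ∈ T, μHE[n - 1] (facet T h ν) :=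
  (measure_mono frontier_polytope_subset).trans (measure_biUnion_finset_le _ _)

lemma OpenBody.exists_outer (hL : OpenBody L) (h0 : (0 : Euc n) ∈ L) {δ : ℝ} (hδ : 0 < δ) :
    ∃ (T : Finset (Euc n)) (h : Euc n → ℝ), IsOuter L T h ∧ polytope T h ⊆ (1 + δ) • L := by
  classical
  have hδ1 : 0 < 1 + δ := by linarith
  set M := (1 + δ) • L with hM
  have hMo : OpenBody M := hL.smul hδ1
  set h : Euc n → ℝ := fun ν => sSup ((fun x => inner ℝ ν x) '' L) with hh
  obtain ⟨C, hC⟩ := hL.isBounded.exists_norm_le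
  have hbdd : ∀ ν : Euc n, BddAbove ((fun x => (inner ℝ ν x : ℝ)) '' L) := by
    intro ν
    refine ⟨‖ν‖ * C, ?_⟩
    rintro _ ⟨x, hx, rfl⟩
    exact (real_inner_le_norm ν x).trans (by gcongr; exact hC x hx)
  have hle : ∀ ν : Euc n, ∀ x ∈ L, inner ℝ ν x ≤ h ν := fun ν x hx =>
    le_csSup (hbdd ν) ⟨x, hx, rfl⟩
  have hpos : ∀ ν : Euc n, ‖ν‖ = 1 → 0 < h ν := by
    intro ν hν
    obtain ⟨r, hr, hrL⟩ := Metric.isOpen_iff.1 hL.isOpen 0 h0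
    have hmem : (r / 2) • ν ∈ L := hrL (by
      rw [mem_ball_zero_iff, norm_smul, hν, mul_one, Real.norm_of_nonneg (by positivity)]; linarith)
    have := hle ν _ hmem
    rw [inner_smul_right, real_inner_self_eq_norm_sq, hν] at this
    linarith
  have hsep : ∀ y ∈ frontier M, ∃ ν : Euc n, ‖ν‖ = 1 ∧ h ν < inner ℝ ν y := by
    intro y hy
    obtain ⟨ν, hν, hsupp⟩ := exists_unit_normal hMo.convex
      (by rw [hMo.isOpen.interior_eq]; exact hMo.nonempty) hy.2
    refine ⟨ν, hν, ?_⟩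
    have h1 : (1 + δ) * h ν ≤ inner ℝ ν y := by
      rw [← le_div_iff₀' hδ1]
      refine csSup_le (hL.nonempty.image _) ?_
      rintro _ ⟨x, hx, rfl⟩
      have := hsupp ((1 + δ) • x) (subset_closure ⟨x, hx, rfl⟩)
      rwa [inner_smul_right, ← le_div_iff₀' hδ1] at this
    nlinarith [hpos ν hν]
  choose! f hf1 hf2 using hsep
  have hcomp : IsCompact (frontier M) :=
    Metric.isCompact_of_isClosed_isBounded isClosed_frontier
      (hMo.isBounded.closure.subset frontier_subset_closure)
  obtain ⟨t, ht, hcov⟩ := hcomp.elim_nhds_subcover (fun y => {z | h (f y) < inner ℝ (f y) z})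
    fun y hy => (isOpen_lt continuous_const (by fun_prop)).mem_nhds (hf2 y hy)
  refine ⟨t.image f, h, ⟨?_, ?_, fun ν _ => hle ν⟩, ?_⟩
  · intro ν hν
    obtain ⟨y, hy, rfl⟩ := Finset.mem_image.1 hν
    exact hf1 y (ht y hy)
  · intro ν hν
    obtain ⟨y, hy, rfl⟩ := Finset.mem_image.1 hν
    exact hpos _ (hf1 y (ht y hy))
  · intro x hx
    by_contra hxM
    have h0P : (0 : Euc n) ∈ polytope (t.image f) h := fun ν _ => by
      have := hle ν 0 h0
      exact this
    obtain ⟨y, hyP, hy⟩ := inter_frontier_nonempty (s := M) convex_polytope.isPreconnected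
      ⟨0, h0P, ⟨0, h0, smul_zero _⟩⟩ ⟨x, hx, hxM⟩
    obtain ⟨z, hz, hyz⟩ := mem_iUnion₂.1 (hcov hy)
    exact absurd (hyP (f z) (Finset.mem_image_of_mem f hz)) (not_le.2 hyz)

end Polytope

/-! ### Surface area of outer polytopes and of balls -/

section SurfaceArea

open Measure

variable {n : ℕ} {L : Set (Euc n)} {T : Finset (Euc n)} {h : Euc n → ℝ}

lemma surface_vadd (x : Euc n) (d : ℕ) (L : Set (Euc n)) :
    μHE[d] (frontier (x +ᵥ L)) = μHE[d] (frontier L) := by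
  have : frontier (x +ᵥ L) = x +ᵥ frontier L := ((Homeomorph.vadd x).image_frontier L).symm
  rw [this, measure_vadd]

lemma surface_smul {a : ℝ} (ha : 0 < a) (d : ℕ) (L : Set (Euc n)) :
    μHE[d] (frontier (a • L)) = ENNReal.ofReal (a ^ d) * μHE[d] (frontier L) := by
  have : frontier (a • L) = a • frontier L :=
    ((Homeomorph.smulOfNeZero a ha.ne').image_frontier L).symm
  rw [this, euclideanHausdorffMeasure_smul₀ _ ha.ne', ENNReal.smul_def, smul_eq_mul]
  congr 1
  rw [ENNReal.ofReal]
  congr 1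
  ext
  simp [Real.coe_toNNReal _ (pow_nonneg ha.le d), abs_of_pos ha]

lemma IsOuter.zero_mem_interior (hT : IsOuter L T h) : (0 : Euc n) ∈ interior (polytope T h) := by
  refine mem_interior.2 ⟨⋂ ν ∈ T, {y : Euc n | inner ℝ ν y < h ν}, fun y hy ν hν => ?_, ?_, ?_⟩
  · exact (mem_iInter₂.1 hy ν hν : inner ℝ ν y < h ν).le
  · exact isOpen_biInter_finset fun ν _ => isOpen_lt (by fun_prop) continuous_const
  · simpa using hT.pos

lemma IsOuter.openBody_interior (hT : IsOuter L T h) (hb : IsBounded (polytope T h)) :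
    OpenBody (interior (polytope T h)) :=
  ⟨isOpen_interior, hb.subset interior_subset, convex_polytope.interior, 0, hT.zero_mem_interior⟩

lemma add_smul_mem_polytope_or {x θ : Euc n} (hx : x ∈ polytope T h) {t : ℝ} (ht : t ∈ Icc 0 1) :
    x + t • θ ∈ polytope T h ∨ ∃ ν ∈ T, 0 < inner ℝ ν θ ∧
      x + t • θ ∈ prism ν θ (h ν) (facet T h ν) (Icc 0 1) := by
  classical
  rw [or_iff_not_imp_left]
  intro hy
  obtain ⟨ν₁, hν₁, hlt⟩ : ∃ ν ∈ T, h ν < inner ℝ ν (x + t • θ) := by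
    simpa [polytope] using hy
  rw [inner_add_right, inner_smul_right] at hlt
  have hpos₁ : 0 < inner ℝ ν₁ θ := by
    have := hx ν₁ hν₁
    by_contra! hneg
    nlinarith [ht.1]
  obtain ⟨ν, hν, hmin⟩ := (T.filter fun ν => 0 < inner ℝ ν θ).exists_min_image
    (fun ν => (h ν - inner ℝ ν x) / inner ℝ ν θ) ⟨ν₁, Finset.mem_filter.2 ⟨hν₁, hpos₁⟩⟩
  obtain ⟨hν, hpos⟩ := Finset.mem_filter.1 hν
  set s := (h ν - inner ℝ ν x) / inner ℝ ν θ with hs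
  have hs0 : 0 ≤ s := div_nonneg (sub_nonneg.2 (hx ν hν)) hpos.le
  have hst : s ≤ t := by
    refine (hmin ν₁ (Finset.mem_filter.2 ⟨hν₁, hpos₁⟩)).trans ?_
    rw [div_le_iff₀ hpos₁]
    linarith
  have hfac : x + s • θ ∈ facet T h ν := by
    constructor
    · intro ν' hν'
      rw [inner_add_right, inner_smul_right]
      by_cases hp : 0 < inner ℝ ν' θ
      · have := hmin ν' (Finset.mem_filter.2 ⟨hν', hp⟩)
        rw [le_div_iff₀ hp] at this
        linarith
      · nlinarith [hx ν' hν', not_lt.1 hp]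
    · rw [mem_ofPred_eq, inner_add_right, inner_smul_right, hs, div_mul_cancel₀ _ hpos.ne']
      ring
  refine ⟨ν, hν, hpos, ?_⟩
  have := add_smul_mem_prism (I := Icc 0 1) (fun y hy => hy.2) hpos.ne' hfac
    (t := t - s) ⟨by linarith, by linarith [ht.2]⟩
  rwa [add_assoc, ← add_smul, add_sub_cancel] at this

lemma IsOuter.psi_le (hT : IsOuter L T h) (hb : IsBounded (polytope T h)) (θ : Euc n) :
    ENNReal.ofReal (psi θ (interior (polytope T h))) ≤
      ∑ ν ∈ T, ENNReal.ofReal (inner ℝ ν θ) * μHE[n - 1] (facet T h ν) := by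
  classical
  have hO := hT.openBody_interior hb
  set P := polytope T h
  have hvol : volume P = volume (interior P) := by
    have hsub : P ⊆ frontier P ∪ interior P := by
      rw [isClosed_polytope.frontier_eq, sdiff_union_of_subset interior_subset]
    refine le_antisymm ((measure_mono hsub).trans ((measure_union_le _ _).trans ?_))
      (measure_mono interior_subset)
    rw [convex_polytope.addHaar_frontier volume, zero_add]
  have hsub : interior P + seg θ 1 ⊆ P ∪ ⋃ ν ∈ T, if 0 < inner ℝ ν θ then
      prism ν θ (h ν) (facet T h ν) (Icc 0 1) else ∅ := by
    rintro _ ⟨x, hx, _, ⟨t, ht, rfl⟩, rfl⟩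
    rcases add_smul_mem_polytope_or (interior_subset hx) ht with h1 | ⟨ν, hν, hpos, h1⟩
    · exact Or.inl h1
    · exact Or.inr (mem_iUnion₂.2 ⟨ν, hν, by rwa [if_pos hpos]⟩)
  have hle : volume (interior P + seg θ 1) ≤ volume (interior P) +
      ∑ ν ∈ T, ENNReal.ofReal (inner ℝ ν θ) * μHE[n - 1] (facet T h ν) := by
    refine (measure_mono hsub).trans ((measure_union_le _ _).trans ?_)
    rw [hvol]
    gcongr
    refine (measure_biUnion_finset_le _ _).trans (Finset.sum_le_sum fun ν hν => ?_)
    split_ifs with hpos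
    · rw [volume_prism (hT.unit ν hν) hpos (isClosed_facet ν).measurableSet measurableSet_Icc
        fun y hy => hy.2]
      simp
    · simp
  rw [psi, ENNReal.ofReal_sub _ measureReal_nonneg, measureReal_def, measureReal_def,
    ENNReal.ofReal_toReal hO.volume_lt_top.ne,
    ENNReal.ofReal_toReal (hO.add_seg θ zero_le_one).volume_lt_top.ne]
  exact tsub_le_iff_left.2 hle

variable {ι : Type} [Fintype ι] {θ : ι → Euc n} {c : ι → ℝ}

lemma sum_max_inner_le (hc : ∀ k, 0 < c k) (hsub : zono θ c ⊆ closedBall 0 1) {ν : Euc n}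
    (hν : ‖ν‖ = 1) : ∑ k, c k * max 0 (inner ℝ (θ k) ν) ≤ 1 := by
  obtain ⟨x, hx, he⟩ := exists_mem_zono_inner_eq (θ := θ) (fun k => (hc k).le) ν
  rw [← he]
  refine (real_inner_le_norm x ν).trans ?_
  rw [hν, mul_one]
  exact mem_closedBall_zero_iff.1 (hsub hx)

lemma IsOuter.surf_le (hT : IsOuter L T h) (hb : IsBounded (polytope T h)) (hc : ∀ k, 0 < c k)
    (hsub : zono θ c ⊆ closedBall 0 1) :
    ENNReal.ofReal (surf θ c (interior (polytope T h))) ≤ ∑ ν ∈ T, μHE[n - 1] (facet T h ν) := by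
  have hO := hT.openBody_interior hb
  rw [surf, ENNReal.ofReal_sum_of_nonneg fun k _ => mul_nonneg (hc k).le (hO.psi_nonneg _)]
  calc _ ≤ ∑ k, ENNReal.ofReal (c k) *
        ∑ ν ∈ T, ENNReal.ofReal (inner ℝ ν (θ k)) * μHE[n - 1] (facet T h ν) := by
        refine Finset.sum_le_sum fun k _ => ?_
        rw [ENNReal.ofReal_mul (hc k).le]
        gcongr
        exact hT.psi_le hb (θ k)
    _ = ∑ ν ∈ T, ENNReal.ofReal (∑ k, c k * max 0 (inner ℝ (θ k) ν)) *
        μHE[n - 1] (facet T h ν) := by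
        simp_rw [Finset.mul_sum]
        rw [Finset.sum_comm]
        refine Finset.sum_congr rfl fun ν _ => ?_
        rw [ENNReal.ofReal_sum_of_nonneg fun k _ =>
          mul_nonneg (hc k).le (le_max_left _ _), Finset.sum_mul]
        refine Finset.sum_congr rfl fun k _ => ?_
        rw [ENNReal.ofReal_mul (hc k).le, mul_assoc, real_inner_comm]
        congr 2
        rcases le_total 0 (inner ℝ (θ k) ν) with h0 | h0
        · rw [max_eq_right h0]
        · rw [max_eq_left h0, ENNReal.ofReal_of_nonpos h0, ENNReal.ofReal_zero]
    _ ≤ ∑ ν ∈ T, μHE[n - 1] (facet T h ν) := by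
        refine Finset.sum_le_sum fun ν hν => ?_
        refine mul_le_of_le_one_left' ?_
        exact ENNReal.ofReal_le_one.2 (sum_max_inner_le hc hsub (hT.unit ν hν))

lemma le_mul_of_forall_one_add_pow {a b : ℝ≥0∞} (d : ℕ)
    (H : ∀ δ : ℝ, 0 < δ → a ≤ ENNReal.ofReal ((1 + δ) ^ d) * b) : a ≤ b := by
  have hc : Filter.Tendsto (fun δ : ℝ => ENNReal.ofReal ((1 + δ) ^ d) * b)
      (nhdsWithin 0 (Ioi 0)) (nhds (1 * b)) := by
    refine ENNReal.Tendsto.mul_const ?_ (Or.inl one_ne_zero)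
    have : ContinuousAt (fun δ : ℝ => ENNReal.ofReal ((1 + δ) ^ d)) 0 :=
      (ENNReal.continuous_ofReal.comp (by fun_prop)).continuousAt
    simpa using this.tendsto.mono_left (nhdsWithin_le_nhds (s := Ioi 0))
  rw [← one_mul b]
  exact ge_of_tendsto hc (Filter.eventually_of_mem self_mem_nhdsWithin fun δ hδ => H δ hδ)

theorem OpenBody.ofReal_surf_le (hL : OpenBody L) (hc : ∀ k, 0 < c k)
    (hsub : zono θ c ⊆ closedBall 0 1) :
    ENNReal.ofReal (surf θ c L) ≤ μHE[n - 1] (frontier L) := by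
  wlog h0 : (0 : Euc n) ∈ L generalizing L
  · obtain ⟨x, hx⟩ := hL.nonempty
    have := this (hL.vadd (-x)) ⟨x, hx, by simp⟩
    rwa [surf_vadd, surface_vadd] at this
  refine le_mul_of_forall_one_add_pow (n - 1) fun δ hδ => ?_
  have hδ1 : 0 < 1 + δ := by linarith
  obtain ⟨T, h, hT, hTL⟩ := hL.exists_outer h0 hδ
  have hb : IsBounded (polytope T h) := (hL.smul hδ1).isBounded.subset hTL
  calc ENNReal.ofReal (surf θ c L) ≤ ENNReal.ofReal (surf θ c (interior (polytope T h))) :=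
        ENNReal.ofReal_le_ofReal (hL.surf_mono (hT.openBody_interior hb) hc
          (interior_maximal hT.subset hL.isOpen))
    _ ≤ _ := hT.surf_le hb hc hsub
    _ ≤ _ := hT.sum_facet_le
    _ ≤ μHE[n - 1] (frontier ((1 + δ) • L)) :=
        surface_mono convex_polytope ⟨0, hT.zero_mem_interior⟩ (hL.smul hδ1).isBounded hTL _
    _ = _ := surface_smul hδ1 _ _

end SurfaceArea

section BallSurface

open Measure

variable {n : ℕ} {T : Finset (Euc n)} {h : Euc n → ℝ}

lemma le_of_forall_mul_le_one_add_pow {a b : ℝ} (d : ℕ)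
    (H : ∀ ε : ℝ, 0 < ε → ε * a ≤ ((1 + ε) ^ d - 1) * b) : a ≤ d * b := by
  have hd : HasDerivAt (fun ε : ℝ => (1 + ε) ^ d * b) (d * b) 0 := by
    simpa using (((hasDerivAt_id (0 : ℝ)).const_add 1).pow d).mul_const b
  refine ge_of_tendsto hd.tendsto_slope_zero_right
    (Filter.eventually_of_mem self_mem_nhdsWithin fun ε hε => ?_)
  have hε : 0 < ε := hε
  rw [smul_eq_mul, inv_mul_eq_div, le_div_iff₀ hε]
  have := H ε hε
  simp only [zero_add, add_zero, one_pow]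
  linarith

lemma IsOuter.disjoint_prism (hT : IsOuter (ball 0 1) T h) {ν ν' : Euc n} (hν : ν ∈ T)
    (hν' : ν' ∈ T) (hne : ν ≠ ν') (ε : ℝ) :
    Disjoint (prism ν ν (h ν) (facet T h ν) (Ioc 0 ε))
      (prism ν' ν' (h ν') (facet T h ν') (Ioc 0 ε)) := by
  rw [Set.disjoint_left]
  rintro y ⟨ht, hy⟩ ⟨ht', hy'⟩
  have h1 : (inner ℝ ν ν : ℝ) = 1 := by rw [real_inner_self_eq_norm_sq, hT.unit ν hν, one_pow]
  have h1' : (inner ℝ ν' ν' : ℝ) = 1 := by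
    rw [real_inner_self_eq_norm_sq, hT.unit ν' hν', one_pow]
  rw [h1, div_one] at ht hy
  rw [h1', div_one] at ht' hy'
  have e1 := hy.1 ν' hν'
  have e2 := hy'.1 ν hν
  rw [inner_sub_right, inner_smul_right] at e1 e2
  have hlt : (inner ℝ ν ν' : ℝ) < 1 :=
    (inner_lt_one_iff_real_of_norm_eq_one (hT.unit ν hν) (hT.unit ν' hν')).2 hne
  rw [real_inner_comm ν ν'] at e1
  set c : ℝ := inner ℝ ν ν'
  obtain ⟨a0, -⟩ := ht
  obtain ⟨b0, -⟩ := ht'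
  nlinarith [mul_pos a0 (sub_pos.2 hlt), mul_pos b0 (sub_pos.2 hlt)]

lemma IsOuter.sum_facet_le_volume (hT : IsOuter (ball 0 1) T h)
    (hb : IsBounded (polytope T h)) :
    ∑ ν ∈ T, μHE[n - 1] (facet T h ν) ≤ ENNReal.ofReal (n * volume.real (polytope T h)) := by
  classical
  set P := polytope T h with hP
  set S := ∑ ν ∈ T, μHE[n - 1] (facet T h ν) with hS
  have hPtop : volume P ≠ ∞ := hb.measure_lt_top.ne
  have hh : ∀ ν ∈ T, 1 ≤ h ν := by
    intro ν hν
    refine le_of_forall_lt fun t ht => ?_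
    rcases lt_or_ge t 0 with h0 | h0
    · exact h0.trans (hT.pos ν hν)
    obtain ⟨t', ht', ht1⟩ := exists_between ht
    have := hT.le ν hν (t' • ν) (by
      rw [mem_ball_zero_iff, norm_smul, hT.unit ν hν, mul_one, Real.norm_of_nonneg (by linarith)]
      exact ht1)
    rw [inner_smul_right, real_inner_self_eq_norm_sq, hT.unit ν hν] at this
    linarith
  have key : ∀ ε : ℝ, 0 < ε →
      volume P + ENNReal.ofReal ε * S ≤ ENNReal.ofReal ((1 + ε) ^ n) * volume P := by
    intro ε hε
    have hinner : ∀ ν ∈ T, (inner ℝ ν ν : ℝ) = 1 := fun ν hν => by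
      rw [real_inner_self_eq_norm_sq, hT.unit ν hν, one_pow]
    have hprism : ∀ ν ∈ T, volume (prism ν ν (h ν) (facet T h ν) (Ioc 0 ε)) =
        ENNReal.ofReal ε * μHE[n - 1] (facet T h ν) := by
      intro ν hν
      rw [volume_prism (hT.unit ν hν) (by rw [hinner ν hν]; exact one_pos)
        (isClosed_facet ν).measurableSet measurableSet_Ioc fun y hy => hy.2, hinner ν hν]
      simp
    have hmeas : ∀ ν ∈ T, MeasurableSet (prism ν ν (h ν) (facet T h ν) (Ioc 0 ε)) := by
      intro ν _
      refine MeasurableSet.inter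
        ((by fun_prop : Measurable fun y : Euc n => (inner ℝ ν y - h ν) / inner ℝ ν ν)
          measurableSet_Ioc) ?_
      exact (by fun_prop : Measurable fun y : Euc n =>
        y - ((inner ℝ ν y - h ν) / inner ℝ ν ν) • ν) (isClosed_facet ν).measurableSet
    have hdisj : Disjoint P (⋃ ν ∈ T, prism ν ν (h ν) (facet T h ν) (Ioc 0 ε)) := by
      rw [Set.disjoint_left]
      intro y hy hy'
      obtain ⟨ν, hν, h1, h2⟩ := mem_iUnion₂.1 hy'
      rw [hinner ν hν, div_one] at h1
      have := hy ν hν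
      linarith [h1.1]
    have hsub : P ∪ (⋃ ν ∈ T, prism ν ν (h ν) (facet T h ν) (Ioc 0 ε)) ⊆ (1 + ε) • P := by
      have hε1 : (0 : ℝ) < 1 + ε := by linarith
      intro y hy
      rw [mem_smul_set_iff_inv_smul_mem₀ hε1.ne']
      intro ν' hν'
      rw [inner_smul_right, inv_mul_le_iff₀ hε1]
      have hh' := hh ν' hν'
      rcases hy with hy | hy
      · nlinarith [hy ν' hν']
      · obtain ⟨ν, hν, h1, h2⟩ := mem_iUnion₂.1 hy
        rw [hinner ν hν, div_one] at h1 h2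
        have e1 := h2.1 ν' hν'
        rw [inner_sub_right, inner_smul_right] at e1
        have : (inner ℝ ν' ν : ℝ) ≤ 1 := by
          have := real_inner_le_norm ν' ν
          rwa [hT.unit ν hν, hT.unit ν' hν', mul_one] at this
        nlinarith [mul_le_mul_of_nonneg_left this h1.1.le, h1.2]
    have hvol : volume ((1 + ε) • P) = ENNReal.ofReal ((1 + ε) ^ n) * volume P := by
      rw [Measure.addHaar_smul, finrank_euclideanSpace, Fintype.card_fin,
        abs_of_pos (by positivity)]
    rw [← hvol, hS, Finset.mul_sum, ← Finset.sum_congr rfl hprism,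
      ← measure_biUnion_finset (fun ν hν ν' hν' hne => hT.disjoint_prism hν hν' hne ε) hmeas,
      ← measure_union hdisj (Finset.measurableSet_biUnion _ hmeas)]
    exact measure_mono hsub
  have hStop : S ≠ ∞ := by
    have := (le_add_self.trans (key 1 one_pos)).trans_lt
      (ENNReal.mul_lt_top ENNReal.ofReal_lt_top hPtop.lt_top)
    rw [ENNReal.ofReal_one, one_mul] at this
    exact this.ne
  rw [← ENNReal.ofReal_toReal hStop]
  refine ENNReal.ofReal_le_ofReal (le_of_forall_mul_le_one_add_pow n fun ε hε => ?_)
  have := ENNReal.toReal_mono (ENNReal.mul_ne_top ENNReal.ofReal_ne_top hPtop) (key ε hε)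
  rw [ENNReal.toReal_add hPtop (ENNReal.mul_ne_top ENNReal.ofReal_ne_top hStop),
    ENNReal.toReal_mul, ENNReal.toReal_mul, ENNReal.toReal_ofReal hε.le,
    ENNReal.toReal_ofReal (by positivity)] at this
  rw [measureReal_def]
  linarith

lemma surface_unit_ball_le :
    μHE[n - 1] (frontier (ball (0 : Euc n) 1)) ≤
      ENNReal.ofReal (n * volume.real (ball (0 : Euc n) 1)) := by
  refine le_mul_of_forall_one_add_pow n fun δ hδ => ?_
  have hδ1 : 0 < 1 + δ := by linarith
  have hB := OpenBody.ball (0 : Euc n) one_pos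
  obtain ⟨T, h, hT, hTL⟩ := hB.exists_outer (mem_ball_self one_pos) hδ
  have hb : IsBounded (polytope T h) := (hB.smul hδ1).isBounded.subset hTL
  calc _ ≤ μHE[n - 1] (frontier (polytope T h)) :=
        surface_mono hB.convex (by rw [hB.isOpen.interior_eq]; exact hB.nonempty) hb hT.subset _
    _ ≤ _ := surface_le_sum_facet
    _ ≤ _ := hT.sum_facet_le_volume hb
    _ ≤ ENNReal.ofReal (n * volume.real ((1 + δ) • ball (0 : Euc n) 1)) := by
        exact ENNReal.ofReal_le_ofReal
          (mul_le_mul_of_nonneg_left ((hB.smul hδ1).real_mono hTL) n.cast_nonneg)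
    _ = _ := by
        rw [real_smul hδ1.le, ← ENNReal.ofReal_mul (by positivity)]
        ring_nf

theorem surface_ball_le (x : Euc n) {r : ℝ} (hr : 0 < r) :
    μHE[n - 1] (frontier (ball x r)) ≤
      ENNReal.ofReal (n * volume.real (ball (0 : Euc n) 1) * r ^ (n - 1)) := by
  have : ball x r = x +ᵥ r • ball (0 : Euc n) 1 := by
    rw [_root_.smul_ball hr.ne', vadd_ball, smul_zero, vadd_eq_add, add_zero, Real.norm_of_nonneg hr.le,
      mul_one]
  rw [this, surface_vadd, surface_smul hr, mul_comm _ (r ^ (n - 1)),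
    ENNReal.ofReal_mul (by positivity)]
  gcongr
  exact surface_unit_ball_le

lemma OpenBody.surface_lt_top {L : Set (Euc n)} (hL : OpenBody L) :
    μHE[n - 1] (frontier L) < ∞ := by
  obtain ⟨r, hr, hLr⟩ := hL.isBounded.subset_ball_lt 0 0
  exact (surface_mono hL.convex (by rw [hL.isOpen.interior_eq]; exact hL.nonempty)
    isBounded_ball hLr _).trans_lt ((surface_ball_le 0 hr).trans_lt ENNReal.ofReal_lt_top)

/-- A convex body whose surface area is that of a ball of radius `R` satisfies `SurfLE`. -/
theorem OpenBody.surfLE {K : Set (Euc n)} (hK : OpenBody K) {R : ℝ} (hR : 0 < R)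
    (hper : μHE[n - 1] (frontier K) ≤ μHE[n - 1] (frontier (Metric.ball (0 : Euc n) R))) :
    SurfLE K R := by
  intro ι _ θ c _ hc hsub
  have := (hK.ofReal_surf_le hc hsub).trans (hper.trans (surface_ball_le 0 hR))
  exact (ENNReal.ofReal_le_ofReal_iff (by positivity)).1 this

end BallSurface

/-! ### A trace inequality on convex bodies -/

section Trace

open Measure

variable {n : ℕ} {K : Set (Euc n)}

lemma OpenBody.surface_inter_ball_le (hK : OpenBody K) (x : Euc n) {r : ℝ} (hr : 0 < r) :
    μHE[n - 1] (frontier K ∩ Metric.ball x r) ≤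
      ENNReal.ofReal (n * volume.real (Metric.ball (0 : Euc n) 1) * r ^ (n - 1)) := by
  rcases (frontier K ∩ Metric.ball x r).eq_empty_or_nonempty with he | ⟨z, hz, hzr⟩
  · rw [he, measure_empty]; exact zero_le
  have hne : (K ∩ Metric.ball x r).Nonempty := by
    rw [inter_comm]
    exact mem_closure_iff.1 hz.1 _ isOpen_ball hzr
  have hopen : IsOpen (K ∩ Metric.ball x r) := hK.isOpen.inter isOpen_ball
  have hsub : frontier K ∩ Metric.ball x r ⊆ frontier (K ∩ Metric.ball x r) := by
    rintro y ⟨hy, hyr⟩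
    rw [hK.isOpen.frontier_eq] at hy
    rw [hopen.frontier_eq]
    exact ⟨IsOpen.closure_inter isOpen_ball ⟨hy.1, hyr⟩, fun h => hy.2 h.1⟩
  exact (measure_mono hsub).trans ((surface_mono (hK.convex.inter (convex_ball x r))
    (by rwa [hopen.interior_eq]) isBounded_ball inter_subset_right _).trans (surface_ball_le x hr))

/-- The image of `H ⊗ Leb` under `(x, s) ↦ s • x`, where `H` is the surface measure of `K` and
`s ∈ (1/2, 1)`. -/
def coneMeasure (K : Set (Euc n)) : Measure (Euc n) :=
  ((μHE[n - 1].restrict (frontier K)).prod (volume.restrict (Ioo (1 / 2 : ℝ) 1))).map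
    fun z => z.2 • z.1

lemma OpenBody.exists_cone_measure_le (hn : n ≠ 0) (hK : OpenBody K) (h0 : (0 : Euc n) ∈ K) :
    ∃ C : ℝ≥0, 0 < C ∧ coneMeasure K ≤ (C : ℝ≥0∞) • volume := by
  obtain ⟨r, hr, hrK⟩ := Metric.isOpen_iff.1 hK.isOpen 0 h0
  have : IsFiniteMeasure (μHE[n - 1].restrict (frontier K) : Measure (Euc n)) :=
    ⟨by rw [restrict_apply_univ]; exact hK.surface_lt_top⟩
  set ω := volume.real (Metric.ball (0 : Euc n) 1) with hω
  have hω0 : 0 < ω := (OpenBody.ball 0 one_pos).real_pos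
  have hnhds : K ∈ nhds (0 : Euc n) := hK.isOpen.mem_nhds h0
  have hmap : Measurable fun z : Euc n × ℝ => z.2 • z.1 := by fun_prop
  have hgauge : LipschitzWith (Real.toNNReal r)⁻¹ (gauge K) :=
    hK.convex.lipschitzWith_gauge (Real.toNNReal_pos.2 hr) (by rwa [Real.coe_toNNReal r hr.le])
  set C : ℝ := 2 / r * n * 4 ^ (n - 1) with hC
  have hC0 : 0 < C := by have : 0 < (n : ℝ) := by exact_mod_cast Nat.pos_of_ne_zero hn
                         positivity
  have hball : ∀ (a : Euc n) (ρ : ℝ), 0 < ρ →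
      coneMeasure K (closedBall a ρ) ≤ ENNReal.ofReal C * volume (closedBall a ρ) := by
    intro a ρ hρ
    rw [coneMeasure, map_apply hmap measurableSet_closedBall,
      prod_apply_symm (hmap measurableSet_closedBall)]
    set J := Icc (gauge K a - ρ / r) (gauge K a + ρ / r) with hJ
    calc _ ≤ ∫⁻ s in Ioo (1 / 2 : ℝ) 1, J.indicator
          (fun _ => ENNReal.ofReal (n * ω * (4 * ρ) ^ (n - 1))) s := by
          refine setLIntegral_mono' measurableSet_Ioo fun s hs => ?_
          have hs0 : 0 < s := by linarith [hs.1]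
          rw [restrict_apply ((by fun_prop : Measurable fun x : Euc n => (x, s))
            (hmap measurableSet_closedBall))]
          by_cases hsJ : s ∈ J
          · rw [indicator_of_mem hsJ]
            refine (measure_mono ?_).trans (hK.surface_inter_ball_le (s⁻¹ • a) (by positivity))
            rintro x ⟨hx, hxK⟩
            refine ⟨hxK, ?_⟩
            have hx : dist (s • x) a ≤ ρ := hx
            rw [mem_ball, ← inv_smul_smul₀ hs0.ne' x, dist_smul₀, norm_inv,
              Real.norm_of_nonneg hs0.le, inv_mul_lt_iff₀ hs0]
            nlinarith [hs.1]
          · rw [indicator_of_notMem hsJ, nonpos_iff_eq_zero]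
            convert measure_empty (μ := μHE[n - 1])
            refine eq_empty_of_forall_notMem ?_
            rintro x ⟨hx, hxK⟩
            have hx : dist (s • x) a ≤ ρ := hx
            refine hsJ ?_
            have h1 : gauge K (s • x) = s := by
              rw [gauge_smul_of_nonneg hs0.le,
                (gauge_eq_one_iff_mem_frontier hK.convex hnhds).2 hxK, smul_eq_mul, mul_one]
            have h2 := hgauge.dist_le_mul (s • x) a
            rw [h1, Real.dist_eq, NNReal.coe_inv, Real.coe_toNNReal r hr.le] at h2
            have h3 : |s - gauge K a| ≤ ρ / r := by
              rw [div_eq_inv_mul]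
              exact h2.trans (by gcongr)
            rw [abs_le] at h3
            exact ⟨by linarith, by linarith⟩
      _ ≤ ∫⁻ s, J.indicator (fun _ => ENNReal.ofReal (n * ω * (4 * ρ) ^ (n - 1))) s :=
          setLIntegral_le_lintegral _ _
      _ = ENNReal.ofReal (n * ω * (4 * ρ) ^ (n - 1)) * ENNReal.ofReal (2 * ρ / r) := by
          rw [lintegral_indicator measurableSet_Icc, setLIntegral_const, Real.volume_Icc]
          congr 2
          ring
      _ = ENNReal.ofReal C * volume (closedBall a ρ) := by
          have : volume (closedBall a ρ) = ENNReal.ofReal (ρ ^ n * ω) := by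
            rw [addHaar_closedBall _ _ hρ.le, ENNReal.ofReal_mul (by positivity), hω,
              ofReal_measureReal (measure_ball_lt_top.ne), finrank_euclideanSpace,
              Fintype.card_fin]
          rw [this, ← ENNReal.ofReal_mul (by positivity), ← ENNReal.ofReal_mul hC0.le, hC, mul_pow,
            ← mul_pow_sub_one hn ρ]
          congr 1
          ring
  refine ⟨C.toNNReal, Real.toNNReal_pos.2 hC0, le_iff'.2 fun s => ?_⟩
  rw [Measure.smul_apply, smul_eq_mul]
  refine ENNReal.le_of_forall_pos_le_add fun ε hε _ => ?_
  have hε' : (ε / C.toNNReal : ℝ≥0∞) ≠ 0 :=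
    (ENNReal.div_pos (by exact_mod_cast hε.ne') ENNReal.coe_ne_top).ne'
  obtain ⟨t, ρ, ht, -, hρ, hcov, hsum⟩ := Besicovitch.exists_closedBall_covering_tsum_measure_le
    (volume : Measure (Euc n)) hε' (fun _ => Ioi 0) s
    (fun x _ δ hδ => ⟨δ / 2, by exact half_pos hδ, half_pos hδ, half_lt_self hδ⟩)
  have hcount : Countable t := ht.to_subtype
  calc coneMeasure K s ≤ coneMeasure K (⋃ x ∈ t, closedBall x (ρ x)) := measure_mono hcov
    _ ≤ ∑' x : t, coneMeasure K (closedBall x (ρ x)) := measure_biUnion_le _ ht _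
    _ ≤ ∑' x : t, ENNReal.ofReal C * volume (closedBall (x : Euc n) (ρ x)) :=
        ENNReal.tsum_le_tsum fun x => hball x _ (hρ x x.2)
    _ ≤ ENNReal.ofReal C * (volume s + ε / C.toNNReal) := by
        rw [ENNReal.tsum_mul_left]; gcongr
    _ = C.toNNReal * volume s + ε := by
        have : (C.toNNReal : ℝ≥0∞) ≠ 0 := by exact_mod_cast (Real.toNNReal_pos.2 hC0).ne'
        rw [mul_add]
        congr 1
        exact ENNReal.mul_div_cancel this ENNReal.coe_ne_top

lemma exists_young_const {p c ε : ℝ} (hp : 1 < p) (hc : 0 < c) (hε : 0 < ε) :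
    ∃ C : ℝ, 0 ≤ C ∧ ∀ a b : ℝ, 0 ≤ a → 0 ≤ b →
      c * a ^ (p - 1) * b ≤ ε * b ^ p + C * a ^ p := by
  have hp' : 0 < p - 1 := sub_pos.2 hp
  have hpow : ∀ t : ℝ, 0 ≤ t → t ^ p = t ^ (p - 1) * t := fun t ht => by
    rcases ht.eq_or_lt with rfl | ht
    · rw [Real.zero_rpow (by linarith), mul_zero]
    · rw [← Real.rpow_add_one ht.ne', sub_add_cancel]
  set M : ℝ := (c / ε) ^ (p - 1)⁻¹ with hM
  have hM0 : 0 < M := by positivity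
  have hMp : M ^ (p - 1) = c / ε := Real.rpow_inv_rpow (by positivity) hp'.ne'
  refine ⟨c * M, by positivity, fun a b ha hb => ?_⟩
  have h1 : 0 ≤ b ^ p := by positivity
  have h2 : 0 ≤ a ^ p := by positivity
  rcases le_total (M * a) b with h | h
  · have h3 : (M * a) ^ (p - 1) ≤ b ^ (p - 1) :=
      Real.rpow_le_rpow (by positivity) h hp'.le
    rw [Real.mul_rpow hM0.le ha, hMp, div_mul_eq_mul_div, div_le_iff₀ hε] at h3
    have h4 : c * a ^ (p - 1) * b ≤ ε * b ^ p := by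
      rw [hpow b hb]
      calc _ ≤ b ^ (p - 1) * ε * b := by gcongr
        _ = _ := by ring
    have : 0 ≤ c * M * a ^ p := by positivity
    linarith
  · have h3 : c * a ^ (p - 1) * b ≤ c * M * a ^ p := by
      rw [hpow a ha]
      calc _ ≤ c * a ^ (p - 1) * (M * a) := by gcongr
        _ = _ := by ring
    have : 0 ≤ ε * b ^ p := by positivity
    linarith

lemma ofReal_rpow_le_lintegral_ray {g : Euc n → ℝ} {L : ℝ≥0} (hg : LipschitzWith L g)
    {p ρ ε C : ℝ} (hp : 1 < p)
    (hY : ∀ a b : ℝ, 0 ≤ a → 0 ≤ b → p * ρ * a ^ (p - 1) * b ≤ ε * b ^ p + C * a ^ p)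
    {x : Euc n} (hx : ‖x‖ ≤ ρ)
    (hd : ∀ᵐ s ∂volume.restrict (Ioo (1 / 2 : ℝ) 1), DifferentiableAt ℝ g (s • x)) :
    ENNReal.ofReal (|g x| ^ p) ≤ ∫⁻ s in Ioo (1 / 2 : ℝ) 1,
      ENNReal.ofReal ((2 + C) * |g (s • x)| ^ p + ε * ‖fderiv ℝ g (s • x)‖ ^ p) := by
  set ψ : ℝ → ℝ := fun s => (2 * s - 1) * |g (s • x)| ^ p with hψ
  have hφ : LipschitzWith (L * ‖x‖₊) fun s : ℝ => g (s • x) :=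
    hg.comp (LipschitzWith.of_dist_le_mul fun s t => by
      rw [dist_eq_norm, ← sub_smul, norm_smul, dist_eq_norm, mul_comm, coe_nnnorm])
  have hloc : LocallyLipschitz ψ := by
    have h1 : LocallyLipschitz fun s : ℝ => |g (s • x)| ^ p :=
      ((contDiff_norm_rpow (E := ℝ) hp).locallyLipschitz).comp hφ.locallyLipschitz
    have h2 : LocallyLipschitz fun s : ℝ => 2 * s - 1 :=
      ContDiff.locallyLipschitz (𝕂 := ℝ) (by fun_prop)
    have h3 : LocallyLipschitz fun z : ℝ × ℝ => z.1 * z.2 :=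
      ContDiff.locallyLipschitz (𝕂 := ℝ) (by fun_prop)
    exact h3.comp (h2.prodMk h1)
  obtain ⟨M, hM⟩ := (hloc.locallyLipschitzOn (s := uIcc (1 / 2 : ℝ) 1)).exists_lipschitzOnWith_of_compact
    isCompact_uIcc
  have hac := hM.absolutelyContinuousOnInterval
  have hint := hac.integral_deriv_eq_sub
  have hψ1 : ψ 1 - ψ (1 / 2) = |g x| ^ p := by simp [hψ]; norm_num
  rw [hψ1, intervalIntegral.integral_of_le (by norm_num), integral_Ioc_eq_integral_Ioo] at hint
  have h0 : 0 ≤ |g x| ^ p := by positivity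
  calc ENNReal.ofReal (|g x| ^ p) = ‖∫ s in Ioo (1 / 2 : ℝ) 1, deriv ψ s‖ₑ := by
        rw [hint, Real.enorm_of_nonneg h0]
    _ ≤ ∫⁻ s in Ioo (1 / 2 : ℝ) 1, ‖deriv ψ s‖ₑ := enorm_integral_le_lintegral_enorm _
    _ ≤ _ := by
      refine lintegral_mono_ae ?_
      filter_upwards [hd, ae_restrict_mem measurableSet_Ioo] with s hs hsI
      have hφ' : HasDerivAt (fun s : ℝ => g (s • x)) (fderiv ℝ g (s • x) x) s := by
        have h1 : HasDerivAt (fun s : ℝ => s • x) x s := by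
          simpa using (hasDerivAt_id s).smul_const x
        exact hs.hasFDerivAt.comp_hasDerivAt s h1
      have hψ' := (((hasDerivAt_id s).const_mul 2).sub_const 1).mul
        ((hasDerivAt_abs_rpow (g (s • x)) hp).comp s hφ')
      have hψ'' : deriv ψ s = _ := hψ'.deriv
      rw [hψ'', Real.enorm_eq_ofReal_abs]
      refine ENNReal.ofReal_le_ofReal ?_
      set a := |g (s • x)| with ha
      have ha0 : 0 ≤ a := abs_nonneg _
      have hb : |fderiv ℝ g (s • x) x| ≤ ‖fderiv ℝ g (s • x)‖ * ρ :=
        ((fderiv ℝ g (s • x)).le_opNorm x).trans (by gcongr)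
      have haa : a ^ (p - 2) * a = a ^ (p - 1) := by
        rcases ha0.eq_or_lt with h | h
        · rw [← h, mul_zero, Real.zero_rpow (by linarith)]
        · rw [← Real.rpow_add_one h.ne']; congr 1; ring
      have hs1 : |2 * s - 1| ≤ 1 := by
        rw [abs_le]; constructor <;> linarith [hsI.1, hsI.2]
      have key := hY a _ ha0 (norm_nonneg (fderiv ℝ g (s • x)))
      simp only [Function.comp, id, mul_one]
      refine (abs_add_le _ _).trans ?_
      rw [abs_mul, abs_mul, abs_mul, abs_mul, abs_mul, abs_two, ← ha,
        abs_of_nonneg (show 0 ≤ a ^ p by positivity), abs_of_pos (show 0 < p by linarith),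
        abs_of_nonneg (show 0 ≤ a ^ (p - 2) by positivity), mul_assoc p, haa]
      calc _ ≤ 2 * a ^ p + 1 * (p * a ^ (p - 1) * (‖fderiv ℝ g (s • x)‖ * ρ)) := by gcongr
        _ = 2 * a ^ p + p * ρ * a ^ (p - 1) * ‖fderiv ℝ g (s • x)‖ := by ring
        _ ≤ _ := by linarith

lemma OpenBody.lintegral_frontier_le_of_zero_mem (hn : n ≠ 0) (hK : OpenBody K)
    (h0 : (0 : Euc n) ∈ K) {p δ : ℝ} (hp : 1 < p) (hδ : 0 < δ) :
    ∃ C : ℝ, 0 ≤ C ∧ ∀ (g : Euc n → ℝ) (L : ℝ≥0), LipschitzWith L g →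
      ∫⁻ x in frontier K, ENNReal.ofReal (|g x| ^ p) ∂μHE[n - 1] ≤
        ∫⁻ x in K, ENNReal.ofReal (C * |g x| ^ p + δ * ‖fderiv ℝ g x‖ ^ p) := by
  obtain ⟨C₀, hC₀, hcone⟩ := hK.exists_cone_measure_le hn h0
  have hC₀' : (0 : ℝ) < C₀ := by exact_mod_cast hC₀
  obtain ⟨ρ, hρ, hKρ⟩ := hK.isBounded.closure.exists_pos_norm_le
  obtain ⟨C, hC, hY⟩ := exists_young_const (p := p) (c := p * ρ) (ε := δ / C₀) hp
    (by positivity) (by positivity)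
  refine ⟨C₀ * (2 + C), by positivity, fun g L hg => ?_⟩
  have : IsFiniteMeasure (μHE[n - 1].restrict (frontier K) : Measure (Euc n)) :=
    ⟨by rw [restrict_apply_univ]; exact hK.surface_lt_top⟩
  have hmap : Measurable fun z : Euc n × ℝ => z.2 • z.1 := by fun_prop
  set F : Euc n → ℝ≥0∞ := fun y =>
    ENNReal.ofReal ((2 + C) * |g y| ^ p + δ / C₀ * ‖fderiv ℝ g y‖ ^ p) with hF
  have hFm : Measurable F := by
    have h1 : Measurable g := hg.continuous.measurable
    have h2 : Measurable fun y => ‖fderiv ℝ g y‖ := (measurable_fderiv ℝ g).norm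
    exact (((h1.norm.pow_const p).const_mul _).add ((h2.pow_const p).const_mul _)).ennreal_ofReal
  have hdiff : ∀ᵐ x ∂(μHE[n - 1].restrict (frontier K) : Measure (Euc n)),
      ∀ᵐ s ∂volume.restrict (Ioo (1 / 2 : ℝ) 1), DifferentiableAt ℝ g (s • x) := by
    have hac : coneMeasure K ≪ (volume : Measure (Euc n)) := absolutelyContinuous_of_le_smul hcone
    exact ae_ae_of_ae_prod (ae_of_ae_map hmap.aemeasurable (hac.ae_le hg.ae_differentiableAt))
  have hmem : ∀ x ∈ frontier K, ∀ s ∈ Ioo (1 / 2 : ℝ) 1, s • x ∈ K := by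
    intro x hx s hs
    have := hK.convex.combo_interior_closure_mem_interior
      (by rwa [hK.isOpen.interior_eq] : (0 : Euc n) ∈ interior K) hx.1
      (sub_pos.2 hs.2) (by linarith [hs.1] : 0 ≤ s) (by ring)
    rwa [smul_zero, zero_add, hK.isOpen.interior_eq] at this
  have hfr : MeasurableSet (frontier K) := isClosed_frontier.measurableSet
  calc ∫⁻ x in frontier K, ENNReal.ofReal (|g x| ^ p) ∂μHE[n - 1]
      ≤ ∫⁻ x in frontier K, (∫⁻ s in Ioo (1 / 2 : ℝ) 1, K.indicator F (s • x)) ∂μHE[n - 1] := by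
        refine lintegral_mono_ae ?_
        filter_upwards [hdiff, ae_restrict_mem hfr] with x hx hxK
        refine (ofReal_rpow_le_lintegral_ray hg hp hY (hKρ x hxK.1) hx).trans_eq ?_
        exact setLIntegral_congr_fun measurableSet_Ioo fun s hs => by
          rw [indicator_of_mem (hmem x hxK s hs)]
    _ = ∫⁻ y, K.indicator F y ∂coneMeasure K := by
        have hm : Measurable (K.indicator F) := hFm.indicator hK.isOpen.measurableSet
        rw [coneMeasure, lintegral_map hm hmap]
        exact (lintegral_prod (fun z : Euc n × ℝ => K.indicator F (z.2 • z.1))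
          (hm.comp hmap).aemeasurable).symm
    _ ≤ C₀ * ∫⁻ y, K.indicator F y := by
        rw [← smul_eq_mul, ← lintegral_smul_measure]
        exact lintegral_mono' hcone le_rfl
    _ = ∫⁻ x in K, ENNReal.ofReal (C₀ * (2 + C) * |g x| ^ p + δ * ‖fderiv ℝ g x‖ ^ p) := by
        rw [lintegral_indicator hK.isOpen.measurableSet, ← lintegral_const_mul _ hFm]
        refine lintegral_congr fun y => ?_
        rw [hF, ← ENNReal.ofReal_coe_nnreal, ← ENNReal.ofReal_mul hC₀'.le]
        congr 1
        field_simp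

lemma OpenBody.lintegral_frontier_le (hn : n ≠ 0) (hK : OpenBody K)
    {p δ : ℝ} (hp : 1 < p) (hδ : 0 < δ) :
    ∃ C : ℝ, 0 ≤ C ∧ ∀ (g : Euc n → ℝ) (L : ℝ≥0), LipschitzWith L g →
      ∫⁻ x in frontier K, ENNReal.ofReal (|g x| ^ p) ∂μHE[n - 1] ≤
        ∫⁻ x in K, ENNReal.ofReal (C * |g x| ^ p + δ * ‖fderiv ℝ g x‖ ^ p) := by
  obtain ⟨z, hz⟩ := hK.nonempty
  have hK' : OpenBody (-z +ᵥ K) := hK.vadd _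
  obtain ⟨C, hC, h⟩ := hK'.lintegral_frontier_le_of_zero_mem hn
    (mem_vadd_set.2 ⟨z, hz, by simp⟩) hp hδ
  refine ⟨C, hC, fun g L hg => ?_⟩
  have hpre : ∀ A : Set (Euc n), (fun x => z + x) ⁻¹' A = -z +ᵥ A := fun A => by
    ext x; simp [mem_vadd_set_iff_neg_vadd_mem]
  have hmp : MeasurePreserving (fun x : Euc n => z + x) volume volume :=
    measurePreserving_add_left volume z
  have hme : MeasurableEmbedding (fun x : Euc n => z + x) := measurableEmbedding_addLeft z
  have hmpH : MeasurePreserving (fun x : Euc n => z + x) μHE[n - 1] μHE[n - 1] :=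
    (IsometryEquiv.addLeft z).measurePreserving_euclideanHausdorffMeasure (n - 1)
  have hfr : frontier (-z +ᵥ K) = -z +ᵥ frontier K := by
    rw [← hpre, ← hpre]
    exact ((Homeomorph.addLeft z).preimage_frontier K).symm
  have hlip : LipschitzWith L fun x => g (z + x) :=
    LipschitzWith.of_dist_le_mul fun x y => by simpa using hg.dist_le_mul (z + x) (z + y)
  have := h _ L hlip
  rw [hfr, ← hpre, ← hpre] at this
  rw [hmpH.setLIntegral_comp_preimage_emb hme (fun x => ENNReal.ofReal (|g x| ^ p))] at this
  simp_rw [fderiv_comp_add_left] at this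
  rwa [hmp.setLIntegral_comp_preimage_emb hme
    (fun x => ENNReal.ofReal (C * |g x| ^ p + δ * ‖fderiv ℝ g x‖ ^ p))] at this

end Trace

/-! ### Boundedness of Rayleigh quotients -/

section Rayleigh

open Measure

variable {n : ℕ} {K : Set (Euc n)}

lemma exists_smul_hausdorffMeasure_eq (hn : 1 ≤ n) :
    ∃ c : ℝ≥0, 0 < c ∧ (μHE[n - 1] : Measure (Euc n)) = c • μH[(n : ℝ) - 1] := by
  refine ⟨_, pos_iff_ne_zero.2 (addHaarScalarFactor_volume_hausdorffMeasure_ne_zero (n - 1)), ?_⟩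
  have h : (n : ℝ) - 1 = ((n - 1 : ℕ) : ℝ) := by rw [Nat.cast_sub hn, Nat.cast_one]
  rw [euclideanHausdorffMeasure_def, h]

lemma LipschitzWith.integrableOn_abs_rpow {g : Euc n → ℝ} {L : ℝ≥0} (hg : LipschitzWith L g)
    {p : ℝ} (hp : 0 ≤ p) {A : Set (Euc n)} (hA : IsBounded A) (hAm : MeasurableSet A)
    {μ : Measure (Euc n)} (hμ : μ A < ∞) : IntegrableOn (fun x => |g x| ^ p) A μ := by
  obtain ⟨M, hM⟩ := (hg.isBounded_image hA).exists_norm_le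
  refine Measure.integrableOn_of_bounded (M := M ^ p) hμ.ne
    (hg.continuous.measurable.norm.pow_const p).aestronglyMeasurable ?_
  filter_upwards [ae_restrict_mem hAm] with x hx
  rw [Real.norm_of_nonneg (by positivity)]
  exact Real.rpow_le_rpow (abs_nonneg _) (hM _ (mem_image_of_mem _ hx)) hp

lemma LipschitzWith.integrableOn_norm_fderiv_rpow {g : Euc n → ℝ} {L : ℝ≥0}
    (hg : LipschitzWith L g) {p : ℝ} (hp : 0 ≤ p) {A : Set (Euc n)}
    {μ : Measure (Euc n)} (hμ : μ A < ∞) : IntegrableOn (fun x => ‖fderiv ℝ g x‖ ^ p) A μ := by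
  refine Measure.integrableOn_of_bounded (M := L ^ p) hμ.ne
    ((measurable_fderiv ℝ g).norm.pow_const p).aestronglyMeasurable ?_
  refine Filter.Eventually.of_forall fun x => ?_
  rw [Real.norm_of_nonneg (by positivity)]
  exact Real.rpow_le_rpow (norm_nonneg _) (norm_fderiv_le_of_lipschitz ℝ hg) hp

lemma OpenBody.bddBelow_rayleigh (hn : 1 ≤ n) (hK : OpenBody K) {p β : ℝ} (hp : 1 < p)
    (hβ : β < 0) :
    BddBelow { r : ℝ | ∃ u : Euc n → ℝ, (∃ L : ℝ≥0, LipschitzOnWith L u (closure K)) ∧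
      (0 < ∫ x in K, |u x| ^ p) ∧ r = rayleigh n p β K u } := by
  obtain ⟨c, hc, hcH⟩ := exists_smul_hausdorffMeasure_eq hn
  have hc' : (0 : ℝ) < c := by exact_mod_cast hc
  obtain ⟨C, hC, h⟩ := hK.lintegral_frontier_le (by omega) hp
    (δ := c / (-β)) (div_pos hc' (by linarith))
  refine ⟨β / c * C, ?_⟩
  rintro _ ⟨u, ⟨L, hu⟩, hD, rfl⟩
  obtain ⟨g, hg, hug⟩ := hu.extend_real
  have hmK := hK.isOpen.measurableSet
  have hmF : MeasurableSet (frontier K) := isClosed_frontier.measurableSet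
  have hp0 : 0 ≤ p := by linarith
  have hfd : ∀ x ∈ K, fderiv ℝ u x = fderiv ℝ g x := fun x hx =>
    Filter.EventuallyEq.fderiv_eq <| Filter.eventuallyEq_of_mem (hK.isOpen.mem_nhds hx)
      fun y hy => hug (subset_closure hy)
  have e1 : ∫ x in K, ‖fderiv ℝ u x‖ ^ p = ∫ x in K, ‖fderiv ℝ g x‖ ^ p :=
    setIntegral_congr_fun hmK fun x hx => by simp only [hfd x hx]
  have e2 : ∫ x in K, |u x| ^ p = ∫ x in K, |g x| ^ p :=
    setIntegral_congr_fun hmK fun x hx => by simp only [hug (subset_closure hx)]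
  have e3 : ∫ x in frontier K, |u x| ^ p ∂μH[(n : ℝ) - 1] =
      ∫ x in frontier K, |g x| ^ p ∂μH[(n : ℝ) - 1] :=
    setIntegral_congr_fun hmF fun x hx => by simp only [hug (frontier_subset_closure hx)]
  rw [rayleigh, e1, e2, e3]
  rw [e2] at hD
  have i1 := LipschitzWith.integrableOn_norm_fderiv_rpow hg hp0 hK.volume_lt_top
  have i2 := LipschitzWith.integrableOn_abs_rpow hg hp0 hK.isBounded hmK hK.volume_lt_top
  have i3 := LipschitzWith.integrableOn_abs_rpow hg hp0
    (hK.isBounded.closure.subset frontier_subset_closure) hmF hK.surface_lt_top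
  have i4 : IntegrableOn (fun x => C * |g x| ^ p + c / -β * ‖fderiv ℝ g x‖ ^ p) K :=
    (i2.const_mul C).add (i1.const_mul _)
  have h4 : ∀ x, 0 ≤ C * |g x| ^ p + c / -β * ‖fderiv ℝ g x‖ ^ p := fun x => by
    have := neg_pos.2 hβ
    positivity
  have key := h g L hg
  rw [← ofReal_integral_eq_lintegral_ofReal i3 (Filter.Eventually.of_forall fun x => by positivity),
    ← ofReal_integral_eq_lintegral_ofReal i4 (Filter.Eventually.of_forall h4),
    ENNReal.ofReal_le_ofReal_iff (integral_nonneg h4),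
    integral_add (i2.const_mul C) (i1.const_mul _), integral_const_mul, integral_const_mul,
    hcH, restrict_smul, integral_smul_nnreal_measure, NNReal.smul_def, smul_eq_mul] at key
  rw [le_div_iff₀ hD]
  set S := ∫ x in frontier K, |g x| ^ p ∂μH[(n : ℝ) - 1]
  set D := ∫ x in K, |g x| ^ p
  set N := ∫ x in K, ‖fderiv ℝ g x‖ ^ p
  have h1 : S ≤ (C * D + c / -β * N) / c := by rw [le_div_iff₀ hc']; linarith
  have h2 := mul_le_mul_of_nonpos_left h1 hβ.le
  have h3 : β * ((C * D + c / -β * N) / c) = β / c * C * D - N := by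
    have := hβ.ne
    field_simp
    ring
  linarith

end Rayleigh

/-! ### Transplanting a radial function by the distance to the boundary -/

section WebFunction

open Measure

variable {n : ℕ} {K : Set (Euc n)}

lemma norm_fderiv_comp_le_of_lipschitz {E : Type*} [NormedAddCommGroup E] [NormedSpace ℝ E]
    {H : ℝ → ℝ} {d : E → ℝ} (hd : LipschitzWith 1 d) {x : E} (hH : DifferentiableAt ℝ H (d x)) :
    ‖fderiv ℝ (fun y => H (d y)) x‖ ≤ |deriv H (d x)| := by
  by_cases hu : DifferentiableAt ℝ (fun y => H (d y)) x
  swap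
  · rw [fderiv_zero_of_not_differentiableAt hu, norm_zero]; exact abs_nonneg _
  refine le_of_forall_pos_le_add fun ε hε => ?_
  refine hu.hasFDerivAt.le_of_lip' (by positivity) ?_
  have h1 := hd.continuous.continuousAt.eventually
    ((hasDerivAt_iff_isLittleO.1 hH.hasDerivAt).bound hε)
  filter_upwards [h1] with y hy
  have h2 : |d y - d x| ≤ ‖y - x‖ := by
    have := hd.dist_le_mul y x
    rwa [NNReal.coe_one, one_mul, Real.dist_eq, dist_eq_norm] at this
  rw [smul_eq_mul, Real.norm_eq_abs, Real.norm_eq_abs] at hy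
  calc ‖H (d y) - H (d x)‖
      = |(H (d y) - H (d x) - (d y - d x) * deriv H (d x)) + (d y - d x) * deriv H (d x)| := by
        rw [sub_add_cancel, Real.norm_eq_abs]
    _ ≤ ε * |d y - d x| + |d y - d x| * |deriv H (d x)| :=
        (abs_add_le _ _).trans (add_le_add hy (abs_mul _ _).le)
    _ = (|deriv H (d x)| + ε) * |d y - d x| := by ring
    _ ≤ _ := by gcongr

/-- A differentiable radial function has a profile differentiable away from the centre. -/
lemma exists_hasDerivAt_profile {E : Type*} [NormedAddCommGroup E] [NormedSpace ℝ E]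
    {v : E → ℝ} {H : ℝ → ℝ} {R : ℝ} (hvH : ∀ x ∈ closedBall (0 : E) R, v x = H (R - ‖x‖))
    {x : E} (hx : x ∈ ball (0 : E) R) (hx0 : x ≠ 0) (hv : DifferentiableAt ℝ v x) :
    DifferentiableAt ℝ H (R - ‖x‖) ∧ |deriv H (R - ‖x‖)| ≤ ‖fderiv ℝ v x‖ := by
  have hr : 0 < ‖x‖ := norm_pos_iff.2 hx0
  rw [mem_ball_zero_iff] at hx
  have h1 : HasDerivAt (fun t : ℝ => (t * ‖x‖⁻¹) • x) ((1 * ‖x‖⁻¹) • x) ‖x‖ :=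
    ((hasDerivAt_id ‖x‖).mul_const _).smul_const x
  have hx1 : (‖x‖ * ‖x‖⁻¹) • x = x := by rw [mul_inv_cancel₀ hr.ne', one_smul]
  have h2 : HasDerivAt (fun t : ℝ => v ((t * ‖x‖⁻¹) • x)) (fderiv ℝ v x ((1 * ‖x‖⁻¹) • x)) ‖x‖ := by
    refine HasFDerivAt.comp_hasDerivAt ‖x‖ (l := v) ?_ h1
    rw [hx1]
    exact hv.hasFDerivAt
  have h3 : HasDerivAt (fun t => H (R - t)) (fderiv ℝ v x ((1 * ‖x‖⁻¹) • x)) ‖x‖ := by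
    refine h2.congr_of_eventuallyEq ?_
    filter_upwards [Ioo_mem_nhds hr hx] with t ht
    have hn : ‖(t * ‖x‖⁻¹) • x‖ = t := by
      rw [norm_smul, norm_mul, norm_inv, norm_norm, mul_assoc, inv_mul_cancel₀ hr.ne', mul_one,
        Real.norm_of_nonneg ht.1.le]
    rw [hvH _ (by rw [mem_closedBall_zero_iff, hn]; exact ht.2.le), hn]
  have h4 : HasDerivAt H (-(fderiv ℝ v x ((1 * ‖x‖⁻¹) • x))) (R - ‖x‖) := by
    have := HasDerivAt.comp_const_sub (f := fun t => H (R - t)) R (R - ‖x‖)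
      (by rwa [sub_sub_cancel])
    simpa using this
  refine ⟨h4.differentiableAt, ?_⟩
  rw [h4.deriv, abs_neg]
  refine ((fderiv ℝ v x).le_opNorm _).trans_eq ?_
  rw [norm_smul, one_mul, norm_inv, norm_norm, inv_mul_cancel₀ hr.ne', mul_one]

lemma OpenBody.lintegral_infDist_le (hK : OpenBody K) (hn : 2 ≤ n) {R : ℝ} (hR : 0 ≤ R)
    (hper : SurfLE K R) {Φ : ℝ → ℝ≥0∞} (hΦ : Measurable Φ) :
    ∫⁻ x in K, Φ (infDist x Kᶜ) ≤ ∫⁻ x in Metric.ball (0 : Euc n) R, Φ (R - ‖x‖) := by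
  have h1 : Measurable fun x : Euc n => infDist x Kᶜ := (continuous_infDist_pt _).measurable
  have h2 : Measurable fun x : Euc n => R - ‖x‖ := by fun_prop
  rw [← lintegral_map hΦ h1, ← lintegral_map hΦ h2]
  exact lintegral_mono' (hK.map_infDist_le hn hR hper) le_rfl

lemma OpenBody.exists_web_function (hK : OpenBody K) (hn : 2 ≤ n) {R : ℝ} (hR : 0 ≤ R)
    (hper : SurfLE K R) {v : Euc n → ℝ} {L : ℝ≥0}
    (hv : LipschitzOnWith L v (closedBall (0 : Euc n) R))
    (hrad : ∃ h : ℝ → ℝ, ∀ x ∈ closedBall (0 : Euc n) R, v x = h ‖x‖) {p : ℝ} (hp : 0 ≤ p) :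
    ∃ u : Euc n → ℝ, LipschitzWith L u ∧
      (∃ a, (∀ x ∈ frontier K, u x = a) ∧ ∀ x ∈ frontier (Metric.ball (0 : Euc n) R), v x = a) ∧
      (∀ x, u x ∈ v '' closedBall (0 : Euc n) R) ∧
      (∫⁻ x in K, ENNReal.ofReal (‖fderiv ℝ u x‖ ^ p) ≤
        ∫⁻ x in Metric.ball (0 : Euc n) R, ENNReal.ofReal (‖fderiv ℝ v x‖ ^ p)) ∧
      ∀ Ψ : ℝ → ℝ≥0∞, Measurable Ψ →
        ∫⁻ x in K, Ψ (u x) ≤ ∫⁻ x in Metric.ball (0 : Euc n) R, Ψ (v x) := by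
  have : Nontrivial (Fin n) := Fin.nontrivial_iff_two_le.2 hn
  have : Nontrivial (Euc n) := inferInstance
  obtain ⟨h, hh⟩ := hrad
  obtain ⟨e, he⟩ := exists_norm_eq (Euc n) zero_le_one
  set γ : ℝ → Euc n := fun s => (max 0 (min R (R - s))) • e with hγ
  have hγn : ∀ s, ‖γ s‖ = max 0 (min R (R - s)) := fun s => by
    rw [hγ, norm_smul, he, mul_one, Real.norm_of_nonneg (le_max_left _ _)]
  have hγm : ∀ s, γ s ∈ closedBall (0 : Euc n) R := fun s => by
    rw [mem_closedBall_zero_iff, hγn]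
    exact max_le hR (min_le_left _ _)
  have hγL : LipschitzWith 1 γ := by
    have h1 : LipschitzWith 1 fun s : ℝ => max 0 (min R (R - s)) :=
      ((LipschitzWith.of_dist_le_mul fun s t => by
        rw [NNReal.coe_one, one_mul, dist_sub_left]).const_min R).const_max 0
    refine LipschitzWith.of_dist_le_mul fun s t => ?_
    have := h1.dist_le_mul s t
    rwa [hγ, dist_eq_norm, ← sub_smul, norm_smul, he, mul_one, ← dist_eq_norm]
  set H : ℝ → ℝ := fun s => v (γ s) with hH
  have hHL : LipschitzWith L H := by
    have := hv.comp hγL.lipschitzOnWith (s := univ) (fun s _ => hγm s)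
    rw [mul_one, lipschitzOnWith_univ] at this
    exact this
  have hvH : ∀ x ∈ closedBall (0 : Euc n) R, v x = H (R - ‖x‖) := fun x hx => by
    rw [hH, hh x hx]
    simp only
    rw [hh _ (hγm _), hγn, sub_sub_cancel, min_eq_right (mem_closedBall_zero_iff.1 hx),
      max_eq_right (norm_nonneg _)]
  set d : Euc n → ℝ := fun x => infDist x Kᶜ with hd
  have hdL : LipschitzWith 1 d := lipschitz_infDist_pt _
  have hdiffB : ∀ᵐ x ∂volume.restrict (Metric.ball (0 : Euc n) R),
      DifferentiableAt ℝ H (R - ‖x‖) ∧ |deriv H (R - ‖x‖)| ≤ ‖fderiv ℝ v x‖ := by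
    have h1 := (hv.mono ball_subset_closedBall).ae_differentiableWithinAt_of_mem
      (μ := (volume : Measure (Euc n)))
    have h2 : ∀ᵐ x ∂(volume : Measure (Euc n)), x ≠ 0 :=
      compl_mem_ae_iff.2 (measure_singleton (0 : Euc n))
    filter_upwards [ae_restrict_of_ae h1, ae_restrict_of_ae h2,
      ae_restrict_mem isOpen_ball.measurableSet] with x hx hx0 hxB
    exact exists_hasDerivAt_profile hvH hxB hx0
      ((hx hxB).differentiableAt (isOpen_ball.mem_nhds hxB))
  have hdiffK : ∀ᵐ x ∂volume.restrict K, DifferentiableAt ℝ H (d x) := by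
    have hm : MeasurableSet {s | DifferentiableAt ℝ H s} := measurableSet_of_differentiableAt ℝ H
    set χ : ℝ → ℝ≥0∞ := {s | DifferentiableAt ℝ H s}ᶜ.indicator 1 with hχ
    have hχm : Measurable χ := measurable_one.indicator hm.compl
    have h1 := hK.lintegral_infDist_le hn hR hper hχm
    have h2 : (fun x : Euc n => χ (R - ‖x‖)) =ᵐ[volume.restrict (Metric.ball 0 R)] 0 := by
      filter_upwards [hdiffB] with x hx
      exact indicator_of_notMem (not_not_intro hx.1) _
    rw [lintegral_congr_ae h2, Pi.zero_def, lintegral_zero, nonpos_iff_eq_zero] at h1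
    have h3 := (lintegral_eq_zero_iff (f := fun x => χ (d x))
      (hχm.comp hdL.continuous.measurable)).1 h1
    filter_upwards [h3] with x hx
    by_contra hcon
    have : χ (d x) = 1 := indicator_of_mem hcon _
    rw [this] at hx
    exact one_ne_zero hx
  refine ⟨fun x => H (d x), by rw [← mul_one L]; exact hHL.comp hdL, ⟨H 0, fun x hx => ?_, fun x hx => ?_⟩,
    fun x => ⟨_, hγm _, rfl⟩, ?_, fun Ψ hΨ => ?_⟩
  · have : x ∈ Kᶜ := by rw [hK.isOpen.frontier_eq] at hx; exact hx.2
    simp only [hd, infDist_zero_of_mem this]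
  · have hxR : ‖x‖ = R := by simpa using frontier_ball_subset_sphere hx
    rw [hvH x (by simp [hxR]), hxR, sub_self]
  · calc _ ≤ ∫⁻ x in K, ENNReal.ofReal (|deriv H (d x)| ^ p) := by
          refine lintegral_mono_ae ?_
          filter_upwards [hdiffK] with x hx
          exact ENNReal.ofReal_le_ofReal (Real.rpow_le_rpow (norm_nonneg _)
            (norm_fderiv_comp_le_of_lipschitz hdL hx) hp)
      _ ≤ ∫⁻ x in Metric.ball (0 : Euc n) R, ENNReal.ofReal (|deriv H (R - ‖x‖)| ^ p) :=
          hK.lintegral_infDist_le hn hR hper (Φ := fun s => ENNReal.ofReal (|deriv H s| ^ p))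
            ((measurable_deriv H).norm.pow_const p).ennreal_ofReal
      _ ≤ _ := by
          refine lintegral_mono_ae ?_
          filter_upwards [hdiffB] with x hx
          exact ENNReal.ofReal_le_ofReal (Real.rpow_le_rpow (abs_nonneg _) hx.2 hp)
  · refine (hK.lintegral_infDist_le hn hR hper
      (hΨ.comp hHL.continuous.measurable)).trans_eq ?_
    exact setLIntegral_congr_fun isOpen_ball.measurableSet fun x hx => by
      simp only [Function.comp, hvH x (ball_subset_closedBall hx)]

end WebFunction

/-! ### Comparison of the first Robin eigenvalues -/

section Rayleigh

open Measure

variable {n : ℕ} {K : Set (Euc n)}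

lemma OpenBody.hausdorffMeasure_frontier_lt_top (hn : 1 ≤ n) (hK : OpenBody K) :
    μH[(n : ℝ) - 1] (frontier K) < ∞ := by
  obtain ⟨c, hc, h⟩ := exists_smul_hausdorffMeasure_eq hn
  have := hK.surface_lt_top
  rw [h, Measure.smul_apply, ENNReal.smul_def, smul_eq_mul] at this
  exact ENNReal.lt_top_of_mul_ne_top_right this.ne (by exact_mod_cast hc.ne')

lemma OpenBody.robinEig_nonpos (hn : 1 ≤ n) (hK : OpenBody K) {p β : ℝ} (hp : 1 < p)
    (hβ : β < 0) : robinEig n p β K ≤ 0 := by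
  refine (csInf_le (hK.bddBelow_rayleigh hn hp hβ)
    ⟨fun _ => 1, ⟨0, LipschitzWith.const 1 |>.lipschitzOnWith⟩, ?_, rfl⟩).trans ?_
  · simpa using hK.real_pos
  · have hp0 : p ≠ 0 := by linarith
    simp only [rayleigh, abs_one, Real.one_rpow, fderiv_fun_const, Pi.zero_apply, norm_zero,
      Real.zero_rpow hp0, integral_zero, zero_add]
    exact div_nonpos_of_nonpos_of_nonneg
      (mul_nonpos_of_nonpos_of_nonneg hβ.le (integral_nonneg fun _ => zero_le_one))
      (integral_nonneg fun _ => zero_le_one)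

lemma setIntegral_le_of_lintegral_le {α : Type*} [MeasurableSpace α] {μ ν : Measure α}
    {f g : α → ℝ} (hf : Integrable f μ) (hg : Integrable g ν) (hf0 : 0 ≤ᵐ[μ] f)
    (hg0 : 0 ≤ᵐ[ν] g)
    (h : ∫⁻ x, ENNReal.ofReal (f x) ∂μ ≤ ∫⁻ x, ENNReal.ofReal (g x) ∂ν) :
    ∫ x, f x ∂μ ≤ ∫ x, g x ∂ν := by
  rwa [← ofReal_integral_eq_lintegral_ofReal hf hf0, ← ofReal_integral_eq_lintegral_ofReal hg hg0,
    ENNReal.ofReal_le_ofReal_iff (integral_nonneg_of_ae hg0)] at h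

end Rayleigh

/-- Key comparison in the proof of Theorem 2 (β < 0). -/
theorem stmt3 {n : ℕ} (hn : 2 ≤ n) (p β : ℝ) (hp1 : 1 < p) (hβ : β < 0)
    (Ω : Set (EuclideanSpace ℝ (Fin n))) (hΩo : IsOpen Ω) (hΩb : IsBounded Ω)
    (hΩc : Convex ℝ Ω) (hΩne : Ω.Nonempty)
    (R : ℝ) (hR : 0 < R)
    (Ωstar : Set (EuclideanSpace ℝ (Fin n)))
    (hstar : Ωstar = ball (0 : EuclideanSpace ℝ (Fin n)) R)
    (hper : perim n Ωstar = perim n Ω)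
    (v : EuclideanSpace ℝ (Fin n) → ℝ) (hv : IsFirstEigenfunction n p β Ωstar v)
    (vm : ℝ) (hvm : vm = sInf (v '' closure Ωstar)) :
    (0 < 1 - vm ^ p / (∫ x in Ωstar, |v x| ^ p) *
        ((volume Ωstar).toReal - (volume Ω).toReal) ∧
      1 - vm ^ p / (∫ x in Ωstar, |v x| ^ p) *
        ((volume Ωstar).toReal - (volume Ω).toReal) ≤ 1) ∧
    robinEig n p β Ω ≤
      robinEig n p β Ωstar /
        (1 - vm ^ p / (∫ x in Ωstar, |v x| ^ p) *
          ((volume Ωstar).toReal - (volume Ω).toReal)) := by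
  subst hstar
  have hn1 : 1 ≤ n := by omega
  have hp0 : 0 ≤ p := by linarith
  have hK : OpenBody Ω := ⟨hΩo, hΩb, hΩc, hΩne⟩
  have hB : OpenBody (ball (0 : Euc n) R) := OpenBody.ball 0 hR
  obtain ⟨⟨L, hvL⟩, hvpos, hrad, hD, hray⟩ := hv
  rw [closure_ball _ hR.ne'] at hvL hvpos hrad hvm
  have hH : μH[(n : ℝ) - 1] (frontier (ball (0 : Euc n) R)) = μH[(n : ℝ) - 1] (frontier Ω) :=
    (ENNReal.toReal_eq_toReal_iff' (hB.hausdorffMeasure_frontier_lt_top hn1).ne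
      (hK.hausdorffMeasure_frontier_lt_top hn1).ne).1 hper
  have hsurf : SurfLE Ω R := by
    obtain ⟨c, -, hc⟩ := exists_smul_hausdorffMeasure_eq hn1
    refine hK.surfLE hR ?_
    rw [hc, Measure.smul_apply, Measure.smul_apply, hH]
  obtain ⟨u, huL, ⟨a, hua, hva⟩, huv, hgrad, hcomp⟩ :=
    hK.exists_web_function hn hR.le hsurf hvL hrad hp0
  have hcpt : IsCompact (v '' closedBall (0 : Euc n) R) :=
    (isCompact_closedBall 0 R).image_of_continuousOn hvL.continuousOn
  have hvm_mem : vm ∈ v '' closedBall (0 : Euc n) R :=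
    hvm ▸ hcpt.sInf_mem ((nonempty_closedBall.2 hR.le).image v)
  have hvm_le : ∀ t ∈ v '' closedBall (0 : Euc n) R, vm ≤ t := fun t ht =>
    hvm ▸ csInf_le hcpt.bddBelow ht
  have hvm0 : 0 < vm := by
    obtain ⟨y, hy, rfl⟩ := hvm_mem
    exact hvpos y hy
  set m : ℝ := vm ^ p with hm
  have hm0 : 0 < m := Real.rpow_pos_of_pos hvm0 p
  have hm_le : ∀ t ∈ v '' closedBall (0 : Euc n) R, m ≤ |t| ^ p := fun t ht =>
    Real.rpow_le_rpow hvm0.le ((hvm_le t ht).trans (le_abs_self t)) hp0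
  obtain ⟨g, hg, hvg⟩ := hvL.extend_real
  have hmB : MeasurableSet (ball (0 : Euc n) R) := measurableSet_ball
  have hmK : MeasurableSet Ω := hΩo.measurableSet
  have iv : IntegrableOn (fun x => |v x| ^ p) (ball (0 : Euc n) R) :=
    (LipschitzWith.integrableOn_abs_rpow hg hp0 isBounded_ball hmB measure_ball_lt_top).congr_fun
      (fun x hx => by simp only [hvg (ball_subset_closedBall hx)]) hmB
  have iv' : IntegrableOn (fun x => ‖fderiv ℝ v x‖ ^ p) (ball (0 : Euc n) R) := by
    refine (LipschitzWith.integrableOn_norm_fderiv_rpow hg hp0 measure_ball_lt_top).congr_fun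
      (fun x hx => ?_) hmB
    have : fderiv ℝ v x = fderiv ℝ g x := Filter.EventuallyEq.fderiv_eq <|
      Filter.eventuallyEq_of_mem (isOpen_ball.mem_nhds hx)
        fun y hy => hvg (ball_subset_closedBall hy)
    simp only [this]
  have iu : IntegrableOn (fun x => |u x| ^ p) Ω :=
    LipschitzWith.integrableOn_abs_rpow huL hp0 hΩb hmK hK.volume_lt_top
  have iu' : IntegrableOn (fun x => ‖fderiv ℝ u x‖ ^ p) Ω :=
    LipschitzWith.integrableOn_norm_fderiv_rpow huL hp0 hK.volume_lt_top
  have icB : IntegrableOn (fun _ => m) (ball (0 : Euc n) R) :=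
    integrableOn_const measure_ball_lt_top.ne
  have icK : IntegrableOn (fun _ => m) Ω := integrableOn_const hK.volume_lt_top.ne
  have hv_nonneg : 0 ≤ᵐ[volume.restrict (ball (0 : Euc n) R)] fun x => |v x| ^ p - m := by
    filter_upwards [ae_restrict_mem hmB] with x hx
    exact sub_nonneg.2 (hm_le _ (mem_image_of_mem _ (ball_subset_closedBall hx)))
  have hu_nonneg : 0 ≤ᵐ[volume.restrict Ω] fun x => |u x| ^ p - m :=
    Filter.Eventually.of_forall fun x => sub_nonneg.2 (hm_le _ (huv x))
  have hN : ∫ x in Ω, ‖fderiv ℝ u x‖ ^ p ≤ ∫ x in ball (0 : Euc n) R, ‖fderiv ℝ v x‖ ^ p :=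
    setIntegral_le_of_lintegral_le iu' iv'
      (Filter.Eventually.of_forall fun x => by positivity)
      (Filter.Eventually.of_forall fun x => by positivity) hgrad
  have hDD := setIntegral_le_of_lintegral_le (iu.sub icK) (iv.sub icB) hu_nonneg hv_nonneg
    (hcomp (fun t => ENNReal.ofReal (|t| ^ p - m))
      ((measurable_norm.pow_const p).sub_const m).ennreal_ofReal)
  have hDv := integral_nonneg_of_ae hv_nonneg
  have hDu := integral_nonneg_of_ae hu_nonneg
  simp only [Pi.sub_apply] at hDD
  rw [integral_sub iv icB, setIntegral_const, smul_eq_mul] at hDv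
  rw [integral_sub iu icK, setIntegral_const, smul_eq_mul] at hDu
  rw [integral_sub iv icB, integral_sub iu icK, setIntegral_const, setIntegral_const, smul_eq_mul,
    smul_eq_mul] at hDD
  have hvol : volume.real Ω ≤ volume.real (ball (0 : Euc n) R) := by
    have := hcomp (fun _ => 1) measurable_const
    rw [setLIntegral_one, setLIntegral_one] at this
    exact ENNReal.toReal_mono measure_ball_lt_top.ne this
  have hvol0 : 0 < volume.real Ω := hK.real_pos
  have hconst : ∀ (A : Set (Euc n)) (w : Euc n → ℝ), (∀ x ∈ frontier A, w x = a) →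
      ∫ x in frontier A, |w x| ^ p ∂μH[(n : ℝ) - 1] =
        (μH[(n : ℝ) - 1] (frontier A)).toReal * |a| ^ p := fun A w hw => by
    have : EqOn (fun x => |w x| ^ p) (fun _ => |a| ^ p) (frontier A) := fun x hx => by
      simp only [hw x hx]
    rw [setIntegral_congr_fun isClosed_frontier.measurableSet this, setIntegral_const,
      Measure.real, smul_eq_mul]
  have hbd : ∫ x in frontier Ω, |u x| ^ p ∂μH[(n : ℝ) - 1] =
      ∫ x in frontier (ball (0 : Euc n) R), |v x| ^ p ∂μH[(n : ℝ) - 1] := by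
    rw [hconst Ω u hua, hconst _ v hva, hH]
  have hle : robinEig n p β Ω ≤ rayleigh n p β Ω u :=
    csInf_le (hK.bddBelow_rayleigh hn1 hp1 hβ)
      ⟨u, ⟨L, huL.lipschitzOnWith⟩, by nlinarith [mul_pos hvol0 hm0], rfl⟩
  have hneg := hB.robinEig_nonpos hn1 hp1 hβ
  rw [← hray] at hneg ⊢
  rw [rayleigh, hbd] at hle
  rw [rayleigh] at hneg ⊢
  change (0 < 1 - m / _ * (volume.real (ball (0 : Euc n) R) - volume.real Ω) ∧
    1 - m / _ * (volume.real (ball (0 : Euc n) R) - volume.real Ω) ≤ 1) ∧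
    _ ≤ _ / (1 - m / _ * (volume.real (ball (0 : Euc n) R) - volume.real Ω))
  set D := ∫ x in ball (0 : Euc n) R, |v x| ^ p
  set D' := ∫ x in Ω, |u x| ^ p
  set S := ∫ x in frontier (ball (0 : Euc n) R), |v x| ^ p ∂μH[(n : ℝ) - 1]
  set N := ∫ x in ball (0 : Euc n) R, ‖fderiv ℝ v x‖ ^ p
  set N' := ∫ x in Ω, ‖fderiv ℝ u x‖ ^ p
  set V := volume.real (ball (0 : Euc n) R)
  set V' := volume.real Ω
  have hE : D * (1 - m / D * (V - V')) = D - m * (V - V') := by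
    field_simp
  have hq : 0 < 1 - m / D * (V - V') := by
    refine pos_of_mul_pos_right (a := D) ?_ hD.le
    rw [hE]
    nlinarith [mul_pos hvol0 hm0]
  refine ⟨⟨hq, sub_le_self _ (mul_nonneg (div_nonneg hm0.le hD.le) (sub_nonneg.2 hvol))⟩, ?_⟩
  have hD' : 0 < D' := by nlinarith [mul_pos hvol0 hm0]
  have hN0 : N + β * S ≤ 0 := by
    by_contra! hcon
    exact hneg.not_gt (div_pos hcon hD)
  calc robinEig n p β Ω ≤ (N' + β * S) / D' := hle
    _ ≤ (N + β * S) / D' := by gcongr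
    _ ≤ (N + β * S) / (D * (1 - m / D * (V - V'))) := by
        rw [div_le_div_iff₀ hD' (mul_pos hD hq)]
        refine mul_le_mul_of_nonpos_left ?_ hN0
        rw [hE]
        linarith
    _ = _ := (div_div _ _ _).symm
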